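/- Assume: (H1) f_i(0,…,0) = 0 for all i; (H2) ∂f_i/∂u_j ≥ 0 everywhere on [0,∞)^m for all i ≠ j; (H3) Σ_{j=1}^m (∂f_i/∂u_j)(0,…,0) ≤ 0 for all i; and (H4) every nontrivial, nonnegative, bounded solution of (C) is positive everywhere in ℝ^N_+ × ℝ. Then every nontrivial, nonnegative, bounded solution U = (u_1,…,u_m) of (C) is strictly increasing in x_1: ∂u_i/∂x_1(x,t) > 0 for all x ∈ ℝ^N_+, all t ∈ ℝ, and all i = 1,…,m. -/

import Mathlib

open Real Set Metric MeasureTheory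

/-- The Laplacian in the space variable, as the sum of second derivatives in
the coordinate directions. -/
noncomputable def lap {N : ℕ} (f : EuclideanSpace ℝ (Fin N) → ℝ)
    (x : EuclideanSpace ℝ (Fin N)) : ℝ :=
  ∑ i, iteratedFDeriv ℝ 2 f x ![EuclideanSpace.single i 1, EuclideanSpace.single i 1]

/-- A nonnegative bounded (classical) solution of the cooperative system (C) in the
half-space `ℝ^N_+ × ℝ` with homogeneous Dirichlet boundary conditions:
the components are `C^2` in `x` and `C^1` in `t` in the open half-space, continuous
up to the boundary, nonnegative and bounded, vanish on the boundary, and satisfy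
`∂_t u_i − Δu_i = f_i(u_1,…,u_m)` pointwise in the open half-space. -/
def IsBddNonnegSolC {N m : ℕ} (hN : 0 < N)
    (f : Fin m → (Fin m → ℝ) → ℝ)
    (u : Fin m → EuclideanSpace ℝ (Fin N) → ℝ → ℝ) : Prop :=
  (∀ i t, ContDiffOn ℝ 2 (fun x => u i x t)
      {x : EuclideanSpace ℝ (Fin N) | 0 < x ⟨0, hN⟩}) ∧
  (∀ i (x : EuclideanSpace ℝ (Fin N)), 0 < x ⟨0, hN⟩ →
      ContDiff ℝ 1 (fun t => u i x t)) ∧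
  (∀ i t, ContinuousOn (fun x => u i x t)
      {x : EuclideanSpace ℝ (Fin N) | 0 ≤ x ⟨0, hN⟩}) ∧
  (∀ i (x : EuclideanSpace ℝ (Fin N)) (t : ℝ), x ⟨0, hN⟩ = 0 → u i x t = 0) ∧
  (∀ i (x : EuclideanSpace ℝ (Fin N)) (t : ℝ), 0 < x ⟨0, hN⟩ → 0 ≤ u i x t) ∧
  (∃ C : ℝ, ∀ i (x : EuclideanSpace ℝ (Fin N)) (t : ℝ),
      0 < x ⟨0, hN⟩ → u i x t ≤ C) ∧
  (∀ i (x : EuclideanSpace ℝ (Fin N)) (t : ℝ), 0 < x ⟨0, hN⟩ →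
      deriv (fun s => u i x s) t - lap (fun y => u i y t) x
        = f i (fun j => u j x t))

/-- A solution is nontrivial if some component is not identically zero in the
open half-space. -/
def IsNontrivialC {N m : ℕ} (hN : 0 < N)
    (u : Fin m → EuclideanSpace ℝ (Fin N) → ℝ → ℝ) : Prop :=
  ∃ (i : Fin m) (x : EuclideanSpace ℝ (Fin N)) (t : ℝ), 0 < x ⟨0, hN⟩ ∧ u i x t ≠ 0

section

open Filter Topology

/-- Normalizing constant of the Gaussian density. -/
noncomputable def gaussConst (N : ℕ) : ℝ :=
  (∫ x : EuclideanSpace ℝ (Fin N), Real.exp (-(1 / 2) * ‖x‖ ^ 2))⁻¹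

/-- The standard Gaussian density on `ℝ^N`. -/
noncomputable def gaussDensity {N : ℕ} (x : EuclideanSpace ℝ (Fin N)) : ℝ :=
  gaussConst N * Real.exp (-(1 / 2) * ‖x‖ ^ 2)

theorem integrable_exp_neg_mul_sq_norm {N : ℕ} {b : ℝ} (hb : 0 < b) :
    Integrable (fun x : EuclideanSpace ℝ (Fin N) => Real.exp (-b * ‖x‖ ^ 2)) := by
  apply Integrable.of_integral_ne_zero
  rw [GaussianFourier.integral_rexp_neg_mul_sq_norm hb]
  positivity

theorem gaussConst_pos (N : ℕ) : 0 < gaussConst N := by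
  unfold gaussConst
  rw [GaussianFourier.integral_rexp_neg_mul_sq_norm (by norm_num)]
  positivity

theorem gaussDensity_pos {N : ℕ} (x : EuclideanSpace ℝ (Fin N)) : 0 < gaussDensity x :=
  mul_pos (gaussConst_pos N) (Real.exp_pos _)

theorem gaussDensity_le {N : ℕ} (x : EuclideanSpace ℝ (Fin N)) :
    gaussDensity x ≤ gaussConst N := by
  unfold gaussDensity
  have : Real.exp (-(1 / 2) * ‖x‖ ^ 2) ≤ 1 := by
    rw [Real.exp_le_one_iff]; nlinarith [sq_nonneg ‖x‖]
  nlinarith [gaussConst_pos N]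

theorem continuous_gaussDensity {N : ℕ} :
    Continuous (gaussDensity : EuclideanSpace ℝ (Fin N) → ℝ) := by
  unfold gaussDensity; fun_prop

theorem integrable_gaussDensity {N : ℕ} :
    Integrable (gaussDensity : EuclideanSpace ℝ (Fin N) → ℝ) :=
  (integrable_exp_neg_mul_sq_norm (by norm_num)).const_mul _

theorem integral_gaussDensity (N : ℕ) :
    ∫ x : EuclideanSpace ℝ (Fin N), gaussDensity x = 1 := by
  unfold gaussDensity
  rw [integral_const_mul]
  have := (gaussConst_pos N).ne'
  unfold gaussConst at this ⊢
  exact inv_mul_cancel₀ (by simpa using this)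

theorem integrable_norm_mul_gaussDensity {N : ℕ} :
    Integrable (fun x : EuclideanSpace ℝ (Fin N) => ‖x‖ * gaussDensity x) := by
  refine Integrable.mono' ((integrable_exp_neg_mul_sq_norm (N := N) (b := 1 / 4)
    (by norm_num)).const_mul (gaussConst N)) ?_ ?_
  · exact (continuous_norm.mul continuous_gaussDensity).aestronglyMeasurable
  · refine Eventually.of_forall fun x => ?_
    have h1 : ‖x‖ ≤ Real.exp (1 / 4 * ‖x‖ ^ 2) := by
      have := Real.add_one_le_exp (1 / 4 * ‖x‖ ^ 2)
      nlinarith [sq_nonneg (‖x‖ - 2)]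
    have h2 : Real.exp (1 / 4 * ‖x‖ ^ 2) * Real.exp (-(1 / 2) * ‖x‖ ^ 2)
        = Real.exp (-(1 / 4) * ‖x‖ ^ 2) := by
      rw [← Real.exp_add]; congr 1; ring
    rw [Real.norm_of_nonneg (mul_nonneg (norm_nonneg _) (gaussDensity_pos x).le)]
    unfold gaussDensity
    rw [← h2]
    have := gaussConst_pos N
    have h3 := Real.exp_pos (-(1 / 2) * ‖x‖ ^ 2)
    calc ‖x‖ * (gaussConst N * Real.exp (-(1 / 2) * ‖x‖ ^ 2))
        ≤ Real.exp (1 / 4 * ‖x‖ ^ 2) * (gaussConst N * Real.exp (-(1 / 2) * ‖x‖ ^ 2)) :=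
          mul_le_mul_of_nonneg_right h1 (by positivity)
      _ = _ := by ring

theorem hasFDerivAt_gaussDensity {N : ℕ} (x : EuclideanSpace ℝ (Fin N)) :
    HasFDerivAt gaussDensity (-(gaussDensity x) • innerSL ℝ x) x := by
  have h1 : HasFDerivAt (fun y : EuclideanSpace ℝ (Fin N) => ‖y‖ ^ 2) (2 • innerSL ℝ x) x :=
    (hasStrictFDerivAt_norm_sq x).hasFDerivAt
  have h2 := ((h1.const_mul (-(1 / 2))).exp).const_mul (gaussConst N)
  unfold gaussDensity
  refine h2.congr_fderiv ?_
  ext y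
  simp
  ring

/-- The standard Gaussian measure on `ℝ^N`. -/
noncomputable def gaussMeas (N : ℕ) : Measure (EuclideanSpace ℝ (Fin N)) :=
  volume.withDensity (fun x => ENNReal.ofReal (gaussDensity x))

theorem integral_gaussMeas {N : ℕ} (g : EuclideanSpace ℝ (Fin N) → ℝ) :
    ∫ x, g x ∂(gaussMeas N) = ∫ x, gaussDensity x * g x := by
  unfold gaussMeas
  rw [integral_withDensity_eq_integral_toReal_smul
    (continuous_gaussDensity.measurable.ennreal_ofReal) (by simp)]
  simp [ENNReal.toReal_ofReal (gaussDensity_pos _).le]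

theorem integrable_gaussMeas_iff {N : ℕ} (g : EuclideanSpace ℝ (Fin N) → ℝ) :
    Integrable g (gaussMeas N) ↔ Integrable (fun x => gaussDensity x * g x) := by
  unfold gaussMeas
  rw [integrable_withDensity_iff_integrable_smul'
    (continuous_gaussDensity.measurable.ennreal_ofReal) (by simp)]
  simp [ENNReal.toReal_ofReal (gaussDensity_pos _).le]

instance isProbabilityMeasure_gaussMeas (N : ℕ) : IsProbabilityMeasure (gaussMeas N) := by
  constructor
  unfold gaussMeas
  rw [withDensity_apply _ MeasurableSet.univ, Measure.restrict_univ,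
    ← ofReal_integral_eq_lintegral_ofReal integrable_gaussDensity
      (Eventually.of_forall fun x => (gaussDensity_pos x).le), integral_gaussDensity]
  simp

theorem integrable_norm_gaussMeas {N : ℕ} :
    Integrable (fun x : EuclideanSpace ℝ (Fin N) => ‖x‖) (gaussMeas N) := by
  rw [integrable_gaussMeas_iff]
  simpa only [mul_comm] using integrable_norm_mul_gaussDensity

/-- Gaussian integration by parts. -/
theorem gaussMeas_integral_inner_mul {N : ℕ} {φ : EuclideanSpace ℝ (Fin N) → ℝ}
    (hφ : ContDiff ℝ 1 φ) {C : ℝ} (hC : ∀ x, |φ x| ≤ C) {C' : ℝ}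
    (hC' : ∀ x, ‖fderiv ℝ φ x‖ ≤ C') (e : EuclideanSpace ℝ (Fin N)) :
    ∫ x, inner ℝ e x * φ x ∂(gaussMeas N) = ∫ x, fderiv ℝ φ x e ∂(gaussMeas N) := by
  have hcont' : Continuous (fun x => fderiv ℝ φ x e) :=
    (hφ.continuous_fderiv (by norm_num)).clm_apply continuous_const
  have hG : ∀ x, fderiv ℝ gaussDensity x e = -(gaussDensity x) * inner ℝ e x := by
    intro x
    rw [(hasFDerivAt_gaussDensity x).fderiv]
    simp [real_inner_comm]
  have key := integral_mul_fderiv_eq_neg_fderiv_mul_of_integrable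
    (μ := (volume : Measure (EuclideanSpace ℝ (Fin N)))) (f := φ) (g := gaussDensity) (v := e)
    ?_ ?_ ?_ (fun x _ => hφ.differentiable (by norm_num) x)
    (fun x _ => (hasFDerivAt_gaussDensity x).differentiableAt)
  · rw [integral_gaussMeas, integral_gaussMeas]
    simp only [hG] at key
    have h1 : ∀ x, φ x * (-gaussDensity x * inner ℝ e x)
        = -(gaussDensity x * (inner ℝ e x * φ x)) := fun x => by ring
    simp only [h1, integral_neg, neg_inj] at key
    rw [key]
    congr 1; ext x; ring
  · refine Integrable.mono' (integrable_gaussDensity.const_mul (C' * ‖e‖))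
      (hcont'.mul continuous_gaussDensity).aestronglyMeasurable
      (Eventually.of_forall fun x => ?_)
    rw [norm_mul, Real.norm_of_nonneg (gaussDensity_pos x).le]
    exact mul_le_mul_of_nonneg_right ((ContinuousLinearMap.le_opNorm _ _).trans
      (mul_le_mul_of_nonneg_right (hC' x) (norm_nonneg _))) (gaussDensity_pos x).le
  · simp only [hG]
    refine Integrable.mono' (integrable_norm_mul_gaussDensity.const_mul (C * ‖e‖)) ?_
      (Eventually.of_forall fun x => ?_)
    · exact (hφ.continuous.mul (continuous_gaussDensity.neg.mul
        (continuous_const.inner continuous_id))).aestronglyMeasurable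
    · rw [norm_mul, norm_mul, norm_neg, Real.norm_of_nonneg (gaussDensity_pos x).le,
        Real.norm_eq_abs]
      have h1 := hC x
      have h2 := norm_inner_le_norm (𝕜 := ℝ) e x
      have h0 : 0 ≤ C := (abs_nonneg _).trans h1
      calc |φ x| * (gaussDensity x * ‖inner ℝ e x‖)
          ≤ C * (gaussDensity x * (‖e‖ * ‖x‖)) := by
            have := (gaussDensity_pos x).le
            gcongr
        _ = _ := by ring
  · refine Integrable.mono' (integrable_gaussDensity.const_mul C)
      (hφ.continuous.mul continuous_gaussDensity).aestronglyMeasurable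
      (Eventually.of_forall fun x => ?_)
    rw [norm_mul, Real.norm_of_nonneg (gaussDensity_pos x).le]
    exact mul_le_mul_of_nonneg_right (hC x) (gaussDensity_pos x).le

theorem gaussDensity_isometry {N : ℕ}
    (σ : EuclideanSpace ℝ (Fin N) ≃ₗᵢ[ℝ] EuclideanSpace ℝ (Fin N))
    (x : EuclideanSpace ℝ (Fin N)) : gaussDensity (σ x) = gaussDensity x := by
  simp [gaussDensity]

theorem measurePreserving_gaussMeas {N : ℕ}
    (σ : EuclideanSpace ℝ (Fin N) ≃ₗᵢ[ℝ] EuclideanSpace ℝ (Fin N)) :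
    MeasurePreserving σ (gaussMeas N) (gaussMeas N) := by
  refine ⟨σ.continuous.measurable, ?_⟩
  ext s hs
  have hσ := σ.measurePreserving
  rw [Measure.map_apply σ.continuous.measurable hs]
  unfold gaussMeas
  rw [withDensity_apply _ hs, withDensity_apply _ (σ.continuous.measurable hs),
    ← hσ.setLIntegral_comp_preimage hs continuous_gaussDensity.measurable.ennreal_ofReal]
  simp [gaussDensity_isometry]

/-- The exponential law on `(0, ∞)`. -/
noncomputable def expLaw : Measure ℝ :=
  (volume.restrict (Ioi 0)).withDensity (fun s => ENNReal.ofReal (Real.exp (-s)))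

theorem integral_expLaw (g : ℝ → ℝ) :
    ∫ s, g s ∂expLaw = ∫ s in Ioi (0 : ℝ), Real.exp (-s) * g s := by
  unfold expLaw
  rw [integral_withDensity_eq_integral_toReal_smul
    (by fun_prop) (by simp)]
  simp [ENNReal.toReal_ofReal (Real.exp_pos _).le]

theorem integrable_expLaw_iff (g : ℝ → ℝ) :
    Integrable g expLaw ↔ IntegrableOn (fun s => Real.exp (-s) * g s) (Ioi 0) := by
  unfold expLaw
  rw [integrable_withDensity_iff_integrable_smul'
    (by fun_prop) (by simp)]
  simp [ENNReal.toReal_ofReal (Real.exp_pos _).le, IntegrableOn]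

instance isProbabilityMeasure_expLaw : IsProbabilityMeasure expLaw := by
  constructor
  unfold expLaw
  rw [withDensity_apply _ MeasurableSet.univ, Measure.restrict_univ,
    ← ofReal_integral_eq_lintegral_ofReal (integrableOn_exp_neg_Ioi 0)
      (Eventually.of_forall fun x => (Real.exp_pos _).le), integral_exp_neg_Ioi]
  simp

theorem ae_expLaw_pos : ∀ᵐ s ∂expLaw, 0 < s := by
  have h : ∀ᵐ s ∂(volume.restrict (Ioi (0 : ℝ))), 0 < s :=
    ae_restrict_mem measurableSet_Ioi
  exact (withDensity_absolutelyContinuous _ _).ae_le h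

theorem integrable_inv_sqrt_expLaw : Integrable (fun s => (√(2 * s))⁻¹) expLaw := by
  rw [integrable_expLaw_iff]
  have h := Real.GammaIntegral_convergent (s := 1 / 2) (by norm_num)
  refine IntegrableOn.congr_fun (Integrable.const_mul h (√2)⁻¹) (fun s hs => ?_)
    measurableSet_Ioi
  have hs : 0 < s := hs
  rw [Real.sqrt_mul (by norm_num), mul_inv, Real.sqrt_eq_rpow s, ← Real.rpow_neg hs.le]
  norm_num
  ring

/-- The joint law of the time and space displacements of the resolvent. -/
noncomputable def resLaw (N : ℕ) : Measure (ℝ × EuclideanSpace ℝ (Fin N)) :=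
  expLaw.prod (gaussMeas N)

instance isProbabilityMeasure_resLaw (N : ℕ) : IsProbabilityMeasure (resLaw N) := by
  unfold resLaw; infer_instance

/-- Parabolic displacement. -/
noncomputable def disp {N : ℕ} (p : ℝ × EuclideanSpace ℝ (Fin N)) :
    EuclideanSpace ℝ (Fin N) × ℝ :=
  (√(2 * p.1) • p.2, p.1)

theorem continuous_disp {N : ℕ} :
    Continuous (disp : ℝ × EuclideanSpace ℝ (Fin N) → EuclideanSpace ℝ (Fin N) × ℝ) := by
  unfold disp; fun_prop

/-- Weighted average of `h` along parabolic displacements. -/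
noncomputable def wres {N : ℕ} (W : ℝ × EuclideanSpace ℝ (Fin N) → ℝ)
    (h : EuclideanSpace ℝ (Fin N) × ℝ → ℝ) (z : EuclideanSpace ℝ (Fin N) × ℝ) : ℝ :=
  ∫ p, W p * h (z - disp p) ∂(resLaw N)

/-- The resolvent `(∂_t - Δ + 1)⁻¹`. -/
noncomputable def resolv {N : ℕ} (h : EuclideanSpace ℝ (Fin N) × ℝ → ℝ)
    (z : EuclideanSpace ℝ (Fin N) × ℝ) : ℝ :=
  wres (fun _ => 1) h z

/-- The weight representing the derivative of the resolvent in the direction `e`. -/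
noncomputable def gradWeight {N : ℕ} (e : EuclideanSpace ℝ (Fin N))
    (p : ℝ × EuclideanSpace ℝ (Fin N)) : ℝ :=
  -((√(2 * p.1))⁻¹ * inner ℝ e p.2)

theorem integrable_gradWeight {N : ℕ} (e : EuclideanSpace ℝ (Fin N)) :
    Integrable (gradWeight e) (resLaw N) := by
  unfold gradWeight resLaw
  refine (Integrable.mul_prod (f := fun s : ℝ => (√(2 * s))⁻¹)
    (g := fun x : EuclideanSpace ℝ (Fin N) => inner ℝ e x) integrable_inv_sqrt_expLaw ?_).neg
  refine (integrable_norm_gaussMeas.const_mul ‖e‖).mono' ?_ (Eventually.of_forall fun x => ?_)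
  · exact (continuous_const.inner continuous_id).aestronglyMeasurable
  · exact norm_inner_le_norm e x

section wres

variable {N : ℕ} {W : ℝ × EuclideanSpace ℝ (Fin N) → ℝ}
  {h h₁ h₂ : EuclideanSpace ℝ (Fin N) × ℝ → ℝ}

theorem integrable_wres (hW : Integrable W (resLaw N)) (hc : Continuous h) {C : ℝ}
    (hC : ∀ z, |h z| ≤ C) (z : EuclideanSpace ℝ (Fin N) × ℝ) :
    Integrable (fun p => W p * h (z - disp p)) (resLaw N) := by
  refine hW.mul_bdd (c := C) ?_ (Eventually.of_forall fun p => hC _)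
  exact (hc.comp (continuous_const.sub continuous_disp)).aestronglyMeasurable

theorem abs_wres_le (hW : Integrable W (resLaw N)) {C : ℝ}
    (hC : ∀ z, |h z| ≤ C) (z : EuclideanSpace ℝ (Fin N) × ℝ) :
    |wres W h z| ≤ (∫ p, |W p| ∂(resLaw N)) * C := by
  unfold wres
  rw [← integral_mul_const, ← Real.norm_eq_abs]
  refine norm_integral_le_of_norm_le (hW.abs.mul_const C) (Eventually.of_forall fun p => ?_)
  rw [norm_mul]
  exact mul_le_mul_of_nonneg_left (hC _) (norm_nonneg _)

theorem abs_resolv_le {C : ℝ} (hC : ∀ z, |h z| ≤ C) (z : EuclideanSpace ℝ (Fin N) × ℝ) :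
    |resolv h z| ≤ C := by
  simpa [resolv] using abs_wres_le (W := fun _ => 1) (integrable_const _) hC z

theorem wres_add (hW : Integrable W (resLaw N)) (hc₁ : Continuous h₁) (hc₂ : Continuous h₂)
    {C₁ C₂ : ℝ} (hC₁ : ∀ z, |h₁ z| ≤ C₁) (hC₂ : ∀ z, |h₂ z| ≤ C₂)
    (z : EuclideanSpace ℝ (Fin N) × ℝ) :
    wres W (fun z => h₁ z + h₂ z) z = wres W h₁ z + wres W h₂ z := by
  unfold wres
  rw [← integral_add (integrable_wres hW hc₁ hC₁ z) (integrable_wres hW hc₂ hC₂ z)]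
  simp only [mul_add]

theorem wres_neg (z : EuclideanSpace ℝ (Fin N) × ℝ) :
    wres W (fun z => - h z) z = - wres W h z := by
  unfold wres
  rw [← integral_neg]
  simp only [mul_neg]

theorem wres_translate (a z : EuclideanSpace ℝ (Fin N) × ℝ) :
    wres W (fun z => h (z + a)) z = wres W h (z + a) := by
  unfold wres
  simp only [sub_add_eq_add_sub]

theorem resolv_mono (hc₁ : Continuous h₁) (hc₂ : Continuous h₂)
    {C₁ C₂ : ℝ} (hC₁ : ∀ z, |h₁ z| ≤ C₁) (hC₂ : ∀ z, |h₂ z| ≤ C₂) (hle : ∀ z, h₁ z ≤ h₂ z)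
    (z : EuclideanSpace ℝ (Fin N) × ℝ) : resolv h₁ z ≤ resolv h₂ z := by
  refine integral_mono (integrable_wres (integrable_const _) hc₁ hC₁ z)
    (integrable_wres (integrable_const _) hc₂ hC₂ z) fun p => ?_
  simpa using hle _

theorem continuous_wres (hW : Integrable W (resLaw N)) (hc : Continuous h) {C : ℝ}
    (hC : ∀ z, |h z| ≤ C) : Continuous (wres W h) := by
  unfold wres
  refine continuous_of_dominated (bound := fun p => |W p| * C)
    (fun z => (integrable_wres hW hc hC z).aestronglyMeasurable)
    (fun z => Eventually.of_forall fun p => ?_) (hW.abs.mul_const C)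
    (Eventually.of_forall fun p => by fun_prop)
  rw [norm_mul]
  exact mul_le_mul_of_nonneg_left (hC _) (norm_nonneg _)

theorem tendsto_wres (hW : Integrable W (resLaw N))
    {H : ℕ → EuclideanSpace ℝ (Fin N) × ℝ → ℝ} (hc : ∀ n, Continuous (H n)) {C : ℝ}
    (hC : ∀ n z, |H n z| ≤ C) (hlim : ∀ z, Tendsto (fun n => H n z) atTop (𝓝 (h z)))
    (z : EuclideanSpace ℝ (Fin N) × ℝ) :
    Tendsto (fun n => wres W (H n) z) atTop (𝓝 (wres W h z)) := by
  unfold wres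
  refine tendsto_integral_of_dominated_convergence (fun p => |W p| * C)
    (fun n => (integrable_wres hW (hc n) (hC n) z).aestronglyMeasurable)
    (hW.abs.mul_const C) (fun n => Eventually.of_forall fun p => ?_)
    (Eventually.of_forall fun p => (hlim _).const_mul _)
  rw [norm_mul]
  exact mul_le_mul_of_nonneg_left (hC _ _) (norm_nonneg _)

theorem hasFDerivAt_wres (hW : Integrable W (resLaw N)) (hd : ContDiff ℝ 1 h) {C C' : ℝ}
    (hC : ∀ z, |h z| ≤ C) (hC' : ∀ z, ‖fderiv ℝ h z‖ ≤ C') (z : EuclideanSpace ℝ (Fin N) × ℝ) :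
    HasFDerivAt (wres W h) (∫ p, W p • fderiv ℝ h (z - disp p) ∂(resLaw N)) z := by
  have hcf : Continuous (fderiv ℝ h) := hd.continuous_fderiv (by norm_num)
  unfold wres
  refine hasFDerivAt_integral_of_dominated_of_fderiv_le (𝕜 := ℝ)
    (F' := fun z p => W p • fderiv ℝ h (z - disp p)) (s := univ)
    (bound := fun p => |W p| * C') Filter.univ_mem
    (Eventually.of_forall fun z => (integrable_wres hW hd.continuous hC z).aestronglyMeasurable)
    (integrable_wres hW hd.continuous hC z) ?_ (Eventually.of_forall fun p z _ => ?_)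
    (hW.abs.mul_const C') (Eventually.of_forall fun p z _ => ?_)
  · exact hW.aestronglyMeasurable.smul
      (hcf.comp (continuous_const.sub continuous_disp)).aestronglyMeasurable
  · rw [norm_smul]
    exact mul_le_mul_of_nonneg_left (hC' _) (norm_nonneg _)
  · have h1 := (hd.differentiable (by norm_num) (z - disp p)).hasFDerivAt
    have h2 : HasFDerivAt (fun z : EuclideanSpace ℝ (Fin N) × ℝ => z - disp p)
      (ContinuousLinearMap.id ℝ (EuclideanSpace ℝ (Fin N) × ℝ)) z :=
      (hasFDerivAt_id z).sub_const _
    exact (h1.comp z h2).const_mul (W p)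

theorem fderiv_wres (hW : Integrable W (resLaw N)) (hd : ContDiff ℝ 1 h) {C C' : ℝ}
    (hC : ∀ z, |h z| ≤ C) (hC' : ∀ z, ‖fderiv ℝ h z‖ ≤ C')
    (z v : EuclideanSpace ℝ (Fin N) × ℝ) :
    fderiv ℝ (wres W h) z v = wres W (fun z => fderiv ℝ h z v) z := by
  rw [(hasFDerivAt_wres hW hd hC hC' z).fderiv, ContinuousLinearMap.integral_apply]
  · rfl
  · refine hW.smul_bdd C' ?_ (Eventually.of_forall fun p => hC' _)
    exact ((hd.continuous_fderiv (by norm_num)).comp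
      (continuous_const.sub continuous_disp)).aestronglyMeasurable

end wres

theorem disp_isometry {N : ℕ} (σ : EuclideanSpace ℝ (Fin N) ≃ₗᵢ[ℝ] EuclideanSpace ℝ (Fin N))
    (p : ℝ × EuclideanSpace ℝ (Fin N)) :
    disp (p.1, σ p.2) = (σ (disp p).1, (disp p).2) := by
  simp [disp]

theorem resolv_isometry {N : ℕ} (σ : EuclideanSpace ℝ (Fin N) ≃ₗᵢ[ℝ] EuclideanSpace ℝ (Fin N))
    {h : EuclideanSpace ℝ (Fin N) × ℝ → ℝ}
    (z : EuclideanSpace ℝ (Fin N) × ℝ) :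
    resolv (fun z => h (σ z.1, z.2)) z = resolv h (σ z.1, z.2) := by
  unfold resolv wres
  have hmp : MeasurePreserving (Prod.map (id : ℝ → ℝ) σ) (resLaw N) (resLaw N) :=
    (MeasurePreserving.id _).prod (measurePreserving_gaussMeas σ)
  have hemb : MeasurableEmbedding (Prod.map (id : ℝ → ℝ) σ) :=
    MeasurableEmbedding.prodMap MeasurableEmbedding.id
      σ.toHomeomorph.toMeasurableEquiv.measurableEmbedding
  have hI := hmp.integral_comp hemb (fun p => 1 * h ((σ z.1, z.2) - disp p))
  rw [← hI]
  congr 1; ext p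
  have := disp_isometry σ p
  simp only [Prod.map, id]
  rw [this]
  simp [Prod.sub_def]

theorem integral_gaussMeas_comp_smul_le {N : ℕ} {h : EuclideanSpace ℝ (Fin N) → ℝ}
    (h0 : ∀ x, 0 ≤ h x) (hi : Integrable h) {r : ℝ} (hr : 0 < r) (x : EuclideanSpace ℝ (Fin N)) :
    ∫ ξ, h (x - r • ξ) ∂(gaussMeas N) ≤ gaussConst N * (r ^ N)⁻¹ * ∫ y, h y := by
  have hi' : Integrable (fun y => h (x - y)) := hi.comp_sub_left x
  have hi2 : Integrable (fun y => h (x - r • y)) := hi'.comp_smul hr.ne'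
  have h1 : ∫ ξ, h (x - r • ξ) = (r ^ N)⁻¹ * ∫ y, h y := by
    have h2 := Measure.integral_comp_smul (volume : Measure (EuclideanSpace ℝ (Fin N)))
      (fun y => h (x - y)) r
    rw [h2, integral_sub_left_eq_self h]
    simp [abs_of_pos hr]
  rw [mul_assoc, ← h1, integral_gaussMeas, ← integral_const_mul]
  refine integral_mono_of_nonneg (Eventually.of_forall fun ξ =>
    mul_nonneg (gaussDensity_pos ξ).le (h0 _)) (hi2.const_mul _) (Eventually.of_forall fun ξ => ?_)
  exact mul_le_mul_of_nonneg_right (gaussDensity_le ξ) (h0 _)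

theorem resolv_le_of_integrable {N : ℕ} {h : EuclideanSpace ℝ (Fin N) × ℝ → ℝ}
    (hc : Continuous h) (h0 : ∀ z, 0 ≤ h z) {M : ℝ} (hM : ∀ z, h z ≤ M)
    (hi : Integrable h (volume.prod volume)) {ε : ℝ} (hε : 0 < ε)
    (z : EuclideanSpace ℝ (Fin N) × ℝ) :
    resolv h z ≤ ε * M + gaussConst N * (√(2 * ε) ^ N)⁻¹ * ∫ y, h y ∂(volume.prod volume) := by
  obtain ⟨x, t⟩ := z
  have hM0 : 0 ≤ M := (h0 0).trans (hM 0)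
  have habs : ∀ z, |h z| ≤ M := fun z => by rw [abs_of_nonneg (h0 z)]; exact hM z
  set c : ℝ := gaussConst N * (√(2 * ε) ^ N)⁻¹ with hc_def
  have hc0 : 0 ≤ c := mul_nonneg (gaussConst_pos N).le (by positivity)
  have h_int := integrable_wres (W := fun _ => 1) (integrable_const _) hc habs (x, t)
  have hHi : Integrable (fun τ => ∫ y, h (y, τ)) := hi.integral_prod_right
  have hH0 : ∀ τ, 0 ≤ ∫ y, h (y, τ) := fun τ => integral_nonneg fun y => h0 _
  have hae : ∀ᵐ s : ℝ, Integrable (fun y => h (y, t - s)) := by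
    have hmp := Measure.measurePreserving_sub_left (volume : Measure ℝ) t
    exact hmp.quasiMeasurePreserving.ae hi.prod_left_ae
  have hG : ∀ s, ∫ ξ, 1 * h ((x, t) - disp (s, ξ)) ∂(gaussMeas N) ≤ M := fun s => by
    calc _ ≤ ∫ ξ : EuclideanSpace ℝ (Fin N), M ∂(gaussMeas N) :=
          integral_mono_of_nonneg (Eventually.of_forall fun ξ => by simpa using h0 _)
            (integrable_const _) (Eventually.of_forall fun ξ => by simpa using hM _)
      _ = M := by simp
  have hG0 : ∀ s, 0 ≤ ∫ ξ, 1 * h ((x, t) - disp (s, ξ)) ∂(gaussMeas N) := fun s =>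
    integral_nonneg fun ξ => by simpa using h0 _
  have hstep : resolv h (x, t) = ∫ s in Ioi (0 : ℝ), Real.exp (-s) *
      ∫ ξ, 1 * h ((x, t) - disp (s, ξ)) ∂(gaussMeas N) := by
    unfold resolv wres resLaw
    rw [integral_prod _ h_int, integral_expLaw]
  have hHt : Integrable (fun s => ∫ y, h (y, t - s)) := hHi.comp_sub_left t
  rw [hstep]
  calc _ ≤ ∫ s in Ioi (0 : ℝ), ((Iic ε).indicator (fun _ => M) s + c * ∫ y, h (y, t - s)) := by
        refine integral_mono_of_nonneg (Eventually.of_forall fun s =>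
          mul_nonneg (Real.exp_pos _).le (hG0 s)) ?_ ?_
        · refine Integrable.add ?_ (hHt.const_mul c).integrableOn
          rw [integrable_indicator_iff measurableSet_Iic, IntegrableOn,
            Measure.restrict_restrict measurableSet_Iic, Iic_inter_Ioi]
          exact integrableOn_const (by simp)
        · filter_upwards [ae_restrict_mem measurableSet_Ioi, ae_restrict_of_ae hae] with s hs hsi
          have hs : 0 < s := hs
          have he : Real.exp (-s) ≤ 1 := by rw [Real.exp_le_one_iff]; linarith
          have h1 : Real.exp (-s) * ∫ ξ, 1 * h ((x, t) - disp (s, ξ)) ∂(gaussMeas N) ≤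
              ∫ ξ, 1 * h ((x, t) - disp (s, ξ)) ∂(gaussMeas N) :=
            mul_le_of_le_one_left (hG0 s) he
          refine h1.trans ?_
          by_cases hsε : s ≤ ε
          · rw [indicator_of_mem (show s ∈ Iic ε from hsε)]
            exact (hG s).trans (le_add_of_nonneg_right (mul_nonneg hc0 (hH0 _)))
          · rw [indicator_of_notMem (show s ∉ Iic ε from hsε), zero_add]
            push Not at hsε
            have h2 := integral_gaussMeas_comp_smul_le (h := fun y => h (y, t - s))
              (fun y => h0 _) hsi (r := √(2 * s)) (by positivity) x
            simp only [disp, one_mul, Prod.mk_sub_mk]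
            refine h2.trans (mul_le_mul_of_nonneg_right ?_ (hH0 _))
            refine mul_le_mul_of_nonneg_left ?_ (gaussConst_pos N).le
            gcongr
    _ = ε * M + c * ∫ s in Ioi (0 : ℝ), ∫ y, h (y, t - s) := by
        rw [integral_add, integral_const_mul, integral_indicator measurableSet_Iic,
          Measure.restrict_restrict measurableSet_Iic, Iic_inter_Ioi]
        · simp [hε.le]
        · rw [integrable_indicator_iff measurableSet_Iic, IntegrableOn,
            Measure.restrict_restrict measurableSet_Iic, Iic_inter_Ioi]
          exact integrableOn_const (by simp)
        · exact (hHt.const_mul c).integrableOn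
    _ ≤ ε * M + c * ∫ y, h y ∂(volume.prod volume) := by
        gcongr
        calc _ ≤ ∫ s, ∫ y, h (y, t - s) := setIntegral_le_integral hHt
              (Eventually.of_forall fun s => hH0 _)
          _ = ∫ s, ∫ y, h (y, s) := integral_sub_left_eq_self (fun s => ∫ y, h (y, s)) volume t
          _ = _ := (integral_prod_symm h hi).symm

/-- `φ` is twice differentiable at `0`, with first derivative `p` and second derivative `l`. -/
def Jet (φ : ℝ → ℝ) (p l : ℝ) : Prop :=
  (∀ᶠ r in 𝓝 0, DifferentiableAt ℝ φ r) ∧ deriv φ 0 = p ∧ HasDerivAt (deriv φ) l 0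

section Jet

variable {φ ψ φ' : ℝ → ℝ} {p q l k c : ℝ}

theorem Jet.of_hasDerivAt (h : ∀ᶠ r in 𝓝 0, HasDerivAt φ (φ' r) r) (h0 : φ' 0 = p)
    (h' : HasDerivAt φ' l 0) : Jet φ p l := by
  have he : deriv φ =ᶠ[𝓝 0] φ' := h.mono fun r hr => hr.deriv
  exact ⟨h.mono fun r hr => hr.differentiableAt, by rw [he.eq_of_nhds, h0],
    h'.congr_of_eventuallyEq he⟩

theorem Jet.eventually (h : Jet φ p l) : ∀ᶠ r in 𝓝 0, HasDerivAt φ (deriv φ r) r :=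
  h.1.mono fun _ hr => hr.hasDerivAt

theorem Jet.hasDerivAt (h : Jet φ p l) : HasDerivAt φ p 0 :=
  h.2.1 ▸ h.eventually.self_of_nhds

theorem Jet.congr (h : Jet φ p l) (he : ψ =ᶠ[𝓝 0] φ) : Jet ψ p l := by
  refine Jet.of_hasDerivAt (φ' := deriv φ) ?_ h.2.1 h.2.2
  filter_upwards [h.eventually, he.eventually_nhds] with r hr hr'
  exact hr.congr_of_eventuallyEq hr'

theorem Jet.unique (h : Jet φ p l) (h' : Jet φ q k) : p = q ∧ l = k :=
  ⟨h.2.1.symm.trans h'.2.1, h.2.2.unique h'.2.2⟩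

theorem Jet.add (h : Jet φ p l) (h' : Jet ψ q k) : Jet (fun r => φ r + ψ r) (p + q) (l + k) := by
  refine Jet.of_hasDerivAt (φ' := fun r => deriv φ r + deriv ψ r) ?_ ?_ (h.2.2.add h'.2.2)
  · filter_upwards [h.eventually, h'.eventually] with r hr hr' using hr.add hr'
  · rw [h.2.1, h'.2.1]

theorem Jet.const_mul (c : ℝ) (h : Jet φ p l) : Jet (fun r => c * φ r) (c * p) (c * l) := by
  refine Jet.of_hasDerivAt (φ' := fun r => c * deriv φ r) ?_ ?_ (h.2.2.const_mul c)
  · filter_upwards [h.eventually] with r hr using hr.const_mul c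
  · rw [h.2.1]

theorem Jet.const (c : ℝ) : Jet (fun _ => c) 0 0 :=
  Jet.of_hasDerivAt (φ' := fun _ => 0) (Eventually.of_forall fun r => hasDerivAt_const r c) rfl
    (hasDerivAt_const _ _)

theorem Jet.comp {Φ Φ' : ℝ → ℝ} (h : Jet φ p l) (hΦ : ∀ y, HasDerivAt Φ (Φ' y) y)
    (hΦ' : HasDerivAt Φ' k (φ 0)) :
    Jet (fun r => Φ (φ r)) (Φ' (φ 0) * p) (k * p ^ 2 + Φ' (φ 0) * l) := by
  refine Jet.of_hasDerivAt (φ' := fun r => Φ' (φ r) * deriv φ r) ?_ ?_ ?_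
  · filter_upwards [h.eventually] with r hr using (hΦ _).comp r hr
  · rw [h.2.1]
  · have h1 := (hΦ'.comp 0 h.hasDerivAt).mul h.2.2
    refine h1.congr_deriv ?_
    rw [h.2.1]; simp; ring

theorem Jet.comp_neg (h : Jet φ p l) : Jet (fun r => φ (-r)) (-p) l := by
  refine Jet.of_hasDerivAt (φ' := fun r => - deriv φ (-r)) ?_ ?_ ?_
  · have ht : Tendsto (fun r : ℝ => -r) (𝓝 0) (𝓝 0) := by
      simpa using (continuous_neg (G := ℝ)).tendsto 0
    filter_upwards [ht.eventually h.eventually] with r hr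
    exact (hr.scomp r (hasDerivAt_neg r)).congr_deriv (by simp)
  · simp [h.2.1]
  · have h2 : HasDerivAt (deriv φ) l (-0) := by simpa using h.2.2
    exact (h2.scomp 0 (hasDerivAt_neg 0)).neg.congr_deriv (by simp)

theorem Jet.of_isLocalMax (h : Jet φ p l) (hm : IsLocalMax φ 0) : p = 0 ∧ l ≤ 0 := by
  have hp : p = 0 := hm.hasDerivAt_eq_zero h.hasDerivAt
  refine ⟨hp, ?_⟩
  by_contra! hl
  have hmin : IsLocalMin φ 0 := isLocalMin_of_deriv_deriv_pos (by rw [h.2.2.deriv]; exact hl)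
    (by rw [h.2.1, hp]) h.hasDerivAt.continuousAt
  have hconst : φ =ᶠ[𝓝 0] fun _ => φ 0 := by
    filter_upwards [hm, hmin] with r h1 h2 using le_antisymm h1 h2
  have := (h.unique ((Jet.const (φ 0)).congr hconst)).2
  linarith

theorem Jet.quadratic (a b c : ℝ) : Jet (fun r => a + b * r + c * r ^ 2) b (2 * c) := by
  refine Jet.of_hasDerivAt (φ' := fun r => b + 2 * c * r) (Eventually.of_forall fun r => ?_)
    (by simp) ?_
  · have h1 := ((hasDerivAt_id r).const_mul b).const_add a
    have h2 := ((hasDerivAt_id r).pow 2).const_mul c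
    exact (h1.add h2).congr_deriv (by simp; ring)
  · simpa using ((hasDerivAt_id (0 : ℝ)).const_mul (2 * c)).const_add b

end Jet

/-- Coordinate vectors. -/
noncomputable def ee {N : ℕ} (i : Fin N) : EuclideanSpace ℝ (Fin N) := EuclideanSpace.single i 1

@[simp] theorem norm_ee {N : ℕ} (i : Fin N) : ‖ee i‖ = 1 := by simp [ee]

theorem ee_apply {N : ℕ} (i j : Fin N) : (ee i) j = if j = i then 1 else 0 := by
  simp [ee]

@[simp] theorem ee_self {N : ℕ} (i : Fin N) : (ee i) i = 1 := by simp [ee_apply]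

/-- `F` has time derivative `τ`, and first and second coordinate derivatives `p i`, `l i`
at `z`. -/
def HasJet {N : ℕ} (F : EuclideanSpace ℝ (Fin N) × ℝ → ℝ) (z : EuclideanSpace ℝ (Fin N) × ℝ)
    (τ : ℝ) (p l : Fin N → ℝ) : Prop :=
  HasDerivAt (fun s => F (z.1, z.2 + s)) τ 0 ∧
    ∀ i, Jet (fun r => F (z.1 + r • ee i, z.2)) (p i) (l i)

/-- `∂_t F - Δ F = a` at `z`. -/
def HasHeat {N : ℕ} (F : EuclideanSpace ℝ (Fin N) × ℝ → ℝ) (z : EuclideanSpace ℝ (Fin N) × ℝ)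
    (a : ℝ) : Prop :=
  ∃ τ p l, HasJet F z τ p l ∧ a = τ - ∑ i, l i

section HasJet

variable {N : ℕ} {F G : EuclideanSpace ℝ (Fin N) × ℝ → ℝ} {z w : EuclideanSpace ℝ (Fin N) × ℝ}
  {τ υ a b : ℝ} {p q l k : Fin N → ℝ}

theorem tendsto_time_line (z : EuclideanSpace ℝ (Fin N) × ℝ) :
    Tendsto (fun s : ℝ => (z.1, z.2 + s)) (𝓝 0) (𝓝 z) := by
  have : Continuous (fun s : ℝ => (z.1, z.2 + s)) := by fun_prop
  simpa using this.tendsto 0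

theorem tendsto_space_line (z : EuclideanSpace ℝ (Fin N) × ℝ) (v : EuclideanSpace ℝ (Fin N)) :
    Tendsto (fun r : ℝ => (z.1 + r • v, z.2)) (𝓝 0) (𝓝 z) := by
  have : Continuous (fun r : ℝ => (z.1 + r • v, z.2)) := by fun_prop
  simpa using this.tendsto 0

theorem HasJet.congr (h : HasJet F z τ p l) (he : G =ᶠ[𝓝 z] F) : HasJet G z τ p l :=
  ⟨h.1.congr_of_eventuallyEq ((tendsto_time_line z).eventually he),
    fun i => (h.2 i).congr ((tendsto_space_line z _).eventually he)⟩

theorem HasJet.add (h : HasJet F z τ p l) (h' : HasJet G z υ q k) :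
    HasJet (fun z => F z + G z) z (τ + υ) (fun i => p i + q i) (fun i => l i + k i) :=
  ⟨h.1.add h'.1, fun i => (h.2 i).add (h'.2 i)⟩

theorem HasJet.const_mul (c : ℝ) (h : HasJet F z τ p l) :
    HasJet (fun z => c * F z) z (c * τ) (fun i => c * p i) (fun i => c * l i) :=
  ⟨h.1.const_mul c, fun i => (h.2 i).const_mul c⟩

theorem HasJet.comp {Φ Φ' : ℝ → ℝ} {c : ℝ} (h : HasJet F z τ p l)
    (hΦ : ∀ y, HasDerivAt Φ (Φ' y) y) (hΦ' : HasDerivAt Φ' c (F z)) :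
    HasJet (fun z => Φ (F z)) z (Φ' (F z) * τ) (fun i => Φ' (F z) * p i)
      (fun i => c * p i ^ 2 + Φ' (F z) * l i) := by
  refine ⟨?_, fun i => ?_⟩
  · have := (hΦ (F (z.1, z.2 + 0))).comp 0 h.1
    exact this.congr_deriv (by simp)
  · have := (h.2 i).comp hΦ (k := c) (by simpa using hΦ')
    simpa using this

theorem HasJet.const (c : ℝ) (z : EuclideanSpace ℝ (Fin N) × ℝ) :
    HasJet (fun _ => c) z 0 (fun _ => 0) (fun _ => 0) :=
  ⟨hasDerivAt_const _ _, fun _ => Jet.const c⟩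

theorem HasJet.hasHeat (h : HasJet F z τ p l) : HasHeat F z (τ - ∑ i, l i) :=
  ⟨τ, p, l, h, rfl⟩

theorem HasHeat.congr (h : HasHeat F z a) (he : G =ᶠ[𝓝 z] F) : HasHeat G z a := by
  obtain ⟨τ, p, l, h, rfl⟩ := h
  exact (h.congr he).hasHeat

theorem HasHeat.congr_val (h : HasHeat F z a) (he : a = b) : HasHeat F z b := he ▸ h

theorem HasHeat.add (h : HasHeat F z a) (h' : HasHeat G z b) :
    HasHeat (fun z => F z + G z) z (a + b) := by
  obtain ⟨τ, p, l, h, rfl⟩ := h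
  obtain ⟨υ, q, k, h', rfl⟩ := h'
  refine (h.add h').hasHeat.congr_val ?_
  rw [Finset.sum_add_distrib]; ring

theorem HasHeat.const_mul (c : ℝ) (h : HasHeat F z a) : HasHeat (fun z => c * F z) z (c * a) := by
  obtain ⟨τ, p, l, h, rfl⟩ := h
  refine (h.const_mul c).hasHeat.congr_val ?_
  rw [← Finset.mul_sum]; ring

theorem HasHeat.neg (h : HasHeat F z a) : HasHeat (fun z => - F z) z (-a) := by
  simpa using h.const_mul (-1)

theorem HasHeat.sub (h : HasHeat F z a) (h' : HasHeat G z b) :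
    HasHeat (fun z => F z - G z) z (a - b) := by
  simpa [sub_eq_add_neg] using h.add h'.neg

theorem HasHeat.const (c : ℝ) (z : EuclideanSpace ℝ (Fin N) × ℝ) : HasHeat (fun _ => c) z 0 := by
  simpa using (HasJet.const c z).hasHeat

theorem HasHeat.sum {ι : Type*} (s : Finset ι) {F : ι → EuclideanSpace ℝ (Fin N) × ℝ → ℝ}
    {a : ι → ℝ} (h : ∀ i ∈ s, HasHeat (F i) z (a i)) :
    HasHeat (fun z => ∑ i ∈ s, F i z) z (∑ i ∈ s, a i) := by
  classical
  induction s using Finset.induction_on with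
  | empty => simpa using HasHeat.const (N := N) 0 z
  | insert i s hi ih =>
    simp only [Finset.sum_insert hi]
    exact (h i (Finset.mem_insert_self i s)).add
      (ih fun j hj => h j (Finset.mem_insert_of_mem hj))

theorem HasHeat.translate (v : EuclideanSpace ℝ (Fin N) × ℝ) (h : HasHeat F (z + v) a) :
    HasHeat (fun z => F (z + v)) z a := by
  obtain ⟨τ, p, l, h, rfl⟩ := h
  refine ⟨τ, p, l, ⟨?_, fun i => ?_⟩, rfl⟩
  · refine h.1.congr_of_eventuallyEq (Eventually.of_forall fun s => ?_)
    simp only [Prod.add_def]; congr 2; ring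
  · refine (h.2 i).congr (Eventually.of_forall fun s => ?_)
    simp only [Prod.add_def]; congr 2; abel

theorem HasHeat.nonneg_of_isLocalMax (h : HasHeat F z a) (hm : IsLocalMax F z) : 0 ≤ a := by
  obtain ⟨τ, p, l, h, rfl⟩ := h
  have h1 : IsLocalMax (fun s => F (z.1, z.2 + s)) 0 := by
    have := (tendsto_time_line z).eventually hm
    filter_upwards [this] with s hs
    simpa using hs
  have h2 : ∀ i, IsLocalMax (fun r : ℝ => F (z.1 + r • ee i, z.2)) 0 := fun i => by
    have := (tendsto_space_line z (ee i)).eventually hm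
    filter_upwards [this] with s hs
    simpa using hs
  have h3 : τ = 0 := h1.hasDerivAt_eq_zero h.1
  have h4 : ∑ i, l i ≤ 0 := Finset.sum_nonpos fun i _ => ((h.2 i).of_isLocalMax (h2 i)).2
  linarith

theorem hasJet_sqDist (z₀ z : EuclideanSpace ℝ (Fin N) × ℝ) :
    HasJet (fun z => ‖z.1 - z₀.1‖ ^ 2 + (z.2 - z₀.2) ^ 2) z (2 * (z.2 - z₀.2))
      (fun i => 2 * (z.1 - z₀.1) i) (fun _ => 2) := by
  refine ⟨?_, fun i => ?_⟩
  · have h1 := (((hasDerivAt_id (0 : ℝ)).const_add (z.2 - z₀.2)).pow 2).const_add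
      (‖z.1 - z₀.1‖ ^ 2)
    have h2 : (2 * (z.2 - z₀.2)) = (↑2 * (z.2 - z₀.2 + id 0) ^ (2 - 1) * 1) := by simp
    rw [h2]
    refine h1.congr_of_eventuallyEq (Eventually.of_forall fun s => ?_)
    simp; ring
  · have h1 := Jet.quadratic (‖z.1 - z₀.1‖ ^ 2 + (z.2 - z₀.2) ^ 2) (2 * (z.1 - z₀.1) i) 1
    rw [mul_one] at h1
    refine h1.congr (Eventually.of_forall fun r => ?_)
    have h2 : z.1 + r • ee i - z₀.1 = (z.1 - z₀.1) + r • ee i := by abel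
    simp only [h2, norm_add_sq_real, inner_smul_right, norm_smul, norm_ee]
    have h3 : inner ℝ (z.1 - z₀.1) (ee i) = (z.1 - z₀.1) i := by
      simp [ee, EuclideanSpace.inner_single_right]
    rw [h3]; simp; ring

theorem hasHeat_sqDist (z₀ z : EuclideanSpace ℝ (Fin N) × ℝ) :
    HasHeat (fun z => ‖z.1 - z₀.1‖ ^ 2 + (z.2 - z₀.2) ^ 2) z (2 * (z.2 - z₀.2) - 2 * N) := by
  refine (hasJet_sqDist z₀ z).hasHeat.congr_val ?_
  simp; ring

end HasJet

theorem jet_line_of_contDiffAt {E : Type*} [NormedAddCommGroup E] [NormedSpace ℝ E]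
    {g : E → ℝ} {x : E} (hg : ContDiffAt ℝ 2 g x) (e : E) :
    Jet (fun r => g (x + r • e)) (fderiv ℝ g x e) (iteratedFDeriv ℝ 2 g x ![e, e]) := by
  have hline : ∀ r : ℝ, HasDerivAt (fun r : ℝ => x + r • e) e r := fun r => by
    simpa using ((hasDerivAt_id r).smul_const e).const_add x
  have hev : ∀ᶠ y in 𝓝 x, DifferentiableAt ℝ g y := by
    have := hg.eventually (by simp)
    exact this.mono fun y hy => hy.differentiableAt (by norm_num)
  have ht : Tendsto (fun r : ℝ => x + r • e) (𝓝 0) (𝓝 x) := by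
    have := (hline 0).continuousAt.tendsto
    simpa using this
  have hd : HasFDerivAt (fderiv ℝ g) (fderiv ℝ (fderiv ℝ g) x) x :=
    ((hg.fderiv_right (m := 1) (by norm_num)).differentiableAt (by norm_num)).hasFDerivAt
  refine Jet.of_hasDerivAt (φ' := fun r => fderiv ℝ g (x + r • e) e) ?_ (by simp) ?_
  · filter_upwards [ht.eventually hev] with r hr
    exact hr.hasFDerivAt.comp_hasDerivAt r (hline r)
  · rw [iteratedFDeriv_two_apply]
    have hd' : HasFDerivAt (fderiv ℝ g) (fderiv ℝ (fderiv ℝ g) x) (x + (0 : ℝ) • e) := by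
      simpa using hd
    have h1 := hd'.comp_hasDerivAt 0 (hline 0)
    simpa using h1.clm_apply (hasDerivAt_const 0 e)

/-- `C^1`, bounded, with bounded derivative. -/
def NiceOne {N : ℕ} (φ : EuclideanSpace ℝ (Fin N) × ℝ → ℝ) : Prop :=
  ContDiff ℝ 1 φ ∧ ∃ C, ∀ z, |φ z| ≤ C ∧ ‖fderiv ℝ φ z‖ ≤ C

/-- All directional derivatives, and the function itself, are `C^1` with bounds. -/
def NiceTwo {N : ℕ} (φ : EuclideanSpace ℝ (Fin N) × ℝ → ℝ) : Prop :=
  NiceOne φ ∧ ∀ v, NiceOne (fun z => fderiv ℝ φ z v)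

/-- The heat operator on smooth functions. -/
noncomputable def heatOp {N : ℕ} (φ : EuclideanSpace ℝ (Fin N) × ℝ → ℝ)
    (z : EuclideanSpace ℝ (Fin N) × ℝ) : ℝ :=
  fderiv ℝ φ z (0, 1) -
    ∑ i : Fin N, fderiv ℝ (fun y => fderiv ℝ φ y (ee i, 0)) z (ee i, 0)

section

variable {N : ℕ} {φ h : EuclideanSpace ℝ (Fin N) × ℝ → ℝ}

theorem NiceOne.continuous (hφ : NiceOne φ) : Continuous φ := hφ.1.continuous

theorem NiceOne.continuous_fderiv (hφ : NiceOne φ) (v : EuclideanSpace ℝ (Fin N) × ℝ) :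
    Continuous (fun z => fderiv ℝ φ z v) :=
  (hφ.1.continuous_fderiv (by norm_num)).clm_apply continuous_const

theorem NiceOne.exists_bound (hφ : NiceOne φ) : ∃ C, ∀ z, |φ z| ≤ C :=
  hφ.2.imp fun _ hC z => (hC z).1

theorem NiceOne.exists_bound_fderiv (hφ : NiceOne φ) (v : EuclideanSpace ℝ (Fin N) × ℝ) :
    ∃ C, ∀ z, |fderiv ℝ φ z v| ≤ C := by
  obtain ⟨C, hC⟩ := hφ.2
  exact ⟨C * ‖v‖, fun z => ((fderiv ℝ φ z).le_opNorm v).trans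
    (mul_le_mul_of_nonneg_right (hC z).2 (norm_nonneg _))⟩

theorem NiceOne.wres {W : ℝ × EuclideanSpace ℝ (Fin N) → ℝ} (hW : Integrable W (resLaw N))
    (hφ : NiceOne φ) : NiceOne (wres W φ) := by
  obtain ⟨hc, C, hC⟩ := hφ
  have hd : ∀ z, HasFDerivAt (_root_.wres W φ)
      (∫ p, W p • fderiv ℝ φ (z - disp p) ∂(resLaw N)) z := fun z =>
    hasFDerivAt_wres hW hc (fun z => (hC z).1) (fun z => (hC z).2) z
  have hcf : Continuous (fderiv ℝ φ) := hc.continuous_fderiv (by norm_num)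
  refine ⟨?_, max ((∫ p, |W p| ∂(resLaw N)) * C) ((∫ p, |W p| ∂(resLaw N)) * C), fun z => ⟨?_, ?_⟩⟩
  · rw [contDiff_one_iff_fderiv]
    refine ⟨fun z => (hd z).differentiableAt, ?_⟩
    have : fderiv ℝ (_root_.wres W φ) = fun z => ∫ p, W p • fderiv ℝ φ (z - disp p) ∂(resLaw N) :=
      funext fun z => (hd z).fderiv
    rw [this]
    refine continuous_of_dominated (bound := fun p => |W p| * C)
      (fun z => ?_) (fun z => Eventually.of_forall fun p => ?_) (hW.abs.mul_const C)
      (Eventually.of_forall fun p => by fun_prop)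
    · exact hW.aestronglyMeasurable.smul
        (hcf.comp (continuous_const.sub continuous_disp)).aestronglyMeasurable
    · rw [norm_smul]
      exact mul_le_mul_of_nonneg_left (hC _).2 (norm_nonneg _)
  · rw [max_self]; exact abs_wres_le hW (fun z => (hC z).1) z
  · rw [max_self, (hd z).fderiv, ← integral_mul_const]
    refine norm_integral_le_of_norm_le (hW.abs.mul_const C) (Eventually.of_forall fun p => ?_)
    rw [norm_smul]
    exact mul_le_mul_of_nonneg_left (hC _).2 (norm_nonneg _)

theorem NiceOne.fderiv_wres {W : ℝ × EuclideanSpace ℝ (Fin N) → ℝ} (hW : Integrable W (resLaw N))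
    (hφ : NiceOne φ) (z v : EuclideanSpace ℝ (Fin N) × ℝ) :
    fderiv ℝ (_root_.wres W φ) z v = _root_.wres W (fun z => fderiv ℝ φ z v) z := by
  obtain ⟨hc, C, hC⟩ := hφ
  exact _root_.fderiv_wres hW hc (fun z => (hC z).1) (fun z => (hC z).2) z v

theorem NiceTwo.wres {W : ℝ × EuclideanSpace ℝ (Fin N) → ℝ} (hW : Integrable W (resLaw N))
    (hφ : NiceTwo φ) : NiceTwo (wres W φ) := by
  refine ⟨hφ.1.wres hW, fun v => ?_⟩
  have : (fun z => fderiv ℝ (_root_.wres W φ) z v) = _root_.wres W (fun z => fderiv ℝ φ z v) :=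
    funext fun z => hφ.1.fderiv_wres hW z v
  rw [this]
  exact (hφ.2 v).wres hW

theorem NiceTwo.resolv (hφ : NiceTwo φ) : NiceTwo (resolv φ) :=
  hφ.wres (W := fun _ => 1) (integrable_const _)

theorem NiceOne.resolv (hφ : NiceOne φ) : NiceOne (resolv φ) :=
  hφ.wres (W := fun _ => 1) (integrable_const _)

theorem NiceOne.hasDerivAt_line (hφ : NiceOne φ) (z v : EuclideanSpace ℝ (Fin N) × ℝ) (r : ℝ) :
    HasDerivAt (fun r : ℝ => φ (z + r • v)) (fderiv ℝ φ (z + r • v) v) r := by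
  have h1 := (hφ.1.differentiable (by norm_num) (z + r • v)).hasFDerivAt
  have h2 : HasDerivAt (fun r : ℝ => z + r • v) v r := by
    simpa using ((hasDerivAt_id r).smul_const v).const_add z
  exact h1.comp_hasDerivAt r h2

theorem NiceTwo.hasHeat (hφ : NiceTwo φ) (z : EuclideanSpace ℝ (Fin N) × ℝ) :
    HasHeat φ z (heatOp φ z) := by
  refine ⟨fderiv ℝ φ z (0, 1), fun i => fderiv ℝ φ z (ee i, 0), _, ⟨?_, fun i => ?_⟩, rfl⟩
  · have := hφ.1.hasDerivAt_line z (0, 1) 0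
    simpa [Prod.add_def] using this
  · have h1 : ∀ r : ℝ, HasDerivAt (fun r : ℝ => φ (z.1 + r • ee i, z.2))
        (fderiv ℝ φ (z + r • (ee i, 0)) (ee i, 0)) r := fun r => by
      have := hφ.1.hasDerivAt_line z (ee i, 0) r
      refine this.congr_of_eventuallyEq (Eventually.of_forall fun r => ?_)
      simp [Prod.add_def]
    refine Jet.of_hasDerivAt (Eventually.of_forall h1) (by simp) ?_
    have := (hφ.2 (ee i, 0)).hasDerivAt_line z (ee i, 0) 0
    simpa using this

theorem NiceTwo.continuous_heatOp (hφ : NiceTwo φ) : Continuous (heatOp φ) := by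
  unfold heatOp
  exact (hφ.1.continuous_fderiv _).sub
    (continuous_finsetSum _ fun i _ => (hφ.2 _).continuous_fderiv _)

theorem NiceTwo.exists_bound_heatOp (hφ : NiceTwo φ) : ∃ C, ∀ z, |heatOp φ z| ≤ C := by
  obtain ⟨C, hC⟩ := hφ.1.exists_bound_fderiv (0, 1)
  choose D hD using fun i : Fin N => (hφ.2 (ee i, 0)).exists_bound_fderiv (ee i, 0)
  refine ⟨C + ∑ i, D i, fun z => ?_⟩
  unfold heatOp
  refine (abs_sub _ _).trans (add_le_add (hC z) ?_)
  exact (Finset.abs_sum_le_sum_abs _ _).trans (Finset.sum_le_sum fun i _ => hD i z)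

/-- Gaussian averages of nice functions. -/
theorem integrable_gauss_comp (hc : Continuous φ) {C : ℝ} (hC : ∀ z, |φ z| ≤ C)
    (z : EuclideanSpace ℝ (Fin N) × ℝ) (s : ℝ) :
    Integrable (fun ξ => φ (z - disp (s, ξ))) (gaussMeas N) := by
  refine (integrable_const C).mono' ?_ (Eventually.of_forall fun ξ => hC _)
  have : Continuous (fun ξ : EuclideanSpace ℝ (Fin N) => z - disp (s, ξ)) :=
    continuous_const.sub (continuous_disp.comp (by fun_prop))
  exact (hc.comp this).aestronglyMeasurable

theorem NiceOne.gauss_inner (hφ : NiceOne φ) (z : EuclideanSpace ℝ (Fin N) × ℝ) (s : ℝ)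
    (e : EuclideanSpace ℝ (Fin N)) :
    ∫ ξ, inner ℝ e ξ * φ (z - disp (s, ξ)) ∂(gaussMeas N) =
      -√(2 * s) * ∫ ξ, fderiv ℝ φ (z - disp (s, ξ)) (e, 0) ∂(gaussMeas N) := by
  obtain ⟨hc, C, hC⟩ := hφ
  let A : EuclideanSpace ℝ (Fin N) →L[ℝ] EuclideanSpace ℝ (Fin N) × ℝ :=
    (-√(2 * s)) • ContinuousLinearMap.inl ℝ _ _
  have hA : ∀ ξ, HasFDerivAt (fun ξ : EuclideanSpace ℝ (Fin N) => z - disp (s, ξ)) A ξ := by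
    intro ξ
    have : (fun ξ : EuclideanSpace ℝ (Fin N) => z - disp (s, ξ)) =
        fun ξ => A ξ + (z - (0, s)) := by
      funext ξ
      simp [A, disp, Prod.sub_def, Prod.add_def]; abel
    rw [this]
    exact A.hasFDerivAt.add_const _
  have hd : ∀ ξ, HasFDerivAt (fun ξ => φ (z - disp (s, ξ)))
      ((fderiv ℝ φ (z - disp (s, ξ))).comp A) ξ := fun ξ =>
    ((hc.differentiable (by norm_num) _).hasFDerivAt).comp ξ (hA ξ)
  have hcd : ContDiff ℝ 1 (fun ξ : EuclideanSpace ℝ (Fin N) => φ (z - disp (s, ξ))) := by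
    have hdisp : ContDiff ℝ 1 (fun ξ : EuclideanSpace ℝ (Fin N) => z - disp (s, ξ)) :=
      contDiff_const.sub ((contDiff_id.const_smul (√(2 * s))).prodMk contDiff_const)
    exact hc.comp hdisp
  have := gaussMeas_integral_inner_mul hcd (C := C) (fun ξ => (hC _).1) (C' := C * ‖A‖)
    (fun ξ => by
      rw [(hd ξ).fderiv]
      exact (ContinuousLinearMap.opNorm_comp_le _ _).trans
        (mul_le_mul_of_nonneg_right (hC _).2 (norm_nonneg _))) e
  rw [this, ← integral_const_mul]
  congr 1; ext ξ
  rw [(hd ξ).fderiv]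
  have h2 : A e = (-√(2 * s)) • ((e, 0) : EuclideanSpace ℝ (Fin N) × ℝ) := by simp [A]
  rw [ContinuousLinearMap.comp_apply, h2, map_smul, smul_eq_mul]

theorem NiceOne.wres_gradWeight (hφ : NiceOne φ) (e : EuclideanSpace ℝ (Fin N))
    (z : EuclideanSpace ℝ (Fin N) × ℝ) :
    _root_.wres (gradWeight e) φ z = _root_.resolv (fun z => fderiv ℝ φ z (e, 0)) z := by
  obtain ⟨C, hC⟩ := hφ.exists_bound
  obtain ⟨D, hD⟩ := hφ.exists_bound_fderiv (e, 0)
  unfold _root_.resolv _root_.wres resLaw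
  rw [integral_prod _ (integrable_wres (integrable_gradWeight e) hφ.continuous hC z),
    integral_prod _ (integrable_wres (W := fun _ => 1) (integrable_const _)
      (hφ.continuous_fderiv _) hD z)]
  refine integral_congr_ae ?_
  filter_upwards [ae_expLaw_pos] with s hs
  have h1 := hφ.gauss_inner z s e
  have h2 : √(2 * s) ≠ 0 := by positivity
  simp only [gradWeight, one_mul]
  calc _ = -(√(2 * s))⁻¹ * ∫ ξ, inner ℝ e ξ * φ (z - disp (s, ξ)) ∂(gaussMeas N) := by
        rw [← integral_const_mul]; congr 1; ext ξ; ring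
    _ = _ := by rw [h1]; field_simp

theorem NiceTwo.hasDerivAt_gauss (hφ : NiceTwo φ) (z : EuclideanSpace ℝ (Fin N) × ℝ) {s : ℝ}
    (hs : 0 < s) :
    HasDerivAt (fun s => ∫ ξ, φ (z - disp (s, ξ)) ∂(gaussMeas N))
      (- ∫ ξ, heatOp φ (z - disp (s, ξ)) ∂(gaussMeas N)) s := by
  obtain ⟨hc, C, hC⟩ := hφ.1
  have hC0 : 0 ≤ C := (abs_nonneg _).trans (hC 0).1
  let v : ℝ → EuclideanSpace ℝ (Fin N) → EuclideanSpace ℝ (Fin N) × ℝ :=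
    fun s ξ => (-(√(2 * s))⁻¹ • ξ, -1)
  have hcurve : ∀ ξ : EuclideanSpace ℝ (Fin N), ∀ s : ℝ, 0 < s →
      HasDerivAt (fun s => z - disp (s, ξ)) (v s ξ) s := by
    intro ξ s hs
    have h1 : HasDerivAt (fun s : ℝ => √(2 * s)) ((√(2 * s))⁻¹) s := by
      have := ((hasDerivAt_id s).const_mul 2).sqrt (by simp; positivity)
      refine this.congr_deriv ?_
      simp; field_simp
    have h2 : HasDerivAt (fun s : ℝ => disp (s, ξ)) ((√(2 * s))⁻¹ • ξ, 1) s :=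
      (h1.smul_const ξ).prodMk (hasDerivAt_id s)
    exact (h2.const_sub z).congr_deriv (by simp [v])
  have hcv : ∀ ξ : EuclideanSpace ℝ (Fin N), ∀ s : ℝ, 0 < s →
      HasDerivAt (fun s => φ (z - disp (s, ξ))) (fderiv ℝ φ (z - disp (s, ξ)) (v s ξ)) s :=
    fun ξ s hs => ((hc.differentiable (by norm_num) _).hasFDerivAt).comp_hasDerivAt s
      (hcurve ξ s hs)
  have hbound : Integrable (fun ξ : EuclideanSpace ℝ (Fin N) =>
      C * ((√(2 * (s / 2)))⁻¹ * ‖ξ‖ + 1)) (gaussMeas N) :=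
    ((integrable_norm_gaussMeas.const_mul _).add (integrable_const 1)).const_mul C
  have hcdisp : ∀ s : ℝ, Continuous (fun ξ : EuclideanSpace ℝ (Fin N) => z - disp (s, ξ)) :=
    fun s => continuous_const.sub (continuous_disp.comp (by fun_prop))
  have hcf : Continuous (fderiv ℝ φ) := hc.continuous_fderiv (by norm_num)
  have key := hasDerivAt_integral_of_dominated_loc_of_deriv_le (μ := gaussMeas N)
    (F := fun s ξ => φ (z - disp (s, ξ)))
    (F' := fun s ξ => fderiv ℝ φ (z - disp (s, ξ)) (v s ξ)) (x₀ := s)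
    (s := Ioi (s / 2)) (Ioi_mem_nhds (by linarith))
    (bound := fun ξ => C * ((√(2 * (s / 2)))⁻¹ * ‖ξ‖ + 1))
    (Eventually.of_forall fun s => (integrable_gauss_comp hc.continuous
      (fun z => (hC z).1) z s).aestronglyMeasurable)
    (integrable_gauss_comp hc.continuous (fun z => (hC z).1) z s) ?_
    (Eventually.of_forall fun ξ s' hs' => ?_) hbound
    (Eventually.of_forall fun ξ s' hs' => hcv ξ s' (lt_trans (by linarith) hs'))
  · refine key.2.congr_deriv ?_
    have hsplit : ∀ ξ, fderiv ℝ φ (z - disp (s, ξ)) (v s ξ) =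
        -(√(2 * s))⁻¹ * (∑ i, inner ℝ (ee i) ξ * fderiv ℝ φ (z - disp (s, ξ)) (ee i, 0)) -
          fderiv ℝ φ (z - disp (s, ξ)) (0, 1) := by
      intro ξ
      have h1 : v s ξ = -(√(2 * s))⁻¹ • (∑ i, inner ℝ (ee i) ξ •
          ((ee i, 0) : EuclideanSpace ℝ (Fin N) × ℝ)) - (0, 1) := by
        have h2 : ∑ i, inner ℝ (ee i) ξ • ee i = ξ := by
          simpa [ee] using (EuclideanSpace.basisFun (Fin N) ℝ).sum_repr' ξ
        refine Prod.ext ?_ ?_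
        · simp only [v, Prod.fst_sub, Prod.smul_fst, Prod.fst_sum]
          rw [h2]; simp
        · simp [v, Prod.snd_sum]
      rw [h1, map_sub, map_smul, map_sum]
      simp only [map_smul, smul_eq_mul]
    have hint1 : ∀ i, Integrable (fun ξ => inner ℝ (ee i) ξ *
        fderiv ℝ φ (z - disp (s, ξ)) (ee i, 0)) (gaussMeas N) := fun i => by
      obtain ⟨D, hD⟩ := hφ.1.exists_bound_fderiv (ee i, 0)
      refine Integrable.mul_bdd (c := D) ?_ ?_ (Eventually.of_forall fun ξ => hD _)
      · refine integrable_norm_gaussMeas.mono'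
          (continuous_const.inner continuous_id).aestronglyMeasurable
          (Eventually.of_forall fun x => ?_)
        simpa using norm_inner_le_norm (𝕜 := ℝ) (ee i) x
      · exact ((hφ.1.continuous_fderiv _).comp (hcdisp s)).aestronglyMeasurable
    have hint2 : Integrable (fun ξ => fderiv ℝ φ (z - disp (s, ξ)) (0, 1)) (gaussMeas N) := by
      obtain ⟨D, hD⟩ := hφ.1.exists_bound_fderiv (0, 1)
      exact integrable_gauss_comp (hφ.1.continuous_fderiv _) hD z s
    have hint3 : ∀ i, Integrable (fun ξ => fderiv ℝ (fun y => fderiv ℝ φ y (ee i, 0))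
        (z - disp (s, ξ)) (ee i, 0)) (gaussMeas N) := fun i => by
      obtain ⟨D, hD⟩ := (hφ.2 (ee i, 0)).exists_bound_fderiv (ee i, 0)
      exact integrable_gauss_comp ((hφ.2 _).continuous_fderiv _) hD z s
    simp only [hsplit, heatOp]
    rw [integral_sub ((integrable_finsetSum _ fun i _ => hint1 i).const_mul _) hint2,
      integral_const_mul, integral_finsetSum _ fun i _ => hint1 i,
      integral_sub hint2 (integrable_finsetSum _ fun i _ => hint3 i),
      integral_finsetSum _ fun i _ => hint3 i]
    have h2 : √(2 * s) ≠ 0 := by positivity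
    have h3 : ∀ i, ∫ ξ, inner ℝ (ee i) ξ * fderiv ℝ φ (z - disp (s, ξ)) (ee i, 0) ∂(gaussMeas N)
      = -√(2 * s) * ∫ ξ, fderiv ℝ (fun y => fderiv ℝ φ y (ee i, 0)) (z - disp (s, ξ)) (ee i, 0)
        ∂(gaussMeas N) := fun i => (hφ.2 (ee i, 0)).gauss_inner z s (ee i)
    simp only [h3]
    rw [← Finset.mul_sum]
    field_simp
    ring
  · have hcv' : Continuous (v s) := by fun_prop
    exact ((hcf.comp (hcdisp s)).clm_apply hcv').aestronglyMeasurable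
  · have hs' : s / 2 < s' := hs'
    have h1 : ‖v s' ξ‖ ≤ (√(2 * (s / 2)))⁻¹ * ‖ξ‖ + 1 := by
      have h2 : (√(2 * s'))⁻¹ ≤ (√(2 * (s / 2)))⁻¹ := by gcongr
      have h3 : ‖-(√(2 * s'))⁻¹ • ξ‖ ≤ (√(2 * (s / 2)))⁻¹ * ‖ξ‖ := by
        rw [norm_smul, norm_neg, Real.norm_of_nonneg (by positivity)]
        gcongr
      rw [Prod.norm_def]
      refine max_le (h3.trans (by linarith)) ?_
      simp only [v, norm_neg, norm_one]
      have : 0 ≤ (√(2 * (s / 2)))⁻¹ * ‖ξ‖ := by positivity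
      linarith
    exact (ContinuousLinearMap.le_opNorm _ _).trans
      (mul_le_mul (hC _).2 h1 (norm_nonneg _) hC0)

theorem NiceTwo.resolv_heatOp_add (hφ : NiceTwo φ) (z : EuclideanSpace ℝ (Fin N) × ℝ) :
    _root_.resolv (fun z => heatOp φ z + φ z) z = φ z := by
  obtain ⟨C, hC⟩ := hφ.1.exists_bound
  obtain ⟨D, hD⟩ := hφ.exists_bound_heatOp
  have hcont : Continuous (fun z => heatOp φ z + φ z) :=
    hφ.continuous_heatOp.add hφ.1.continuous
  have hbd : ∀ z, |heatOp φ z + φ z| ≤ D + C := fun z =>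
    (abs_add_le _ _).trans (add_le_add (hD z) (hC z))
  have h_int := integrable_wres (W := fun _ => 1) (integrable_const _) hcont hbd z
  have hstep : _root_.resolv (fun z => heatOp φ z + φ z) z = ∫ s in Ioi (0 : ℝ), Real.exp (-s) *
      ∫ ξ, (heatOp φ (z - disp (s, ξ)) + φ (z - disp (s, ξ))) ∂(gaussMeas N) := by
    unfold _root_.resolv _root_.wres resLaw
    rw [integral_prod _ h_int, integral_expLaw]
    simp only [one_mul]
  have h_int' : IntegrableOn (fun s => Real.exp (-s) *
      ∫ ξ, (heatOp φ (z - disp (s, ξ)) + φ (z - disp (s, ξ))) ∂(gaussMeas N)) (Ioi 0) := by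
    have := (integrable_expLaw_iff _).1 h_int.integral_prod_left
    simpa only [one_mul] using this
  let G : ℝ → ℝ := fun s => ∫ ξ, φ (z - disp (s, ξ)) ∂(gaussMeas N)
  have hGC : ∀ s, |G s| ≤ C := fun s => by
    have := norm_integral_le_of_norm_le_const (μ := gaussMeas N)
      (f := fun ξ => φ (z - disp (s, ξ))) (C := C) (Eventually.of_forall fun ξ => hC _)
    simpa using this
  have hGcont : Continuous G := by
    refine continuous_of_dominated (bound := fun _ => C)
      (fun s => (integrable_gauss_comp hφ.1.continuous hC z s).aestronglyMeasurable)
      (fun s => Eventually.of_forall fun ξ => hC _) (integrable_const _)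
      (Eventually.of_forall fun ξ => ?_)
    have : Continuous (fun s : ℝ => z - disp (s, ξ)) :=
      continuous_const.sub (continuous_disp.comp (by fun_prop))
    exact hφ.1.continuous.comp this
  have hF : ∀ s ∈ Ioi (0 : ℝ), HasDerivAt (fun s => -(Real.exp (-s) * G s)) (Real.exp (-s) *
      ∫ ξ, (heatOp φ (z - disp (s, ξ)) + φ (z - disp (s, ξ))) ∂(gaussMeas N)) s := by
    intro s hs
    have h1 := ((hasDerivAt_neg s).exp.mul (hφ.hasDerivAt_gauss z hs)).neg
    refine h1.congr_deriv ?_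
    rw [integral_add (integrable_gauss_comp hφ.continuous_heatOp hD z s)
      (integrable_gauss_comp hφ.1.continuous hC z s)]
    ring
  have hlim : Tendsto (fun s => -(Real.exp (-s) * G s)) atTop (𝓝 0) := by
    have h1 : Tendsto (fun s => Real.exp (-s) * C) atTop (𝓝 (0 * C)) :=
      Real.tendsto_exp_neg_atTop_nhds_zero.mul_const C
    rw [zero_mul] at h1
    refine squeeze_zero_norm (fun s => ?_) h1
    rw [norm_neg, norm_mul, Real.norm_of_nonneg (Real.exp_pos _).le]
    exact mul_le_mul_of_nonneg_left (hGC s) (Real.exp_pos _).le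
  have hfinal := integral_Ioi_of_hasDerivAt_of_tendsto (a := (0 : ℝ))
    (f := fun s => -(Real.exp (-s) * G s)) (m := 0)
    (by exact (by fun_prop : Continuous _).continuousWithinAt) hF h_int' hlim
  rw [hstep, hfinal]
  simp [G, disp, Prod.sub_def]

theorem NiceTwo.heatOp_resolv (hh : NiceTwo h) (z : EuclideanSpace ℝ (Fin N) × ℝ) :
    heatOp (_root_.resolv h) z = h z - _root_.resolv h z := by
  have hW : Integrable (fun _ : ℝ × EuclideanSpace ℝ (Fin N) => (1 : ℝ)) (resLaw N) :=
    integrable_const _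
  have h1 : ∀ v, (fun z => fderiv ℝ (_root_.resolv h) z v) =
      _root_.resolv (fun z => fderiv ℝ h z v) := fun v => funext fun z =>
    hh.1.fderiv_wres hW z v
  have h2 : ∀ (v w : EuclideanSpace ℝ (Fin N) × ℝ),
      fderiv ℝ (_root_.resolv (fun z => fderiv ℝ h z v)) z w =
      _root_.resolv (fun z => fderiv ℝ (fun y => fderiv ℝ h y v) z w) z := fun v w =>
    (hh.2 v).fderiv_wres hW z w
  obtain ⟨C, hC⟩ := hh.1.exists_bound
  obtain ⟨D, hD⟩ := hh.exists_bound_heatOp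
  obtain ⟨D', hD'⟩ := hh.1.exists_bound_fderiv (0, 1)
  choose B hB using fun i : Fin N => (hh.2 (ee i, 0)).exists_bound_fderiv (ee i, 0)
  have h3 : heatOp (_root_.resolv h) z = _root_.resolv (heatOp h) z := by
    have h4 : fderiv ℝ (_root_.resolv h) z (0, 1) =
      _root_.resolv (fun z => fderiv ℝ h z (0, 1)) z := congrFun (h1 (0, 1)) z
    unfold heatOp
    rw [h4]
    simp only [h1, h2]
    unfold _root_.resolv _root_.wres
    rw [← integral_finsetSum, ← integral_sub]
    · simp
    · exact integrable_wres hW (hh.1.continuous_fderiv _) hD' z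
    · exact integrable_finsetSum _ fun i _ =>
        integrable_wres hW ((hh.2 _).continuous_fderiv _) (hB i) z
    · exact fun i _ => integrable_wres hW ((hh.2 _).continuous_fderiv _) (hB i) z
  have h5 := hh.resolv_heatOp_add z
  have h6 : _root_.resolv (fun z => heatOp h z + h z) z =
    _root_.resolv (heatOp h) z + _root_.resolv h z :=
    wres_add hW hh.continuous_heatOp hh.1.continuous hD hC z
  rw [h3]; linarith

theorem NiceTwo.hasHeat_resolv (hh : NiceTwo h) (z : EuclideanSpace ℝ (Fin N) × ℝ) :
    HasHeat (_root_.resolv h) z (h z - _root_.resolv h z) :=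
  (hh.resolv.hasHeat z).congr_val (hh.heatOp_resolv z)

end

instance isNegInvariant_volume_prod (N : ℕ) :
    (volume.prod volume : Measure (EuclideanSpace ℝ (Fin N) × ℝ)).IsNegInvariant :=
  Measure.IsAddHaarMeasure.isNegInvariant_of_regular _

open scoped Convolution in
theorem niceOne_convolution {N : ℕ} {g h : EuclideanSpace ℝ (Fin N) × ℝ → ℝ}
    (hg : ContDiff ℝ 1 g) (hgs : HasCompactSupport g) (hc : Continuous h) {C : ℝ}
    (hC : ∀ z, |h z| ≤ C) :
    NiceOne (g ⋆[ContinuousLinearMap.lsmul ℝ ℝ, volume.prod volume] h) ∧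
    ∀ z v, fderiv ℝ (g ⋆[ContinuousLinearMap.lsmul ℝ ℝ, volume.prod volume] h) z v =
      ((fun y => fderiv ℝ g y v) ⋆[ContinuousLinearMap.lsmul ℝ ℝ, volume.prod volume] h) z := by
  have hC0 : 0 ≤ C := (abs_nonneg _).trans (hC 0)
  have hl : LocallyIntegrable h (volume.prod volume) := hc.locallyIntegrable
  have hd := fun z => HasCompactSupport.hasFDerivAt_convolution_left
    (ContinuousLinearMap.lsmul ℝ ℝ) (μ := volume.prod volume) hgs hg hl z
  have hgc : Continuous (fderiv ℝ g) := hg.continuous_fderiv (by norm_num)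
  have hgi : Integrable g (volume.prod volume) := hg.continuous.integrable_of_hasCompactSupport hgs
  have hgi' : Integrable (fderiv ℝ g) (volume.prod volume) :=
    hgc.integrable_of_hasCompactSupport (hgs.fderiv ℝ)
  have h_int : ∀ z, Integrable (fun y => ((ContinuousLinearMap.lsmul ℝ ℝ).precompL
      (EuclideanSpace ℝ (Fin N) × ℝ)) (fderiv ℝ g y) (h (z - y))) (volume.prod volume) := by
    intro z
    exact (HasCompactSupport.convolutionExists_left _ (hgs.fderiv ℝ) hgc hl z)
  have hv : ∀ z v, fderiv ℝ (g ⋆[ContinuousLinearMap.lsmul ℝ ℝ, volume.prod volume] h) z v =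
      ((fun y => fderiv ℝ g y v) ⋆[ContinuousLinearMap.lsmul ℝ ℝ, volume.prod volume] h) z := by
    intro z v
    rw [(hd z).fderiv]
    unfold convolution
    rw [ContinuousLinearMap.integral_apply (h_int z)]
    rfl
  refine ⟨⟨?_, max ((∫ y, |g y| ∂(volume.prod volume)) * C)
    ((∫ y, ‖fderiv ℝ g y‖ ∂(volume.prod volume)) * C), fun z => ⟨?_, ?_⟩⟩, hv⟩
  · exact hgs.contDiff_convolution_left _ hg hl
  · refine le_max_of_le_left ?_
    rw [← integral_mul_const, ← Real.norm_eq_abs]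
    refine norm_integral_le_of_norm_le (hgi.abs.mul_const C) (Eventually.of_forall fun p => ?_)
    simp only [ContinuousLinearMap.lsmul_apply, norm_smul]
    exact mul_le_mul_of_nonneg_left (hC _) (norm_nonneg _)
  · refine le_max_of_le_right ?_
    refine ContinuousLinearMap.opNorm_le_bound _ (by positivity) fun v => ?_
    rw [hv, ← integral_mul_const, ← integral_mul_const]
    refine norm_integral_le_of_norm_le ((hgi'.norm.mul_const C).mul_const _)
      (Eventually.of_forall fun p => ?_)
    simp only [ContinuousLinearMap.lsmul_apply, norm_smul]
    calc ‖fderiv ℝ g p v‖ * ‖h (z - p)‖ ≤ (‖fderiv ℝ g p‖ * ‖v‖) * C :=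
          mul_le_mul (ContinuousLinearMap.le_opNorm _ _) (hC _) (norm_nonneg _) (by positivity)
      _ = _ := by ring

open scoped Convolution in
theorem exists_mollifier (N : ℕ) {δ : ℝ} (hδ : 0 < δ) :
    ∃ T : (EuclideanSpace ℝ (Fin N) × ℝ → ℝ) → EuclideanSpace ℝ (Fin N) × ℝ → ℝ,
      ∀ (h : EuclideanSpace ℝ (Fin N) × ℝ → ℝ) (C : ℝ), Continuous h → (∀ z, |h z| ≤ C) →
        NiceTwo (T h) ∧ (∀ z, |T h z| ≤ C) ∧
        (∀ z ε, (∀ y ∈ ball z δ, |h y - h z| ≤ ε) → |T h z - h z| ≤ ε) ∧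
        ∀ (v : EuclideanSpace ℝ (Fin N) × ℝ) (k : EuclideanSpace ℝ (Fin N) × ℝ → ℝ) (D : ℝ),
          Continuous k → (∀ z, |k z| ≤ D) →
          (∀ z (r : ℝ), HasDerivAt (fun r : ℝ => h (z + r • v)) (k (z + r • v)) r) →
          ∀ z, fderiv ℝ (T h) z v = T k z := by
  let b : ContDiffBump (0 : EuclideanSpace ℝ (Fin N) × ℝ) := ⟨δ / 2, δ, by linarith, by linarith⟩
  let μ : Measure (EuclideanSpace ℝ (Fin N) × ℝ) := volume.prod volume
  let g : EuclideanSpace ℝ (Fin N) × ℝ → ℝ := b.normed μ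
  have hg : ∀ n : ℕ∞, ContDiff ℝ n g := fun n => b.contDiff_normed
  have hgs : HasCompactSupport g := b.hasCompactSupport_normed
  have hgi : Integrable g μ := b.integrable_normed
  refine ⟨fun h => g ⋆[ContinuousLinearMap.lsmul ℝ ℝ, μ] h, fun h C hc hC =>
    ⟨⟨(niceOne_convolution (hg 1) hgs hc hC).1, fun v => ?_⟩, fun z => ?_, fun z ε hε => ?_,
      fun v k D hkc hkD hd z => ?_⟩⟩
  · have : (fun z => fderiv ℝ (g ⋆[ContinuousLinearMap.lsmul ℝ ℝ, μ] h) z v) =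
      ((fun y => fderiv ℝ g y v) ⋆[ContinuousLinearMap.lsmul ℝ ℝ, volume.prod volume] h) :=
      funext fun z => (niceOne_convolution (hg 1) hgs hc hC).2 z v
    rw [this]
    refine (niceOne_convolution ?_ ?_ hc hC).1
    · exact ((hg 2).fderiv_right (m := 1) (by norm_num)).clm_apply contDiff_const
    · exact hgs.fderiv_apply ℝ v
  · have h1 : ∫ y, |g y| ∂μ = 1 := by
      rw [← b.integral_normed (μ := μ)]
      exact integral_congr_ae (Eventually.of_forall fun y => abs_of_nonneg (b.nonneg_normed y))
    have h2 : |(g ⋆[ContinuousLinearMap.lsmul ℝ ℝ, μ] h) z| ≤ (∫ y, |g y| ∂μ) * C := by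
      rw [← integral_mul_const, ← Real.norm_eq_abs]
      refine norm_integral_le_of_norm_le (hgi.abs.mul_const C) (Eventually.of_forall fun p => ?_)
      simp only [ContinuousLinearMap.lsmul_apply, norm_smul]
      exact mul_le_mul_of_nonneg_left (hC _) (norm_nonneg _)
    rwa [h1, one_mul] at h2
  · have := b.dist_normed_convolution_le (μ := μ) (x₀ := z) (g := h) (ε := ε)
      hc.aestronglyMeasurable (fun x hx => by rw [Real.dist_eq]; exact hε x hx)
    rwa [Real.dist_eq] at this
  · have hgc : Continuous g := (hg 1).continuous
    have hgh : ∀ w, Integrable (fun y => g y * h (w - y)) μ := fun w =>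
      hgi.mul_bdd (c := C) (hc.comp (continuous_const.sub continuous_id)).aestronglyMeasurable
        (Eventually.of_forall fun y => hC _)
    have h1 := (hasDerivAt_integral_of_dominated_loc_of_deriv_le (μ := μ) (s := univ) (x₀ := (0 : ℝ))
      (F := fun r y => g y * h (z - y + r • v)) (F' := fun r y => g y * k (z - y + r • v))
      (bound := fun y => |g y| * D) univ_mem
      (Eventually.of_forall fun r => (by
        have : Continuous fun y => g y * h (z - y + r • v) := by fun_prop
        exact this.aestronglyMeasurable))
      (by simpa using hgh z)
      (by
        have : Continuous fun y => g y * k (z - y + (0 : ℝ) • v) := by fun_prop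
        exact this.aestronglyMeasurable)
      (Eventually.of_forall fun y r _ => by
        rw [norm_mul]; exact mul_le_mul_of_nonneg_left (hkD _) (abs_nonneg _))
      (hgi.abs.mul_const D)
      (Eventually.of_forall fun y r _ => (hd (z - y) r).const_mul (g y))).2
    have h2 : HasDerivAt (fun r : ℝ => (g ⋆[ContinuousLinearMap.lsmul ℝ ℝ, μ] h) (z + r • v))
        (fderiv ℝ (g ⋆[ContinuousLinearMap.lsmul ℝ ℝ, μ] h) z v) 0 := by
      simpa using (niceOne_convolution (hg 1) hgs hc hC).1.hasDerivAt_line z v 0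
    have h3 : (fun r : ℝ => (g ⋆[ContinuousLinearMap.lsmul ℝ ℝ, μ] h) (z + r • v)) =
        fun r => ∫ y, g y * h (z - y + r • v) ∂μ := by
      funext r
      unfold convolution
      refine integral_congr_ae (Eventually.of_forall fun y => ?_)
      simp only [ContinuousLinearMap.lsmul_apply, smul_eq_mul]
      congr 2
      abel
    rw [h3] at h2
    rw [h2.unique h1]
    unfold convolution
    refine integral_congr_ae (Eventually.of_forall fun y => ?_)
    simp

theorem exists_moll {N : ℕ} {h : EuclideanSpace ℝ (Fin N) × ℝ → ℝ} (hc : Continuous h) {C : ℝ}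
    (hC : ∀ z, |h z| ≤ C) {δ : ℝ} (hδ : 0 < δ) :
    ∃ H, NiceTwo H ∧ (∀ z, |H z| ≤ C) ∧
      ∀ z ε, (∀ y ∈ ball z δ, |h y - h z| ≤ ε) → |H z - h z| ≤ ε := by
  obtain ⟨T, hT⟩ := exists_mollifier N hδ
  obtain ⟨h1, h2, h3, -⟩ := hT h C hc hC
  exact ⟨T h, h1, h2, h3⟩

theorem tendsto_of_moll {N : ℕ} {h : EuclideanSpace ℝ (Fin N) × ℝ → ℝ} (hc : Continuous h)
    {H : ℕ → EuclideanSpace ℝ (Fin N) × ℝ → ℝ}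
    (h3 : ∀ (n : ℕ) z ε, (∀ y ∈ ball z (1 / ((n : ℝ) + 1)), |h y - h z| ≤ ε) → |H n z - h z| ≤ ε)
    (z : EuclideanSpace ℝ (Fin N) × ℝ) : Tendsto (fun n => H n z) atTop (𝓝 (h z)) := by
  rw [Metric.tendsto_atTop]
  intro ε hε
  obtain ⟨δ, hδ, hball⟩ := Metric.continuousAt_iff.1 hc.continuousAt (ε / 2) (half_pos hε)
  obtain ⟨n₀, hn₀⟩ := exists_nat_one_div_lt hδ
  refine ⟨n₀, fun n hn => ?_⟩
  rw [Real.dist_eq]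
  refine lt_of_le_of_lt (h3 n z (ε / 2) fun y hy => ?_) (half_lt_self hε)
  refine (hball ?_).le
  refine lt_of_lt_of_le (mem_ball.1 hy) (le_trans ?_ hn₀.le)
  have : (n₀ : ℝ) ≤ n := by exact_mod_cast hn
  gcongr

theorem exists_moll_seq {N : ℕ} {h : EuclideanSpace ℝ (Fin N) × ℝ → ℝ} (hc : Continuous h) {C : ℝ}
    (hC : ∀ z, |h z| ≤ C) :
    ∃ H : ℕ → EuclideanSpace ℝ (Fin N) × ℝ → ℝ, (∀ n, NiceTwo (H n)) ∧ (∀ n z, |H n z| ≤ C) ∧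
      ∀ z, Tendsto (fun n => H n z) atTop (𝓝 (h z)) := by
  choose H h1 h2 h3 using fun n : ℕ => exists_moll hc hC (δ := 1 / (n + 1)) (by positivity)
  exact ⟨H, h1, h2, tendsto_of_moll hc h3⟩

theorem exists_moll_seq_deriv {N : ℕ} {ι : Type*} {h : EuclideanSpace ℝ (Fin N) × ℝ → ℝ}
    (hc : Continuous h) {C : ℝ} (hC : ∀ z, |h z| ≤ C) {v : ι → EuclideanSpace ℝ (Fin N) × ℝ}
    {k : ι → EuclideanSpace ℝ (Fin N) × ℝ → ℝ} {D : ι → ℝ} (hkc : ∀ i, Continuous (k i))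
    (hkD : ∀ i z, |k i z| ≤ D i)
    (hd : ∀ i z (r : ℝ), HasDerivAt (fun r : ℝ => h (z + r • v i)) (k i (z + r • v i)) r) :
    ∃ H : ℕ → EuclideanSpace ℝ (Fin N) × ℝ → ℝ, (∀ n, NiceTwo (H n)) ∧ (∀ n z, |H n z| ≤ C) ∧
      (∀ z, Tendsto (fun n => H n z) atTop (𝓝 (h z))) ∧
      (∀ i n z, |fderiv ℝ (H n) z (v i)| ≤ D i) ∧
      ∀ i z, Tendsto (fun n => fderiv ℝ (H n) z (v i)) atTop (𝓝 (k i z)) := by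
  choose T hT using fun n : ℕ => exists_mollifier N (δ := 1 / ((n : ℝ) + 1)) (by positivity)
  have h4 : ∀ i n z, fderiv ℝ (T n h) z (v i) = T n (k i) z := fun i n =>
    (hT n h C hc hC).2.2.2 (v i) (k i) (D i) (hkc i) (hkD i) (hd i)
  refine ⟨fun n => T n h, fun n => (hT n h C hc hC).1, fun n => (hT n h C hc hC).2.1,
    tendsto_of_moll hc fun n => (hT n h C hc hC).2.2.1, fun i n z => ?_, fun i z => ?_⟩
  · rw [h4]; exact (hT n (k i) (D i) (hkc i) (hkD i)).2.1 z
  · simp only [h4]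
    exact tendsto_of_moll (hkc i) (fun n => (hT n (k i) (D i) (hkc i) (hkD i)).2.2.1) z

theorem exists_moll_uniform {N : ℕ} {h : EuclideanSpace ℝ (Fin N) × ℝ → ℝ} (hc : Continuous h)
    {C : ℝ} (hC : ∀ z, |h z| ≤ C) (hu : UniformContinuous h) {ε : ℝ} (hε : 0 < ε) :
    ∃ H, NiceTwo H ∧ (∀ z, |H z| ≤ C) ∧ ∀ z, |H z - h z| ≤ ε := by
  obtain ⟨δ, hδ, hball⟩ := Metric.uniformContinuous_iff.1 hu ε hε
  obtain ⟨H, h1, h2, h3⟩ := exists_moll hc hC hδ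
  exact ⟨H, h1, h2, fun z => h3 z ε fun y hy => (hball (mem_ball.1 hy)).le⟩

theorem exists_moll_local {N : ℕ} {h : EuclideanSpace ℝ (Fin N) × ℝ → ℝ} (hc : Continuous h)
    {C : ℝ} (hC : ∀ z, |h z| ≤ C) {ε : ℝ} (hε : 0 < ε) (ρ : ℝ) :
    ∃ H, NiceTwo H ∧ (∀ z, |H z| ≤ C) ∧ ∀ z, ‖z‖ ≤ ρ → |H z - h z| ≤ ε := by
  have hK : IsCompact (closedBall (0 : EuclideanSpace ℝ (Fin N) × ℝ) (ρ + 1)) :=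
    isCompact_closedBall _ _
  have hu := hK.uniformContinuousOn_of_continuous hc.continuousOn
  obtain ⟨δ, hδ, hball⟩ := Metric.uniformContinuousOn_iff.1 hu ε hε
  obtain ⟨H, h1, h2, h3⟩ := exists_moll hc hC (lt_min hδ one_pos)
  refine ⟨H, h1, h2, fun z hz => h3 z ε fun y hy => ?_⟩
  have hy1 := lt_min_iff.1 (mem_ball.1 hy)
  refine (hball y ?_ z ?_ hy1.1).le
  · rw [mem_closedBall]
    have := dist_triangle y z 0
    rw [dist_zero_right z] at this
    linarith [hy1.2]
  · rw [mem_closedBall, dist_zero_right]; linarith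

/-- Maximum principle at a touching point for functions that are uniform limits of functions
with a pointwise heat operator. -/
theorem le_of_isLocalMax_sub_of_approx {N : ℕ} {v q Φ θ : EuclideanSpace ℝ (Fin N) × ℝ → ℝ}
    {W : Set (EuclideanSpace ℝ (Fin N) × ℝ)} {z₁ : EuclideanSpace ℝ (Fin N) × ℝ} (hW : W ∈ 𝓝 z₁)
    (happ : ∀ e > 0, ∃ S G : EuclideanSpace ℝ (Fin N) × ℝ → ℝ, ContinuousOn S W ∧
      ∀ z ∈ W, |S z - v z| ≤ e ∧ |G z - q z| ≤ e ∧ HasHeat S z (G z))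
    (hΦc : ContinuousOn Φ W) (hΦ : ∀ z ∈ W, HasHeat Φ z (θ z)) (hθ : ContinuousAt θ z₁)
    (hq : ContinuousAt q z₁) (hmax : IsLocalMax (fun z => v z - Φ z) z₁) : θ z₁ ≤ q z₁ := by
  have key : ∀ ω > 0, θ z₁ ≤ q z₁ + (6 + 2 * N) * ω := by
    intro ω hω
    have e1 := Metric.continuousAt_iff'.1 hθ ω hω
    have e2 := Metric.continuousAt_iff'.1 hq ω hω
    obtain ⟨r, hr, hball⟩ := Metric.nhds_basis_closedBall.mem_iff.1
      (inter_mem hW (inter_mem e1 (inter_mem e2 (inter_mem hmax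
        (closedBall_mem_nhds z₁ one_pos)))))
    obtain ⟨S, G, hSc, hSG⟩ := happ (min ω (ω * r ^ 2 / 3)) (by positivity)
    have hBW : closedBall z₁ r ⊆ W := fun z hz => (hball hz).1
    set d : EuclideanSpace ℝ (Fin N) × ℝ → ℝ :=
      fun z => ‖z.1 - z₁.1‖ ^ 2 + (z.2 - z₁.2) ^ 2 with hd
    have hdc : Continuous d := by fun_prop
    obtain ⟨z, hz, hzmax⟩ := (isCompact_closedBall z₁ r).exists_isMaxOn
      ⟨z₁, mem_closedBall_self hr.le⟩
      (f := fun z => S z - Φ z - ω * d z)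
      (((hSc.mono hBW).sub (hΦc.mono hBW)).sub (continuous_const.mul hdc).continuousOn)
    obtain ⟨hzW, h1, h2, h3, h4⟩ := hball hz
    simp only [mem_ofPred_eq] at h1 h2 h3
    have hcmp : S z₁ - Φ z₁ - ω * d z₁ ≤ S z - Φ z - ω * d z :=
      hzmax (mem_closedBall_self hr.le)
    have hd1 : d z₁ = 0 := by simp [hd]
    obtain ⟨hS, hG, hH⟩ := hSG z hzW
    obtain ⟨hS1, -, -⟩ := hSG z₁ (mem_of_mem_nhds hW)
    have hm1 := min_le_right ω (ω * r ^ 2 / 3)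
    have hm2 := min_le_left ω (ω * r ^ 2 / 3)
    have h_int : dist z z₁ < r := by
      refine lt_of_le_of_ne (mem_closedBall.1 hz) fun he => ?_
      have hd2 : r ^ 2 ≤ d z := by
        rw [Prod.dist_eq, dist_eq_norm, Real.dist_eq] at he
        simp only [hd]
        rcases max_choice ‖z.1 - z₁.1‖ |z.2 - z₁.2| with h | h
        · rw [← he, h]; nlinarith [sq_nonneg (z.2 - z₁.2)]
        · rw [← he, h, sq_abs]; nlinarith [sq_nonneg ‖z.1 - z₁.1‖]
      have := mul_le_mul_of_nonneg_left hd2 hω.le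
      rw [hd1] at hcmp
      rw [abs_le] at hS hS1
      have hp : 0 < ω * r ^ 2 := by positivity
      linarith
    have hloc : IsLocalMax (fun z => S z - Φ z - ω * d z) z :=
      hzmax.isLocalMax (mem_of_superset (isOpen_ball.mem_nhds (mem_ball.2 h_int)) ball_subset_closedBall)
    have hnn := ((hH.sub (hΦ z hzW)).sub ((hasHeat_sqDist z₁ z).const_mul ω)).nonneg_of_isLocalMax hloc
    have ht : |z.2 - z₁.2| ≤ 1 := by
      have := mem_closedBall.1 h4
      rw [Prod.dist_eq] at this
      exact (le_max_right _ _).trans this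
    rw [Real.dist_eq, abs_lt] at h1 h2
    rw [abs_le] at hG ht
    nlinarith
  refine le_of_forall_pos_le_add fun ε hε => ?_
  have := key (ε / (6 + 2 * N)) (by positivity)
  rwa [mul_div_cancel₀ _ (by positivity)] at this

/-- Average over the time window `[t, t + δ]`. -/
noncomputable def tavg {N : ℕ} (δ : ℝ) (u : EuclideanSpace ℝ (Fin N) × ℝ → ℝ)
    (z : EuclideanSpace ℝ (Fin N) × ℝ) : ℝ :=
  ∫ k in (0 : ℝ)..1, u (z.1, z.2 + δ * k)

section tavg

variable {N : ℕ} {u : EuclideanSpace ℝ (Fin N) × ℝ → ℝ} {C : ℝ}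

theorem abs_tavg_le (hC : ∀ z, |u z| ≤ C) (δ : ℝ) (z : EuclideanSpace ℝ (Fin N) × ℝ) :
    |tavg δ u z| ≤ C := by
  have := intervalIntegral.norm_integral_le_of_norm_le_const (a := 0) (b := 1)
    (f := fun k => u (z.1, z.2 + δ * k)) (C := C) fun k _ => hC _
  simpa [tavg] using this

theorem tavg_sub_le (hut : ∀ x, Continuous fun t => u (x, t)) {z : EuclideanSpace ℝ (Fin N) × ℝ}
    {δ e c : ℝ} (h : ∀ k ∈ Icc (0 : ℝ) 1, |u (z.1, z.2 + δ * k) - c| ≤ e) :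
    |tavg δ u z - c| ≤ e := by
  have hc : Continuous fun k => u (z.1, z.2 + δ * k) := (hut z.1).comp (by fun_prop)
  have h1 : tavg δ u z - c = ∫ k in (0 : ℝ)..1, (u (z.1, z.2 + δ * k) - c) := by
    rw [intervalIntegral.integral_sub (hc.intervalIntegrable _ _) (by simp)]
    simp [tavg]
  have := intervalIntegral.norm_integral_le_of_norm_le_const (a := 0) (b := 1)
    (f := fun k => u (z.1, z.2 + δ * k) - c) (C := e) fun k hk => h k (by
      rw [uIoc_of_le zero_le_one] at hk; exact ⟨hk.1.le, hk.2⟩)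
  rw [h1]
  simpa using this

theorem tendsto_tavg (hut : ∀ x, Continuous fun t => u (x, t))
    (z : EuclideanSpace ℝ (Fin N) × ℝ) : Tendsto (fun δ => tavg δ u z) (𝓝 0) (𝓝 (u z)) := by
  have h : Continuous fun δ => tavg δ u z := by
    unfold tavg
    refine intervalIntegral.continuous_parametric_intervalIntegral_of_continuous' ?_ _ _
    exact (hut z.1).comp (by fun_prop)
  simpa [tavg] using h.tendsto 0

theorem abs_tavg_time_sub_le (hut : ∀ x, Continuous fun t => u (x, t)) (hC : ∀ z, |u z| ≤ C)
    {δ : ℝ} (hδ : 0 < δ) (x : EuclideanSpace ℝ (Fin N)) (s t : ℝ) :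
    |tavg δ u (x, s) - tavg δ u (x, t)| ≤ 2 * C / δ * |s - t| := by
  have hi : ∀ a b, IntervalIntegrable (fun t => u (x, t)) volume a b :=
    fun a b => (hut x).intervalIntegrable a b
  have h1 : ∀ s, tavg δ u (x, s) = δ⁻¹ * ∫ τ in s..s + δ, u (x, τ) := by
    intro s
    unfold tavg
    rw [intervalIntegral.integral_comp_add_mul (fun τ => u (x, τ)) hδ.ne' s]
    simp
  have hb : ∀ a b, |∫ τ in a..b, u (x, τ)| ≤ C * |b - a| := fun a b =>
    intervalIntegral.norm_integral_le_of_norm_le_const (f := fun τ => u (x, τ)) fun k _ => hC _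
  have h2 : (∫ τ in s..s + δ, u (x, τ)) - ∫ τ in t..t + δ, u (x, τ)
      = (∫ τ in s..t, u (x, τ)) - ∫ τ in s + δ..t + δ, u (x, τ) :=
    intervalIntegral.integral_interval_sub_interval_comm (hi _ _) (hi _ _) (hi _ _)
  rw [h1, h1, ← mul_sub, h2, abs_mul, abs_of_pos (inv_pos.2 hδ)]
  have h3 := hb s t
  have h4 := hb (s + δ) (t + δ)
  have h5 : t + δ - (s + δ) = t - s := by ring
  rw [h5] at h4
  rw [abs_sub_comm t s] at h3 h4
  have h6 := (abs_sub (∫ τ in s..t, u (x, τ)) (∫ τ in s + δ..t + δ, u (x, τ))).trans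
    (add_le_add h3 h4)
  calc _ ≤ δ⁻¹ * (C * |s - t| + C * |s - t|) := mul_le_mul_of_nonneg_left h6 (by positivity)
    _ = _ := by ring

theorem continuous_tavg (hux : ∀ t, Continuous fun x => u (x, t))
    (hut : ∀ x, Continuous fun t => u (x, t)) (hC : ∀ z, |u z| ≤ C)
    {δ : ℝ} (hδ : 0 < δ) : Continuous (tavg δ u) := by
  have hC0 : 0 ≤ C := (abs_nonneg _).trans (hC 0)
  refine continuous_prod_of_continuous_lipschitzWith' (tavg δ u) (Real.toNNReal (2 * C / δ))
    (fun x => ?_) (fun t => ?_)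
  · refine LipschitzWith.of_dist_le_mul fun s t => ?_
    rw [Real.coe_toNNReal _ (by positivity), Real.dist_eq, Real.dist_eq]
    exact abs_tavg_time_sub_le hut hC hδ x s t
  · unfold tavg
    refine intervalIntegral.continuous_of_dominated_interval (bound := fun _ => C) (fun x => ?_)
      (fun x => Eventually.of_forall fun k _ => hC _) (by simp)
      (Eventually.of_forall fun k _ => hux (t + δ * k))
    exact Continuous.aestronglyMeasurable ((hut x).comp (by fun_prop))

theorem abs_integral_sub_riemann_le {φ : ℝ → ℝ} (hφ : Continuous φ) {n : ℕ} (hn : 0 < n) {e : ℝ}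
    (h : ∀ a ∈ Icc (0 : ℝ) 1, ∀ b ∈ Icc (0 : ℝ) 1, |a - b| ≤ 1 / n → |φ a - φ b| ≤ e) :
    |(1 / n * ∑ j ∈ Finset.range n, φ (j / n)) - ∫ k in (0 : ℝ)..1, φ k| ≤ e := by
  have hn' : (0 : ℝ) < n := by exact_mod_cast hn
  have h1 := intervalIntegral.sum_integral_adjacent_intervals (f := φ) (μ := volume)
    (a := fun j : ℕ => (j : ℝ) / n) (n := n) fun k _ => hφ.intervalIntegrable _ _
  have h2 : ((n : ℝ) / n) = 1 := div_self hn'.ne'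
  simp only [Nat.cast_zero, zero_div, h2] at h1
  rw [← h1, Finset.mul_sum, ← Finset.sum_sub_distrib]
  have h3 : ∀ j ∈ Finset.range n, |1 / (n : ℝ) * φ (j / n)
      - ∫ x in ((j : ℕ) : ℝ) / n..((j + 1 : ℕ) : ℝ) / n, φ x| ≤ e * (1 / n) := by
    intro j hj
    have hlen : ((j + 1 : ℕ) : ℝ) / n - (j : ℝ) / n = 1 / n := by
      push_cast; ring
    have hjn : ((j + 1 : ℕ) : ℝ) / n ≤ 1 := by
      rw [div_le_one hn']; exact_mod_cast Finset.mem_range.1 hj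
    have hj0 : (0 : ℝ) ≤ (j : ℝ) / n := by positivity
    have h4 : 1 / (n : ℝ) * φ (j / n) - ∫ x in ((j : ℕ) : ℝ) / n..((j + 1 : ℕ) : ℝ) / n, φ x
        = ∫ x in ((j : ℕ) : ℝ) / n..((j + 1 : ℕ) : ℝ) / n, (φ (j / n) - φ x) := by
      rw [intervalIntegral.integral_sub (by simp) (hφ.intervalIntegrable _ _),
        intervalIntegral.integral_const, hlen, smul_eq_mul]
    have h6 : (0 : ℝ) < 1 / n := by positivity
    rw [h4]
    have h5 := intervalIntegral.norm_integral_le_of_norm_le_const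
      (f := fun x => φ (j / n) - φ x) (C := e) (a := (j : ℝ) / n) (b := ((j + 1 : ℕ) : ℝ) / n)
      fun x hx => by
        rw [uIoc_of_le (by linarith)] at hx
        have := hx.1
        have := hx.2
        refine h _ ⟨hj0, by linarith⟩ _ ⟨by linarith, by linarith⟩ ?_
        rw [abs_le]; constructor <;> linarith
    rwa [hlen, abs_of_pos h6] at h5
  refine (Finset.abs_sum_le_sum_abs _ _).trans ((Finset.sum_le_sum h3).trans ?_)
  rw [Finset.sum_const, Finset.card_range, nsmul_eq_mul]
  field_simp
  exact le_rfl

theorem exists_approx_tavg {g : EuclideanSpace ℝ (Fin N) × ℝ → ℝ}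
    (hut : ∀ x, Continuous fun t => u (x, t)) (hgt : ∀ x, Continuous fun t => g (x, t))
    {K : Set (EuclideanSpace ℝ (Fin N))} (hK : IsCompact K) {a b δ : ℝ} (hδ : 0 ≤ δ)
    (hu : ContinuousOn u (K ×ˢ Icc a b)) (hg : ContinuousOn g (K ×ˢ Icc a b))
    (hH : ∀ z ∈ K ×ˢ Icc a b, HasHeat u z (g z)) {W : Set (EuclideanSpace ℝ (Fin N) × ℝ)}
    (hW : ∀ z ∈ W, z.1 ∈ K ∧ a ≤ z.2 ∧ z.2 + δ ≤ b) {e : ℝ} (he : 0 < e) :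
    ∃ S G : EuclideanSpace ℝ (Fin N) × ℝ → ℝ, ContinuousOn S W ∧
      ∀ z ∈ W, |S z - tavg δ u z| ≤ e ∧ |G z - tavg δ g z| ≤ e ∧ HasHeat S z (G z) := by
  have hKI := hK.prod (isCompact_Icc (a := a) (b := b))
  obtain ⟨d₁, hd₁, h₁⟩ := Metric.uniformContinuousOn_iff.1
    (hKI.uniformContinuousOn_of_continuous hu) e he
  obtain ⟨d₂, hd₂, h₂⟩ := Metric.uniformContinuousOn_iff.1
    (hKI.uniformContinuousOn_of_continuous hg) e he
  obtain ⟨n, hn⟩ := exists_nat_gt (max 1 (δ / min d₁ d₂))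
  have hn0 : (0 : ℝ) < n := lt_of_lt_of_le one_pos ((le_max_left _ _).trans hn.le)
  have hnd : δ / n < min d₁ d₂ := by
    rw [div_lt_comm₀ hn0 (lt_min hd₁ hd₂)]
    exact (le_max_right _ _).trans_lt hn
  have hmem : ∀ z ∈ W, ∀ k ∈ Icc (0 : ℝ) 1, (z.1, z.2 + δ * k) ∈ K ×ˢ Icc a b := by
    intro z hz k hk
    obtain ⟨h1, h2, h3⟩ := hW z hz
    have h4 : 0 ≤ δ * k := mul_nonneg hδ hk.1
    have h5 : δ * k ≤ δ := mul_le_of_le_one_right hδ hk.2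
    exact ⟨h1, by simp only [mem_Icc]; constructor <;> linarith⟩
  have hj : ∀ j ∈ Finset.range n, (j : ℝ) / n ∈ Icc (0 : ℝ) 1 := fun j hj =>
    ⟨by positivity, by rw [div_le_one hn0]; exact_mod_cast (Finset.mem_range.1 hj).le⟩
  have hdist : ∀ z : EuclideanSpace ℝ (Fin N) × ℝ, ∀ p q : ℝ, |p - q| ≤ 1 / n →
      dist (z.1, z.2 + δ * p) (z.1, z.2 + δ * q) < min d₁ d₂ := by
    intro z p q hpq
    refine lt_of_le_of_lt ?_ hnd
    rw [Prod.dist_eq, dist_self, Real.dist_eq]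
    refine max_le (by positivity) ?_
    have : z.2 + δ * p - (z.2 + δ * q) = δ * (p - q) := by ring
    rw [this, abs_mul, abs_of_nonneg hδ, div_eq_mul_one_div]
    exact mul_le_mul_of_nonneg_left hpq hδ
  refine ⟨fun z => 1 / n * ∑ j ∈ Finset.range n, u (z.1, z.2 + δ * (j / n)),
    fun z => 1 / n * ∑ j ∈ Finset.range n, g (z.1, z.2 + δ * (j / n)), ?_, fun z hz => ⟨?_, ?_, ?_⟩⟩
  · refine continuousOn_const.mul (continuousOn_finsetSum _ fun j hjn => ?_)
    exact hu.comp (by fun_prop) fun z hz => hmem z hz _ (hj j hjn)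
  · refine abs_integral_sub_riemann_le (φ := fun k => u (z.1, z.2 + δ * k))
      ((hut z.1).comp (by fun_prop)) (by exact_mod_cast hn0) fun p hp q hq hpq => ?_
    exact (h₁ _ (hmem z hz p hp) _ (hmem z hz q hq)
      ((hdist z p q hpq).trans_le (min_le_left _ _))).le
  · refine abs_integral_sub_riemann_le (φ := fun k => g (z.1, z.2 + δ * k))
      ((hgt z.1).comp (by fun_prop)) (by exact_mod_cast hn0) fun p hp q hq hpq => ?_
    exact (h₂ _ (hmem z hz p hp) _ (hmem z hz q hq)
      ((hdist z p q hpq).trans_le (min_le_right _ _))).le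
  · refine HasHeat.const_mul _ (HasHeat.sum _ fun j hjn => ?_)
    have h3 : ∀ w : EuclideanSpace ℝ (Fin N) × ℝ,
        (w.1, w.2 + δ * ((j : ℝ) / n)) = w + (0, δ * ((j : ℝ) / n)) := fun w => by
      simp [Prod.add_def]
    have h4 := hH _ (hmem z hz _ (hj j hjn))
    rw [h3] at h4
    simp only [h3]
    exact h4.translate _

end tavg

section LocalContinuity

variable {N : ℕ}

/-- Squared Euclidean distance in space-time. -/
noncomputable def sqDist (z₀ z : EuclideanSpace ℝ (Fin N) × ℝ) : ℝ :=
  ‖z.1 - z₀.1‖ ^ 2 + (z.2 - z₀.2) ^ 2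

theorem continuous_sqDist (z₀ : EuclideanSpace ℝ (Fin N) × ℝ) : Continuous (sqDist z₀) := by
  unfold sqDist; fun_prop

theorem sqDist_self (z₀ : EuclideanSpace ℝ (Fin N) × ℝ) : sqDist z₀ z₀ = 0 := by simp [sqDist]

theorem bounds_of_sqDist_le {z₀ z : EuclideanSpace ℝ (Fin N) × ℝ} {r : ℝ} (hr : 0 ≤ r)
    (h : sqDist z₀ z ≤ r ^ 2) : ‖z.1 - z₀.1‖ ≤ r ∧ |z.2 - z₀.2| ≤ r := by
  unfold sqDist at h
  refine ⟨abs_le_of_sq_le_sq' (by nlinarith [sq_nonneg (z.2 - z₀.2)]) hr |>.2,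
    abs_le_of_sq_le_sq (by nlinarith [sq_nonneg ‖z.1 - z₀.1‖]) hr⟩

theorem isCompact_sqDist_le (z₀ : EuclideanSpace ℝ (Fin N) × ℝ) {r : ℝ} (hr : 0 ≤ r) :
    IsCompact {z | sqDist z₀ z ≤ r ^ 2} := by
  refine (isCompact_closedBall z₀ r).of_isClosed_subset
    (isClosed_le (continuous_sqDist z₀) continuous_const) fun z hz => ?_
  obtain ⟨h1, h2⟩ := bounds_of_sqDist_le hr hz
  rw [mem_closedBall, Prod.dist_eq, dist_eq_norm, Real.dist_eq]
  exact max_le h1 h2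

theorem hasHeat_exp_sqDist (α c : ℝ) (z₀ z : EuclideanSpace ℝ (Fin N) × ℝ) :
    HasHeat (fun z => exp (α * sqDist z₀ z + c)) z (exp (α * sqDist z₀ z + c) *
      (α * (2 * (z.2 - z₀.2) - 2 * N) - 4 * α ^ 2 * ‖z.1 - z₀.1‖ ^ 2)) := by
  have h1 : ∀ y, HasDerivAt (fun y => exp (α * y + c)) (exp (α * y + c) * α) y := fun y => by
    have := (((hasDerivAt_id y).const_mul α).add_const c).exp
    simpa using this
  have h2 := (hasJet_sqDist z₀ z).comp h1 ((h1 (sqDist z₀ z)).mul_const α)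
  refine h2.hasHeat.congr_val ?_
  have h3 : ‖z.1 - z₀.1‖ ^ 2 = ∑ i, ((z.1 - z₀.1) i) ^ 2 := EuclideanSpace.real_norm_sq_eq _
  simp only [Finset.sum_add_distrib, Finset.sum_const, Finset.card_univ, Fintype.card_fin,
    ← Finset.mul_sum, mul_pow, h3, nsmul_eq_mul]
  simp only [sqDist, h3]
  ring

theorem local_comparison {v q H : EuclideanSpace ℝ (Fin N) × ℝ → ℝ} (hv : Continuous v)
    (hq : Continuous q) (z₀ : EuclideanSpace ℝ (Fin N) × ℝ) {r C α κ d : ℝ} (hr : 0 < r)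
    (hC : 0 ≤ C) (hα : 0 < α) (hκ : 0 < κ) (hd : 0 ≤ d) (hvC : ∀ z, v z ≤ 2 * C)
    (hH : NiceTwo H) (hH0 : ∀ z, -κ ≤ H z)
    (hHQ : ∀ z, sqDist z₀ z ≤ r ^ 2 →
      (α * (2 * r + 2 * N) + 4 * α ^ 2 * r ^ 2 + 1) * |v z| + |q z| - κ ≤ H z)
    (D : Set (EuclideanSpace ℝ (Fin N)))
    (hD : ∀ z, sqDist z₀ z ≤ r ^ 2 → z.1 ∈ D → v z ≤ d)
    (happ : ∀ z, sqDist z₀ z < r ^ 2 → z.1 ∉ D → ∃ W ∈ 𝓝 z, ∀ e > 0,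
      ∃ S G : EuclideanSpace ℝ (Fin N) × ℝ → ℝ, ContinuousOn S W ∧
      ∀ z ∈ W, |S z - v z| ≤ e ∧ |G z - q z| ≤ e ∧ HasHeat S z (G z))
    (z : EuclideanSpace ℝ (Fin N) × ℝ) (hz : sqDist z₀ z ≤ r ^ 2) :
    v z ≤ resolv H z + 2 * C * exp (α * sqDist z₀ z + -(α * r ^ 2)) + (d + 2 * κ) := by
  set b : EuclideanSpace ℝ (Fin N) × ℝ → ℝ :=
    fun z => 2 * C * exp (α * sqDist z₀ z + -(α * r ^ 2)) with hb
  have hb0 : ∀ z, 0 ≤ b z := fun z => by positivity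
  have hbc : Continuous b := by have := continuous_sqDist z₀; fun_prop
  have hHc := hH.1.continuous
  obtain ⟨M, hM⟩ := hH.1.exists_bound
  have hRc : Continuous (resolv H) := hH.resolv.1.continuous
  have hR0 : ∀ z, -κ ≤ resolv H z := fun z => by
    have h1 := resolv_mono (h₁ := fun _ => -κ) (h₂ := H) continuous_const hHc
      (C₁ := |-κ|) (fun _ => le_rfl) hM hH0 z
    simpa [resolv, wres] using h1
  obtain ⟨z₁, hz₁, hmax⟩ := (isCompact_sqDist_le z₀ hr.le).exists_isMaxOn ⟨z, hz⟩
    (f := fun z => v z - (resolv H z + b z)) (hv.sub (hRc.add hbc)).continuousOn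
  by_contra! hcon
  have hz1 : d + 2 * κ < v z₁ - (resolv H z₁ + b z₁) := by
    have : v z - (resolv H z + b z) ≤ v z₁ - (resolv H z₁ + b z₁) := hmax hz
    simp only [hb] at this ⊢
    linarith
  have hz₁' : sqDist z₀ z₁ ≤ r ^ 2 := hz₁
  have h_int : sqDist z₀ z₁ < r ^ 2 := by
    refine lt_of_le_of_ne hz₁' fun he => ?_
    have h2 : b z₁ = 2 * C := by simp [hb, he]
    have := hvC z₁
    have := hR0 z₁
    linarith
  have hDn : z₁.1 ∉ D := fun hx => by
    have := hD z₁ hz₁' hx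
    have := hR0 z₁
    have := hb0 z₁
    linarith
  obtain ⟨W, hW, hWa⟩ := happ z₁ h_int hDn
  have hloc : IsLocalMax (fun z => v z - (resolv H z + b z)) z₁ := by
    refine hmax.isLocalMax ?_
    exact mem_of_superset ((isOpen_lt (continuous_sqDist z₀) continuous_const).mem_nhds h_int)
      fun z (hz : sqDist z₀ z < r ^ 2) => show sqDist z₀ z ≤ r ^ 2 from hz.le
  have hkey := le_of_isLocalMax_sub_of_approx (Φ := fun z => resolv H z + b z)
    (θ := fun z => (H z - resolv H z) + 2 * C * (exp (α * sqDist z₀ z + -(α * r ^ 2)) *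
      (α * (2 * (z.2 - z₀.2) - 2 * N) - 4 * α ^ 2 * ‖z.1 - z₀.1‖ ^ 2))) hW hWa
    (hRc.add hbc).continuousOn
    (fun z _ => (hH.hasHeat_resolv z).add ((hasHeat_exp_sqDist α _ z₀ z).const_mul (2 * C)))
    (Continuous.continuousAt (by have := continuous_sqDist z₀; fun_prop)) hq.continuousAt hloc
  obtain ⟨h1, h2⟩ := bounds_of_sqDist_le hr.le hz₁'
  have h3 := hHQ z₁ hz₁'
  have h4 : ‖z₁.1 - z₀.1‖ ^ 2 ≤ r ^ 2 := by gcongr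
  have h5 : -(α * (2 * r + 2 * N) + 4 * α ^ 2 * r ^ 2) ≤
      α * (2 * (z₁.2 - z₀.2) - 2 * N) - 4 * α ^ 2 * ‖z₁.1 - z₀.1‖ ^ 2 := by
    have h6 : α * (-(2 * r) - 2 * N) ≤ α * (2 * (z₁.2 - z₀.2) - 2 * N) := by
      refine mul_le_mul_of_nonneg_left ?_ hα.le
      have := (abs_le.1 h2).1
      linarith
    have h7 := mul_le_mul_of_nonneg_left h4 (by positivity : 0 ≤ 4 * α ^ 2)
    linarith
  set K := α * (2 * r + 2 * N) + 4 * α ^ 2 * r ^ 2 with hK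
  have hK0 : 0 ≤ K := by positivity
  have h6 : -(K * b z₁) ≤ 2 * C * (exp (α * sqDist z₀ z₁ + -(α * r ^ 2)) *
      (α * (2 * (z₁.2 - z₀.2) - 2 * N) - 4 * α ^ 2 * ‖z₁.1 - z₀.1‖ ^ 2)) := by
    have := mul_le_mul_of_nonneg_left h5 (hb0 z₁)
    simp only [hb] at this ⊢
    linarith
  have h7 := hR0 z₁
  have h8 := hb0 z₁
  have hvpos : 0 ≤ v z₁ := by linarith
  rw [abs_of_nonneg hvpos] at h3
  have h9 := le_abs_self (q z₁)
  have h10 : K * b z₁ ≤ K * v z₁ := mul_le_mul_of_nonneg_left (by linarith) hK0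
  linarith

theorem continuousAt_of_heat_off_lipschitz {u g : EuclideanSpace ℝ (Fin N) × ℝ → ℝ} {C : ℝ}
    (huC : ∀ z, |u z| ≤ C) (hgC : ∀ z, |g z| ≤ C)
    (hux : ∀ t, Continuous fun x => u (x, t)) (hut : ∀ x, Continuous fun t => u (x, t))
    (hgx : ∀ t, Continuous fun x => g (x, t)) (hgt : ∀ x, Continuous fun t => g (x, t))
    (z₀ : EuclideanSpace ℝ (Fin N) × ℝ) {r n : ℝ} (hr : 0 < r) (hn : 0 ≤ n)
    (D : Set (EuclideanSpace ℝ (Fin N)))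
    (hD : ∀ x ∈ closedBall z₀.1 r, x ∈ D → ∀ s ∈ Icc (z₀.2 - 3 * r) (z₀.2 + 3 * r),
      ∀ t ∈ Icc (z₀.2 - 3 * r) (z₀.2 + 3 * r), |u (x, s) - u (x, t)| ≤ n * |s - t|)
    (hDc : ∀ x ∈ closedBall z₀.1 r, x ∉ D → ∃ U ∈ 𝓝 x,
      ContinuousOn u (U ×ˢ Icc (z₀.2 - 3 * r) (z₀.2 + 3 * r)) ∧
      ContinuousOn g (U ×ˢ Icc (z₀.2 - 3 * r) (z₀.2 + 3 * r)) ∧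
      ∀ z ∈ U ×ˢ Icc (z₀.2 - 3 * r) (z₀.2 + 3 * r), HasHeat u z (g z)) :
    ContinuousAt u z₀ := by
  have hC0 : 0 ≤ C := (abs_nonneg _).trans (huC 0)
  refine continuousAt_of_locally_uniform_approx_of_continuousAt fun V hV => ?_
  obtain ⟨η, hη, hηV⟩ := Metric.mem_uniformity_dist.1 hV
  -- the barrier is small on the inner region for large `α`
  obtain ⟨α, hα, hαb⟩ : ∃ α > 0, 2 * C * exp (-(α * (r ^ 2 / 2))) ≤ η / 8 := by
    have h1 : Tendsto (fun α : ℝ => 2 * C * exp (-(α * (r ^ 2 / 2)))) atTop (𝓝 (2 * C * 0)) := by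
      refine Tendsto.const_mul _ (Real.tendsto_exp_neg_atTop_nhds_zero.comp ?_)
      exact tendsto_id.atTop_mul_const (by positivity)
    rw [mul_zero] at h1
    have h2 := (h1.eventually (ge_mem_nhds (by positivity : 0 < η / 8))).and
      (eventually_gt_atTop 0)
    obtain ⟨α, h3, h4⟩ := h2.exists
    exact ⟨α, h4, h3⟩
  set K := α * (2 * r + 2 * N) + 4 * α ^ 2 * r ^ 2 + 1 with hK
  have hK0 : 0 ≤ K := by positivity
  let χ : EuclideanSpace ℝ (Fin N) × ℝ → ℝ := fun z => max 0 (min 1 (2 - sqDist z₀ z / r ^ 2))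
  have hχc : Continuous χ := by have := continuous_sqDist z₀; fun_prop
  have hχ0 : ∀ z, 0 ≤ χ z := fun z => le_max_left _ _
  have hχ1 : ∀ z, χ z ≤ 1 := fun z => max_le zero_le_one (min_le_left _ _)
  have hχQ : ∀ z, sqDist z₀ z ≤ r ^ 2 → χ z = 1 := fun z hz => by
    have : sqDist z₀ z / r ^ 2 ≤ 1 := (div_le_one (by positivity)).2 hz
    have h2 : min 1 (2 - sqDist z₀ z / r ^ 2) = 1 := min_eq_left (by linarith)
    simp [χ, h2]
  have hχs : HasCompactSupport χ := by
    refine HasCompactSupport.intro (isCompact_sqDist_le z₀ (r := 2 * r) (by positivity))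
      fun z hz => ?_
    simp only [mem_ofPred_eq, not_le] at hz
    refine max_eq_left ((min_le_right _ _).trans ?_)
    rw [sub_nonpos, le_div_iff₀ (by positivity)]
    nlinarith [sq_nonneg r]
  let v : ℝ → ℝ → EuclideanSpace ℝ (Fin N) × ℝ → ℝ := fun δ ε z => tavg δ u z - tavg ε u z
  let q : ℝ → ℝ → EuclideanSpace ℝ (Fin N) × ℝ → ℝ := fun δ ε z => tavg δ g z - tavg ε g z
  let p : ℝ → ℝ → EuclideanSpace ℝ (Fin N) × ℝ → ℝ :=
    fun δ ε z => χ z * (K * |v δ ε z| + |q δ ε z|)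
  have hvc : ∀ δ > 0, ∀ ε > 0, Continuous (v δ ε) := fun δ hδ ε hε =>
    (continuous_tavg hux hut huC hδ).sub (continuous_tavg hux hut huC hε)
  have hqc : ∀ δ > 0, ∀ ε > 0, Continuous (q δ ε) := fun δ hδ ε hε =>
    (continuous_tavg hgx hgt hgC hδ).sub (continuous_tavg hgx hgt hgC hε)
  have hvb : ∀ δ ε z, |v δ ε z| ≤ 2 * C := fun δ ε z =>
    (abs_sub _ _).trans (by linarith [abs_tavg_le huC δ z, abs_tavg_le huC ε z])
  have hqb : ∀ δ ε z, |q δ ε z| ≤ 2 * C := fun δ ε z =>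
    (abs_sub _ _).trans (by linarith [abs_tavg_le hgC δ z, abs_tavg_le hgC ε z])
  have hpc : ∀ δ > 0, ∀ ε > 0, Continuous (p δ ε) := fun δ hδ ε hε =>
    hχc.mul (((hvc δ hδ ε hε).abs.const_mul K).add (hqc δ hδ ε hε).abs)
  have hp0 : ∀ δ ε z, 0 ≤ p δ ε z := fun δ ε z => mul_nonneg (hχ0 z) (by positivity)
  have hps : ∀ δ ε, HasCompactSupport (p δ ε) := fun δ ε => hχs.mul_right
  set M := K * (2 * C) + 2 * C with hM
  have hM0 : 0 ≤ M := by positivity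
  have hin : ∀ δ ε z, K * |v δ ε z| + |q δ ε z| ≤ M := fun δ ε z =>
    add_le_add (mul_le_mul_of_nonneg_left (hvb δ ε z) hK0) (hqb δ ε z)
  have hpM' : ∀ δ ε z, p δ ε z ≤ χ z * M := fun δ ε z =>
    mul_le_mul_of_nonneg_left (hin δ ε z) (hχ0 z)
  have hpM : ∀ δ ε z, p δ ε z ≤ M := fun δ ε z =>
    (hpM' δ ε z).trans (mul_le_of_le_one_left hM0 (hχ1 z))
  have hlim : Tendsto (fun de : ℝ × ℝ => ∫ z, p de.1 de.2 z ∂(volume.prod volume))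
      (𝓝[>] 0 ×ˢ 𝓝[>] 0) (𝓝 0) := by
    suffices h0 : Tendsto (fun de : ℝ × ℝ => ∫ z, p de.1 de.2 z ∂(volume.prod volume))
        (𝓝[>] 0 ×ˢ 𝓝[>] 0)
        (𝓝 (∫ z : EuclideanSpace ℝ (Fin N) × ℝ, (0 : ℝ) ∂(volume.prod volume))) by simpa using h0
    have hpos : ∀ᶠ de : ℝ × ℝ in 𝓝[>] 0 ×ˢ 𝓝[>] 0, 0 < de.1 ∧ 0 < de.2 :=
      (eventually_mem_nhdsWithin (s := Ioi (0 : ℝ))).prod_mk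
        (eventually_mem_nhdsWithin (s := Ioi (0 : ℝ)))
    refine tendsto_integral_filter_of_dominated_convergence (fun z => χ z * M) ?_ ?_ ?_ ?_
    · filter_upwards [hpos] with de hde
      exact (hpc _ hde.1 _ hde.2).aestronglyMeasurable
    · refine Eventually.of_forall fun de => Eventually.of_forall fun z => ?_
      rw [Real.norm_eq_abs, abs_of_nonneg (hp0 _ _ z)]
      exact hpM' _ _ z
    · exact (hχc.integrable_of_hasCompactSupport hχs).mul_const M
    · refine Eventually.of_forall fun z => ?_
      have ht : ∀ w : EuclideanSpace ℝ (Fin N) × ℝ → ℝ, (∀ x, Continuous fun t => w (x, t)) →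
          Tendsto (fun de : ℝ × ℝ => |tavg de.1 w z - tavg de.2 w z|)
          (𝓝[>] 0 ×ˢ 𝓝[>] 0) (𝓝 0) := by
        intro w hw
        have h1 := (tendsto_tavg hw z).mono_left (nhdsWithin_le_nhds (s := Ioi 0))
        have h2 := ((h1.comp tendsto_fst).sub (h1.comp (tendsto_snd (f := 𝓝[>] (0 : ℝ))))).abs
        simpa using h2
      have := ((ht u hut).const_mul K |>.add (ht g hgt)).const_mul (χ z)
      simpa [p, v, q] using this
  -- the source term is small
  set ε₁ := η / (8 * (M + 1)) with hε₁
  have hε₁0 : 0 < ε₁ := by positivity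
  set A := gaussConst N * (√(2 * ε₁) ^ N)⁻¹ with hA
  have hA0 : 0 ≤ A := by have := (gaussConst_pos N).le; positivity
  have hev1 := hlim.eventually (gt_mem_nhds (by positivity : 0 < η / (8 * (A + 1))))
  obtain ⟨T, hT, hTT⟩ := eventually_prod_self_iff'.1 hev1
  have hT2 : T ∩ Ioo 0 (min r (η / (16 * (n + 1)))) ∈ 𝓝[>] (0 : ℝ) :=
    inter_mem hT (Ioo_mem_nhdsGT (by positivity))
  set Q' : Set (EuclideanSpace ℝ (Fin N) × ℝ) := {z | sqDist z₀ z < r ^ 2 / 2} with hQ'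
  have hclaim : ∀ δ ∈ T ∩ Ioo 0 (min r (η / (16 * (n + 1)))),
      ∀ ε ∈ T ∩ Ioo 0 (min r (η / (16 * (n + 1)))), ∀ z ∈ Q',
      tavg δ u z - tavg ε u z ≤ 3 * η / 4 := by
    rintro δ ⟨hδT, hδ0, hδm⟩ ε ⟨hεT, hε0, hεm⟩ z hz
    have hδr := hδm.trans_le (min_le_left _ _)
    have hδn := hδm.trans_le (min_le_right _ _)
    have hεr := hεm.trans_le (min_le_left _ _)
    have hεn := hεm.trans_le (min_le_right _ _)
    have h_int := hTT δ hδT ε hεT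
    have hpcc := hpc δ hδ0 ε hε0
    have hpi : Integrable (p δ ε) (volume.prod volume) :=
      hpcc.integrable_of_hasCompactSupport (hps δ ε)
    have hpabs : ∀ z, |p δ ε z| ≤ M := fun z => by
      rw [abs_of_nonneg (hp0 _ _ z)]; exact hpM _ _ z
    obtain ⟨H, hH, hHM, hHp⟩ := exists_moll_uniform hpcc hpabs
      ((hps δ ε).uniformContinuous_of_continuous hpcc) (by positivity : 0 < η / 32)
    have hnε : n * ε ≤ η / 16 := by
      rw [lt_div_iff₀ (by positivity)] at hεn; nlinarith
    have hnδ : n * δ ≤ η / 16 := by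
      rw [lt_div_iff₀ (by positivity)] at hδn; nlinarith
    have htD : ∀ δ, 0 < δ → δ < r → ∀ z, sqDist z₀ z ≤ r ^ 2 → z.1 ∈ D →
        |tavg δ u z - u z| ≤ n * δ := by
      intro δ hδ0 hδr z hz hzD
      obtain ⟨h1, h2⟩ := bounds_of_sqDist_le hr.le hz
      rw [abs_le] at h2
      refine tavg_sub_le hut fun k hk => ?_
      have h3 : 0 ≤ δ * k := mul_nonneg hδ0.le hk.1
      have h4 : δ * k ≤ δ := mul_le_of_le_one_right hδ0.le hk.2
      refine (hD z.1 (by rwa [mem_closedBall, dist_eq_norm]) hzD _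
        ⟨by linarith, by linarith⟩ z.2 ⟨by linarith, by linarith⟩).trans ?_
      refine mul_le_mul_of_nonneg_left ?_ hn
      rw [add_sub_cancel_left, abs_of_nonneg h3]
      exact h4
    have hcomp := local_comparison (hvc δ hδ0 ε hε0) (hqc δ hδ0 ε hε0) z₀ (d := η / 8) hr hC0 hα
      (by positivity : 0 < η / 32) (by positivity) (fun z => (le_abs_self _).trans (hvb δ ε z)) hH
      (fun z => by
        have h1 := (abs_le.1 (hHp z)).1
        have h2 := hp0 δ ε z
        linarith)
      (fun z hz => by
        have h1 := (abs_le.1 (hHp z)).1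
        have h2 : p δ ε z = K * |v δ ε z| + |q δ ε z| := by simp [p, hχQ z hz]
        rw [h2] at h1
        linarith) D
      (fun z hz hzD => by
        have h1 := abs_le.1 (htD δ hδ0 hδr z hz hzD)
        have h2 := abs_le.1 (htD ε hε0 hεr z hz hzD)
        simp only [v]
        linarith [h1.2, h2.1])
      (fun z hz hzD => by
        obtain ⟨h1, h2⟩ := bounds_of_sqDist_le hr.le hz.le
        rw [abs_le] at h2
        obtain ⟨U, hU, hUu, hUg, hUH⟩ := hDc z.1 (by rwa [mem_closedBall, dist_eq_norm]) hzD
        obtain ⟨ρ, hρ, hρU⟩ := Metric.nhds_basis_closedBall.mem_iff.1 hU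
        have hsub : closedBall z.1 ρ ×ˢ Icc (z₀.2 - 3 * r) (z₀.2 + 3 * r) ⊆
          U ×ˢ Icc (z₀.2 - 3 * r) (z₀.2 + 3 * r) := prod_mono_left hρU
        refine ⟨closedBall z.1 ρ ×ˢ Icc (z₀.2 - 2 * r) (z₀.2 + 2 * r), ?_, fun e he => ?_⟩
        · exact prod_mem_nhds (closedBall_mem_nhds _ hρ)
            (Icc_mem_nhds (by linarith) (by linarith))
        · have hW : ∀ δ, 0 < δ → δ < r →
              ∀ w ∈ closedBall z.1 ρ ×ˢ Icc (z₀.2 - 2 * r) (z₀.2 + 2 * r),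
              w.1 ∈ closedBall z.1 ρ ∧ z₀.2 - 3 * r ≤ w.2 ∧ w.2 + δ ≤ z₀.2 + 3 * r := by
            rintro δ h3 h4 w ⟨h5, h6, h7⟩
            exact ⟨h5, by linarith, by linarith⟩
          obtain ⟨S₁, G₁, hS₁, hG₁⟩ := exists_approx_tavg hut hgt (isCompact_closedBall z.1 ρ)
            hδ0.le (hUu.mono hsub) (hUg.mono hsub) (fun w hw => hUH w (hsub hw))
            (hW δ hδ0 hδr) (half_pos he)
          obtain ⟨S₂, G₂, hS₂, hG₂⟩ := exists_approx_tavg hut hgt (isCompact_closedBall z.1 ρ)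
            hε0.le (hUu.mono hsub) (hUg.mono hsub) (fun w hw => hUH w (hsub hw))
            (hW ε hε0 hεr) (half_pos he)
          refine ⟨fun z => S₁ z - S₂ z, fun z => G₁ z - G₂ z, hS₁.sub hS₂, fun w hw => ?_⟩
          obtain ⟨a1, a2, a3⟩ := hG₁ w hw
          obtain ⟨b1, b2, b3⟩ := hG₂ w hw
          rw [abs_le] at a1 a2 b1 b2
          refine ⟨?_, ?_, a3.sub b3⟩
          · simp only [v]; rw [abs_le]; constructor <;> linarith
          · simp only [q]; rw [abs_le]; constructor <;> linarith)
      z ((le_of_lt hz).trans (by nlinarith [sq_nonneg r]))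
    have hZ : resolv H z ≤ resolv (p δ ε) z + η / 32 := by
      have h1 := resolv_mono (h₂ := fun z => p δ ε z + η / 32) hH.1.continuous
        (hpcc.add continuous_const) hHM
        (C₂ := M + |η / 32|) (fun z => (abs_add_le _ _).trans (add_le_add (hpabs z) le_rfl))
        (fun z => by
          have := (abs_le.1 (hHp z)).2
          linarith) z
      have h2 := wres_add (W := fun _ => 1) (integrable_const _) hpcc
        (continuous_const (y := η / 32)) hpabs (fun _ => le_rfl) z
      refine h1.trans (le_of_eq ?_)
      refine h2.trans ?_
      simp [resolv, wres]
    have hRp := resolv_le_of_integrable hpcc (hp0 δ ε) (hpM δ ε) hpi hε₁0 z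
    have h5 : ε₁ * M ≤ η / 8 := by
      rw [hε₁, div_mul_eq_mul_div, div_le_div_iff₀ (by positivity) (by norm_num)]
      nlinarith
    have h6 : A * ∫ y, p δ ε y ∂(volume.prod volume) ≤ η / 8 := by
      refine (mul_le_mul_of_nonneg_left h_int.le hA0).trans ?_
      rw [mul_div_assoc', div_le_div_iff₀ (by positivity) (by norm_num)]
      nlinarith
    have h7 : 2 * C * exp (α * sqDist z₀ z + -(α * r ^ 2)) ≤ η / 8 := by
      refine le_trans ?_ hαb
      have : sqDist z₀ z ≤ r ^ 2 / 2 := le_of_lt hz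
      have h8 : α * sqDist z₀ z + -(α * r ^ 2) ≤ -(α * (r ^ 2 / 2)) := by
        have := mul_le_mul_of_nonneg_left this hα.le
        linarith
      gcongr
    have h9 : v δ ε z = tavg δ u z - tavg ε u z := rfl
    linarith
  obtain ⟨δ, hδ⟩ := Filter.nonempty_of_mem hT2
  refine ⟨Q', (isOpen_lt (continuous_sqDist z₀) continuous_const).mem_nhds ?_, tavg δ u,
    (continuous_tavg hux hut huC hδ.2.1).continuousAt, fun z hz => hηV ?_⟩
  · rw [mem_ofPred_eq, sqDist_self]; positivity
  · have hlimz : Tendsto (fun ε => tavg ε u z) (𝓝[>] 0) (𝓝 (u z)) :=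
      (tendsto_tavg hut z).mono_left nhdsWithin_le_nhds
    have h1 : u z - tavg δ u z ≤ 3 * η / 4 := by
      refine le_of_tendsto (hlimz.sub_const _) ?_
      filter_upwards [hT2] with ε hε using hclaim ε hε δ hδ z hz
    have h2 : tavg δ u z - u z ≤ 3 * η / 4 := by
      refine le_of_tendsto (hlimz.const_sub _) ?_
      filter_upwards [hT2] with ε hε using hclaim δ hδ ε hε z hz
    rw [Real.dist_eq, abs_lt]
    constructor <;> linarith

end LocalContinuity

theorem ContDiff.exists_lipschitz_Icc {φ : ℝ → ℝ} (h : ContDiff ℝ 1 φ) (T : ℝ) :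
    ∃ n : ℕ, ∀ s ∈ Icc (-T) T, ∀ t ∈ Icc (-T) T, |φ s - φ t| ≤ n * |s - t| := by
  have hc : Continuous (deriv φ) := h.continuous_deriv le_rfl
  obtain ⟨M, hM⟩ := (isCompact_Icc (a := -T) (b := T)).exists_bound_of_continuousOn hc.continuousOn
  obtain ⟨n, hn⟩ := exists_nat_ge M
  refine ⟨n, fun s hs t ht => ?_⟩
  exact (convex_Icc (-T) T).norm_image_sub_le_of_norm_deriv_le
    (fun x _ => (h.differentiable (by norm_num)) x) (fun x hx => (hM x hx).trans hn) ht hs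

/-- A bounded family of separately continuous functions with a pointwise heat operator off a
closed set of positions on which the family vanishes is jointly continuous. -/
theorem continuous_of_separately_continuous_heat {N m : ℕ}
    {u g : Fin m → EuclideanSpace ℝ (Fin N) × ℝ → ℝ} {C : ℝ}
    (huC : ∀ i z, |u i z| ≤ C) (hgC : ∀ i z, |g i z| ≤ C)
    (hux : ∀ i t, Continuous fun x => u i (x, t)) (hut : ∀ i x, Continuous fun t => u i (x, t))
    (hgx : ∀ i t, Continuous fun x => g i (x, t)) (hgt : ∀ i x, Continuous fun t => g i (x, t))
    (hgu : ∀ z, (∀ j, ContinuousAt (u j) z) → ∀ i, ContinuousAt (g i) z)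
    {S : Set (EuclideanSpace ℝ (Fin N))} (hS : IsClosed S) (hu0 : ∀ i, ∀ x ∈ S, ∀ t, u i (x, t) = 0)
    (hut1 : ∀ i, ∀ x ∉ S, ContDiff ℝ 1 fun t => u i (x, t))
    (hH : ∀ i, ∀ x ∉ S, ∀ t, HasHeat (u i) (x, t) (g i (x, t))) (i : Fin m) :
    Continuous (u i) := by
  have main : ∀ T > 0, ∀ x, ∀ᶠ y in 𝓝 x, ∀ t, |t| < T → ∀ i, ContinuousAt (u i) (y, t) := by
    intro T hT
    set O : Set (EuclideanSpace ℝ (Fin N)) :=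
      {x | ∀ᶠ y in 𝓝 x, ∀ t, |t| < T → ∀ i, ContinuousAt (u i) (y, t)} with hO
    have hOo : IsOpen O := isOpen_iff_mem_nhds.2 fun x hx => Filter.Eventually.eventually_nhds hx
    by_contra hne
    obtain ⟨x', hx'⟩ := not_forall.1 hne
    set F : Set (EuclideanSpace ℝ (Fin N)) := Oᶜ with hF
    have hFc : IsClosed F := hOo.isClosed_compl
    have : CompleteSpace F := hFc.completeSpace_coe
    have : Nonempty F := ⟨⟨x', hx'⟩⟩
    let En : ℕ → Set F := fun n => {x | ∀ i, ∀ s ∈ Icc (-T) T, ∀ t ∈ Icc (-T) T,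
      |u i (x.1, s) - u i (x.1, t)| ≤ n * |s - t|}
    have hEc : ∀ n, IsClosed (En n) := by
      intro n
      have : En n = ⋂ i, ⋂ s ∈ Icc (-T) T, ⋂ t ∈ Icc (-T) T,
          {x : F | |u i (x.1, s) - u i (x.1, t)| ≤ n * |s - t|} := by
        ext x; simp only [En, mem_iInter, mem_ofPred_eq]
      rw [this]
      refine isClosed_iInter fun i => isClosed_biInter fun s _ => isClosed_biInter fun t _ =>
        isClosed_le ?_ continuous_const
      exact (((hux i s).comp continuous_subtype_val).sub
        ((hux i t).comp continuous_subtype_val)).abs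
    have hEU : ⋃ n, En n = univ := by
      refine eq_univ_of_forall fun x => mem_iUnion.2 ?_
      by_cases hxS : x.1 ∈ S
      · exact ⟨0, fun i s _ t _ => by simp [hu0 i x.1 hxS]⟩
      · choose n hn using fun i => (hut1 i x.1 hxS).exists_lipschitz_Icc T
        refine ⟨∑ i, n i, fun i s hs t ht => (hn i s hs t ht).trans ?_⟩
        gcongr
        exact Finset.single_le_sum (f := n) (fun _ _ => Nat.zero_le _) (Finset.mem_univ i)
    obtain ⟨n, x₀, hx₀⟩ := nonempty_interior_of_iUnion_of_closed hEc hEU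
    obtain ⟨ρ, hρ, hball⟩ := Metric.mem_nhds_iff.1 (mem_interior_iff_mem_nhds.1 hx₀)
    have hlip : ∀ x ∈ ball x₀.1 ρ, x ∈ F → ∀ i, ∀ s ∈ Icc (-T) T, ∀ t ∈ Icc (-T) T,
        |u i (x, s) - u i (x, t)| ≤ n * |s - t| := by
      intro x hx hxF
      have h1 : (⟨x, hxF⟩ : F) ∈ ball x₀ ρ := hx
      exact hball h1
    have hx₀F : x₀.1 ∉ O := x₀.2
    refine hx₀F (mem_of_superset (ball_mem_nhds x₀.1 hρ) fun y hy t₀ ht₀ i => ?_)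
    obtain ⟨r₁, hr₁, hr₁b⟩ := Metric.nhds_basis_closedBall.mem_iff.1 (isOpen_ball.mem_nhds hy)
    set r := min r₁ ((T - |t₀|) / 4) with hr
    have hr0 : 0 < r := lt_min hr₁ (by linarith)
    have hrb : closedBall y r ⊆ ball x₀.1 ρ :=
      (closedBall_subset_closedBall (min_le_left _ _)).trans hr₁b
    have hrT : 3 * r < T - |t₀| := by
      have : r ≤ (T - |t₀|) / 4 := min_le_right _ _
      linarith
    have hI : ∀ s ∈ Icc (t₀ - 3 * r) (t₀ + 3 * r), |s| < T := fun s hs => by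
      have := hs.1
      have := hs.2
      have := neg_abs_le t₀
      have := le_abs_self t₀
      rw [abs_lt]; constructor <;> linarith
    have hI' : ∀ s ∈ Icc (t₀ - 3 * r) (t₀ + 3 * r), s ∈ Icc (-T) T := fun s hs =>
      abs_le.1 (hI s hs).le
    refine continuousAt_of_heat_off_lipschitz (huC i) (hgC i) (hux i) (hut i) (hgx i) (hgt i)
      (y, t₀) hr0 (Nat.cast_nonneg n) (F ∪ S) ?_ ?_
    · rintro x hx (hxF | hxS) s hs t ht
      · exact hlip x (hrb hx) hxF i s (hI' s hs) t (hI' t ht)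
      · rw [hu0 i x hxS, hu0 i x hxS, sub_self, abs_zero]; positivity
    · intro x hx hxD
      rw [mem_union, not_or] at hxD
      have hxO : x ∈ O := not_not.1 hxD.1
      refine ⟨_, inter_mem hxO (hS.isOpen_compl.mem_nhds hxD.2), ?_, ?_, ?_⟩
      · rintro ⟨w, t⟩ ⟨⟨hw, -⟩, ht⟩
        exact (hw t (hI t ht) i).continuousWithinAt
      · rintro ⟨w, t⟩ ⟨⟨hw, -⟩, ht⟩
        exact (hgu _ (hw t (hI t ht)) i).continuousWithinAt
      · rintro ⟨w, t⟩ ⟨⟨-, hw⟩, ht⟩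
        exact hH i w hw t
  refine continuous_iff_continuousAt.2 fun z => ?_
  exact (main (|z.2| + 1) (by positivity) z.1).self_of_nhds z.2 (by linarith) i

section Reflection

variable {N m : ℕ} (i₀ : Fin N)

/-- Reflection in the coordinate `i₀`. -/
noncomputable def coordRefl (i₀ : Fin N) :
    EuclideanSpace ℝ (Fin N) ≃ₗᵢ[ℝ] EuclideanSpace ℝ (Fin N) :=
  LinearIsometryEquiv.piLpCongrRight 2
    (fun i => if i = i₀ then LinearIsometryEquiv.neg ℝ else LinearIsometryEquiv.refl ℝ ℝ)

theorem coordRefl_apply (x : EuclideanSpace ℝ (Fin N)) (i : Fin N) :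
    coordRefl i₀ x i = if i = i₀ then - x i else x i := by
  unfold coordRefl
  rw [LinearIsometryEquiv.piLpCongrRight_apply]
  simp only
  split_ifs <;> simp

@[simp] theorem coordRefl_apply_self (x : EuclideanSpace ℝ (Fin N)) :
    coordRefl i₀ x i₀ = - x i₀ := by simp [coordRefl_apply]

@[simp] theorem coordRefl_coordRefl (x : EuclideanSpace ℝ (Fin N)) :
    coordRefl i₀ (coordRefl i₀ x) = x := by
  ext i
  simp only [coordRefl_apply]
  split_ifs <;> simp

theorem coordRefl_eq_self {x : EuclideanSpace ℝ (Fin N)} (hx : x i₀ = 0) :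
    coordRefl i₀ x = x := by
  ext i
  simp only [coordRefl_apply]
  split_ifs with h
  · subst h; simp [hx]
  · rfl

theorem coordRefl_ee (i : Fin N) :
    coordRefl i₀ (ee i) = (if i = i₀ then (-1 : ℝ) else 1) • ee i := by
  ext j
  simp only [coordRefl_apply, PiLp.smul_apply, ee_apply, smul_eq_mul]
  by_cases h1 : j = i
  · subst h1; split_ifs <;> simp
  · simp [h1]

theorem HasHeat.comp_coordRefl {F : EuclideanSpace ℝ (Fin N) × ℝ → ℝ}
    {z : EuclideanSpace ℝ (Fin N) × ℝ} {a : ℝ} (h : HasHeat F (coordRefl i₀ z.1, z.2) a) :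
    HasHeat (fun z => F (coordRefl i₀ z.1, z.2)) z a := by
  obtain ⟨τ, p, l, h, rfl⟩ := h
  refine ⟨τ, fun i => if i = i₀ then - p i else p i, l, ⟨h.1, fun i => ?_⟩, rfl⟩
  have h2 := h.2 i
  by_cases hi : i = i₀
  · beta_reduce
    rw [if_pos hi]
    refine h2.comp_neg.congr (Eventually.of_forall fun r => ?_)
    simp [coordRefl_ee, hi]
  · beta_reduce
    rw [if_neg hi]
    refine h2.congr (Eventually.of_forall fun r => ?_)
    simp [coordRefl_ee, hi]

/-- Odd reflection of a function of the values of the unknowns. -/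
noncomputable def oddF (φ : (Fin m → ℝ) → ℝ) (v : Fin m → ℝ) : ℝ :=
  φ (v ⊔ 0) - φ ((-v) ⊔ 0)

theorem oddF_neg (φ : (Fin m → ℝ) → ℝ) (v : Fin m → ℝ) : oddF φ (-v) = - oddF φ v := by
  simp [oddF]

theorem oddF_of_nonneg {φ : (Fin m → ℝ) → ℝ} (h0 : φ 0 = 0) {v : Fin m → ℝ} (hv : ∀ j, 0 ≤ v j) :
    oddF φ v = φ v := by
  have h1 : v ⊔ 0 = v := sup_eq_left.2 hv
  have h2 : (-v) ⊔ 0 = 0 := sup_eq_right.2 fun j => by simpa using hv j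
  simp [oddF, h1, h2, h0]

theorem continuous_oddF {φ : (Fin m → ℝ) → ℝ}
    (hφ : ContinuousOn φ {v : Fin m → ℝ | ∀ j, 0 ≤ v j}) : Continuous (oddF φ) := by
  have h1 : Continuous fun v : Fin m → ℝ => φ (v ⊔ 0) :=
    hφ.comp_continuous (continuous_pi fun j => (continuous_apply j).max continuous_const) fun v j => le_sup_right
  exact h1.sub (h1.comp continuous_neg)

theorem exists_bound_oddF {φ : (Fin m → ℝ) → ℝ}
    (hφ : ContinuousOn φ {v : Fin m → ℝ | ∀ j, 0 ≤ v j}) (C : ℝ) :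
    ∃ M, ∀ v : Fin m → ℝ, (∀ j, |v j| ≤ C) → |oddF φ v| ≤ M := by
  obtain ⟨M, hM⟩ := (isCompact_univ_pi fun _ : Fin m =>
    (isCompact_Icc (a := -C) (b := C))).exists_bound_of_continuousOn (continuous_oddF hφ).continuousOn
  exact ⟨M, fun v hv => hM v fun j _ => abs_le.1 (hv j)⟩

end Reflection

section Uniqueness

variable {N : ℕ} {i₀ : Fin N}

theorem le_barrier_of_heat {d e : EuclideanSpace ℝ (Fin N) × ℝ → ℝ} (hd : Continuous d) {B : ℝ}
    (hB : ∀ z, |d z| ≤ B) (hd0 : ∀ z, z.1 i₀ = 0 → d z = 0)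
    (hH : ∀ z, z.1 i₀ ≠ 0 → HasHeat d z (e z - d z)) {κ A : ℝ} (hκ : 0 ≤ κ) (hA : 0 < A)
    (he : ∀ z, e z ≤ κ + A * sqDist 0 z) (z : EuclideanSpace ℝ (Fin N) × ℝ) :
    d z ≤ (κ + 4 * A * (N + 1)) + 2 * A * sqDist 0 z := by
  have hs0 : ∀ z : EuclideanSpace ℝ (Fin N) × ℝ, 0 ≤ sqDist 0 z := fun z => by
    unfold sqDist; positivity
  by_contra! hcon
  have hB0 : 0 ≤ B := (abs_nonneg _).trans (hB z)
  set R := 1 + sqDist 0 z + B / A with hR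
  have hR1 : 1 ≤ R := by
    have := hs0 z
    have : 0 ≤ B / A := by positivity
    linarith
  have hRR : R ≤ R ^ 2 := by nlinarith
  have hzR : sqDist 0 z ≤ R ^ 2 := by
    have : 0 ≤ B / A := by positivity
    linarith
  have hsc := continuous_sqDist (0 : EuclideanSpace ℝ (Fin N) × ℝ)
  obtain ⟨z₁, hz₁, hmax⟩ := (isCompact_sqDist_le (0 : EuclideanSpace ℝ (Fin N) × ℝ)
    (r := R) (by linarith)).exists_isMaxOn ⟨z, hzR⟩
    (f := fun z => d z - ((κ + 4 * A * (N + 1)) + 2 * A * sqDist 0 z))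
    (Continuous.continuousOn (by fun_prop))
  have hz₁' : sqDist 0 z₁ ≤ R ^ 2 := hz₁
  have hpos : (κ + 4 * A * (N + 1)) + 2 * A * sqDist 0 z₁ < d z₁ := by
    have : d z - ((κ + 4 * A * (N + 1)) + 2 * A * sqDist 0 z) ≤
      d z₁ - ((κ + 4 * A * (N + 1)) + 2 * A * sqDist 0 z₁) := hmax hzR
    linarith
  have h_int : sqDist 0 z₁ < R ^ 2 := by
    refine lt_of_le_of_ne hz₁' fun h => ?_
    have h1 : B / A ≤ R ^ 2 := by have := hs0 z; linarith
    rw [div_le_iff₀ hA] at h1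
    have h2 := (le_abs_self _).trans (hB z₁)
    rw [h] at hpos
    have h3 : 0 ≤ 4 * A * (N + 1) := by positivity
    nlinarith
  have hne : z₁.1 i₀ ≠ 0 := fun h => by
    have h3 : 0 ≤ 4 * A * (N + 1) := by positivity
    have h4 := mul_nonneg (by positivity : 0 ≤ 2 * A) (hs0 z₁)
    rw [hd0 z₁ h] at hpos
    linarith
  have hloc : IsLocalMax (fun z => d z - ((κ + 4 * A * (N + 1)) + 2 * A * sqDist 0 z)) z₁ :=
    hmax.isLocalMax (mem_of_superset ((isOpen_lt hsc continuous_const).mem_nhds h_int)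
      fun z (hz : sqDist 0 z < R ^ 2) => show sqDist 0 z ≤ R ^ 2 from hz.le)
  have hnn := ((hH z₁ hne).sub ((HasHeat.const (κ + 4 * A * (N + 1)) z₁).add
    ((hasHeat_sqDist 0 z₁).const_mul (2 * A)))).nonneg_of_isLocalMax hloc
  have h5 := he z₁
  have h6 : z₁.2 ^ 2 ≤ sqDist 0 z₁ := by
    unfold sqDist; simp only [Prod.snd_zero, sub_zero]
    nlinarith [sq_nonneg ‖z₁.1 - (0 : EuclideanSpace ℝ (Fin N) × ℝ).1‖]
  have h7 : A * (-(4 * z₁.2)) ≤ A * (4 + sqDist 0 z₁) :=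
    mul_le_mul_of_nonneg_left (by nlinarith [sq_nonneg (z₁.2 + 2)]) hA.le
  simp only [Prod.snd_zero, sub_zero] at hnn
  linarith

theorem eq_resolv_of_heat {w h : EuclideanSpace ℝ (Fin N) × ℝ → ℝ} (hw : Continuous w)
    (hh : Continuous h) {B M : ℝ} (hB : ∀ z, |w z| ≤ B) (hM : ∀ z, |h z| ≤ M)
    (hwo : ∀ z, w (coordRefl i₀ z.1, z.2) = - w z) (hho : ∀ z, h (coordRefl i₀ z.1, z.2) = - h z)
    (hH : ∀ z, z.1 i₀ ≠ 0 → HasHeat w z (h z - w z)) (z : EuclideanSpace ℝ (Fin N) × ℝ) :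
    w z = resolv h z := by
  have hM0 : 0 ≤ M := (abs_nonneg _).trans (hM 0)
  choose H hN2 hHM hHh using fun n : ℕ => exists_moll_local hh hM
    (ε := 1 / ((n : ℝ) + 1)) (by positivity) ((n : ℝ) + 1)
  let Z : ℕ → EuclideanSpace ℝ (Fin N) × ℝ → ℝ :=
    fun n z => (1 / 2) * (resolv (H n) z - resolv (H n) (coordRefl i₀ z.1, z.2))
  have hlim : Tendsto (fun n => Z n z) atTop (𝓝 (resolv h z)) := by
    have h1 : ∀ z, Tendsto (fun n => H n z) atTop (𝓝 (h z)) := by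
      intro z
      refine tendsto_iff_dist_tendsto_zero.2 ?_
      refine squeeze_zero' (Eventually.of_forall fun _ => dist_nonneg) ?_
        tendsto_one_div_add_atTop_nhds_zero_nat
      obtain ⟨k, hk⟩ := exists_nat_ge ‖z‖
      filter_upwards [eventually_ge_atTop k] with n hn
      refine hHh n z (hk.trans ?_)
      have : (k : ℝ) ≤ n := by exact_mod_cast hn
      linarith
    have h2 := fun z => tendsto_wres (W := fun _ => 1) (integrable_const _)
      (fun n => (hN2 n).1.continuous) hHM h1 z
    have h3 : resolv h (coordRefl i₀ z.1, z.2) = - resolv h z := by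
      rw [← resolv_isometry]
      simp only [hho]
      exact wres_neg z
    have h4 := ((h2 z).sub (h2 (coordRefl i₀ z.1, z.2))).const_mul (1 / 2)
    have h5 : resolv h z = 1 / 2 * (wres (fun _ => 1) h z -
        wres (fun _ => 1) h (coordRefl i₀ z.1, z.2)) := by
      have h3' : wres (fun _ => 1) h (coordRefl i₀ z.1, z.2) = - resolv h z := h3
      rw [h3']
      change resolv h z = 1 / 2 * (resolv h z - -resolv h z)
      ring
    rw [h5]
    exact h4
  have hlim2 : Tendsto (fun n => Z n z) atTop (𝓝 (w z)) := by
    let κ : ℕ → ℝ := fun n => 1 / ((n : ℝ) + 1)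
    let A : ℕ → ℝ := fun n => (2 * M + 1) * (1 / ((n : ℝ) + 1))
    have hκ : Tendsto κ atTop (𝓝 0) := tendsto_one_div_add_atTop_nhds_zero_nat
    have hA : Tendsto A atTop (𝓝 0) := by simpa using hκ.const_mul (2 * M + 1)
    refine tendsto_iff_dist_tendsto_zero.2 (squeeze_zero (g := fun n =>
      (κ n + 4 * A n * (N + 1)) + 2 * A n * sqDist 0 z) (fun _ => dist_nonneg) (fun n => ?_) ?_)
    · have hκ0 : 0 < κ n := by positivity
      have hA0 : 0 < A n := by positivity
      have hRc : Continuous (resolv (H n)) := (hN2 n).resolv.1.continuous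
      have hσc : Continuous fun z : EuclideanSpace ℝ (Fin N) × ℝ => (coordRefl i₀ z.1, z.2) := by
        have := (coordRefl i₀).continuous
        fun_prop
      have hZc : Continuous (Z n) := continuous_const.mul (hRc.sub (hRc.comp hσc))
      have hZM : ∀ z, |Z n z| ≤ M := fun z => by
        have h1 := abs_le.1 (abs_resolv_le (hHM n) z)
        have h2 := abs_le.1 (abs_resolv_le (hHM n) (coordRefl i₀ z.1, z.2))
        simp only [Z]
        rw [abs_le]; constructor <;> linarith
      let e : EuclideanSpace ℝ (Fin N) × ℝ → ℝ :=
        fun z => h z - 1 / 2 * (H n z - H n (coordRefl i₀ z.1, z.2))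
      have hZH : ∀ z, HasHeat (Z n) z (1 / 2 * ((H n z - resolv (H n) z) -
          (H n (coordRefl i₀ z.1, z.2) - resolv (H n) (coordRefl i₀ z.1, z.2)))) := fun z =>
        (((hN2 n).hasHeat_resolv z).sub
          (HasHeat.comp_coordRefl i₀ ((hN2 n).hasHeat_resolv _))).const_mul _
      have hZ0 : ∀ z, z.1 i₀ = 0 → w z - Z n z = 0 := fun z hz => by
        have h1 := hwo z
        rw [coordRefl_eq_self i₀ hz] at h1
        have h2 : w z = 0 := by linarith
        simp [Z, coordRefl_eq_self i₀ hz, h2]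
      have hes : ∀ z, |e z| ≤ κ n + A n * sqDist 0 z := by
        intro z
        have h1 : e z = 1 / 2 * ((h z - H n z) -
            (h (coordRefl i₀ z.1, z.2) - H n (coordRefl i₀ z.1, z.2))) := by
          rw [hho]; simp only [e]; ring
        have hs0 : 0 ≤ sqDist 0 z := by unfold sqDist; positivity
        rcases le_or_gt ‖z‖ ((n : ℝ) + 1) with hz | hz
        · have h2 : ‖(coordRefl i₀ z.1, z.2)‖ ≤ (n : ℝ) + 1 := by
            rw [Prod.norm_def] at hz ⊢
            simpa using hz
          have h3 := abs_le.1 (hHh n z hz)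
          have h4 := abs_le.1 (hHh n _ h2)
          have h5 : |e z| ≤ κ n := by
            rw [h1, abs_le]; simp only [κ]; constructor <;> linarith
          have := mul_nonneg hA0.le hs0
          linarith
        · have h2 : (n : ℝ) + 1 ≤ sqDist 0 z := by
            have h3 : ((n : ℝ) + 1) ^ 2 ≤ sqDist 0 z := by
              by_contra! h4
              obtain ⟨h5, h6⟩ := bounds_of_sqDist_le (by positivity) h4.le
              refine hz.not_ge ?_
              rw [Prod.norm_def]
              exact max_le (by simpa using h5) (by simpa using h6)
            nlinarith [Nat.cast_nonneg (α := ℝ) n]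
          have h3 : 2 * M ≤ A n * sqDist 0 z := by
            have h4 : A n * ((n : ℝ) + 1) ≤ A n * sqDist 0 z :=
              mul_le_mul_of_nonneg_left h2 hA0.le
            have h5 : A n * ((n : ℝ) + 1) = 2 * M + 1 := by
              simp only [A]; field_simp
            linarith
          have a1 := abs_le.1 (hM z)
          have a2 := abs_le.1 (hHM n z)
          have a3 := abs_le.1 (hHM n (coordRefl i₀ z.1, z.2))
          have h5 : |e z| ≤ 2 * M := by
            rw [abs_le]; simp only [e]; constructor <;> linarith
          linarith
      have hup := le_barrier_of_heat (i₀ := i₀) (d := fun z => w z - Z n z) (e := e)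
        (hw.sub hZc) (B := B + M)
        (fun z => (abs_sub _ _).trans (add_le_add (hB z) (hZM z))) hZ0
        (fun z hz => ((hH z hz).sub (hZH z)).congr_val (by simp only [e, Z]; ring))
        hκ0.le hA0 (fun z => (le_abs_self _).trans (hes z)) z
      have hlo := le_barrier_of_heat (i₀ := i₀) (d := fun z => -(w z - Z n z)) (e := fun z => - e z)
        (hw.sub hZc).neg (B := B + M)
        (fun z => by
          rw [abs_neg]; exact (abs_sub _ _).trans (add_le_add (hB z) (hZM z)))
        (fun z hz => by rw [hZ0 z hz, neg_zero])
        (fun z hz => ((hH z hz).sub (hZH z)).neg.congr_val (by simp only [e, Z]; ring))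
        hκ0.le hA0 (fun z => (neg_le_abs _).trans (hes z)) z
      rw [Real.dist_eq, abs_le]
      constructor <;> linarith
    · have := (hκ.add ((hA.const_mul 4).mul_const ((N : ℝ) + 1))).add
        ((hA.const_mul 2).mul_const (sqDist 0 z))
      simpa using this
  exact tendsto_nhds_unique hlim2 hlim

end Uniqueness

section OddExtension

variable {N m : ℕ}

/-- Bounded continuous odd mild solutions of the reflected system on the whole space, nonnegative
on the half-space. -/
structure IsOddMild (i₀ : Fin N) (f : Fin m → (Fin m → ℝ) → ℝ)
    (v : Fin m → EuclideanSpace ℝ (Fin N) × ℝ → ℝ) : Prop where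
  cont : ∀ i, Continuous (v i)
  bdd : ∃ C, ∀ i z, |v i z| ≤ C
  odd : ∀ i z, v i (coordRefl i₀ z.1, z.2) = - v i z
  nonneg : ∀ i z, 0 ≤ z.1 i₀ → 0 ≤ v i z
  mild : ∀ i z, v i z = resolv (fun w => oddF (f i) (fun j => v j w) + v i w) z

/-- The odd extension across the hyperplane `x i₀ = 0`. -/
noncomputable def oddExt (i₀ : Fin N) (u : Fin m → EuclideanSpace ℝ (Fin N) → ℝ → ℝ) (i : Fin m)
    (z : EuclideanSpace ℝ (Fin N) × ℝ) : ℝ :=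
  if 0 < z.1 i₀ then u i z.1 z.2 else - u i (coordRefl i₀ z.1) z.2

theorem oddExt_of_pos {i₀ : Fin N} {u : Fin m → EuclideanSpace ℝ (Fin N) → ℝ → ℝ} {i : Fin m}
    {z : EuclideanSpace ℝ (Fin N) × ℝ} (hz : 0 < z.1 i₀) : oddExt i₀ u i z = u i z.1 z.2 :=
  if_pos hz

theorem hasHeat_of_classical {F : EuclideanSpace ℝ (Fin N) × ℝ → ℝ}
    {z : EuclideanSpace ℝ (Fin N) × ℝ}
    (hx : ContDiffAt ℝ 2 (fun x => F (x, z.2)) z.1) (ht : DifferentiableAt ℝ (fun t => F (z.1, t)) z.2) :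
    HasHeat F z (deriv (fun t => F (z.1, t)) z.2 - lap (fun x => F (x, z.2)) z.1) := by
  refine HasJet.hasHeat (p := fun i => fderiv ℝ (fun x => F (x, z.2)) z.1 (ee i)) ⟨?_, fun i => ?_⟩
  · exact HasDerivAt.comp_const_add z.2 0 (by rw [add_zero]; exact ht.hasDerivAt)
  · exact jet_line_of_contDiffAt hx (ee i)

theorem IsBddNonnegSolC.isOddMild {hN : 0 < N} {f : Fin m → (Fin m → ℝ) → ℝ}
    (hf : ∀ i, ContinuousOn (f i) {v : Fin m → ℝ | ∀ j, 0 ≤ v j}) (H1 : ∀ i, f i 0 = 0)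
    {u : Fin m → EuclideanSpace ℝ (Fin N) → ℝ → ℝ} (hu : IsBddNonnegSolC hN f u) :
    IsOddMild ⟨0, hN⟩ f (oddExt ⟨0, hN⟩ u) := by
  obtain ⟨h1, h2, h3, h4, h5, ⟨C, hC⟩, h7⟩ := hu
  set i₀ : Fin N := ⟨0, hN⟩ with hi₀
  set v := oddExt i₀ u with hv
  have hpos : ∀ i (z : EuclideanSpace ℝ (Fin N) × ℝ), 0 < z.1 i₀ → v i z = u i z.1 z.2 :=
    fun i z hz => if_pos hz
  have hneg : ∀ i (z : EuclideanSpace ℝ (Fin N) × ℝ), z.1 i₀ ≤ 0 →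
      v i z = - u i (coordRefl i₀ z.1) z.2 := fun i z hz => if_neg hz.not_gt
  have hzero : ∀ i (z : EuclideanSpace ℝ (Fin N) × ℝ), z.1 i₀ = 0 → v i z = 0 := fun i z hz => by
    rw [hneg i z hz.le, coordRefl_eq_self i₀ hz, h4 i _ _ hz, neg_zero]
  have hge : ∀ i (z : EuclideanSpace ℝ (Fin N) × ℝ), 0 ≤ z.1 i₀ → v i z = u i z.1 z.2 :=
    fun i z hz => by
      rcases hz.eq_or_lt with h | h
      · rw [hzero i z h.symm, h4 i _ _ h.symm]
      · exact hpos i z h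
  have hodd : ∀ i z, v i (coordRefl i₀ z.1, z.2) = - v i z := by
    intro i z
    rcases le_total 0 (z.1 i₀) with h | h
    · rw [hneg i _ (by simpa using h), hge i z h]; simp
    · rw [hneg i z h, hge i _ (by simpa using h)]; simp
  have hnn : ∀ i z, 0 ≤ z.1 i₀ → 0 ≤ v i z := by
    intro i z hz
    rcases hz.eq_or_lt with h | h
    · rw [hzero i z h.symm]
    · rw [hpos i z h]; exact h5 i _ _ h
  have hC0 : ∀ i z, |v i z| ≤ |C| := by
    have key : ∀ i (z : EuclideanSpace ℝ (Fin N) × ℝ), 0 ≤ z.1 i₀ → |v i z| ≤ |C| := by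
      intro i z hz
      rcases hz.eq_or_lt with h | h
      · rw [hzero i z h.symm, abs_zero]; positivity
      · rw [abs_of_nonneg (hnn i z hz), hpos i z h]; exact (hC i _ _ h).trans (le_abs_self C)
    intro i z
    rcases le_total 0 (z.1 i₀) with h | h
    · exact key i z h
    · have := key i (coordRefl i₀ z.1, z.2) (by simpa using h)
      rwa [hodd, abs_neg] at this
  have hcoord : Continuous fun x : EuclideanSpace ℝ (Fin N) => x i₀ := by fun_prop
  have hvx : ∀ i t, Continuous fun x => v i (x, t) := by
    intro i t
    have hA : IsClosed {x : EuclideanSpace ℝ (Fin N) | 0 ≤ x i₀} := isClosed_le continuous_const hcoord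
    have hB : IsClosed {x : EuclideanSpace ℝ (Fin N) | x i₀ ≤ 0} := isClosed_le hcoord continuous_const
    have h8 : ContinuousOn (fun x => v i (x, t)) {x : EuclideanSpace ℝ (Fin N) | 0 ≤ x i₀} :=
      (h3 i t).congr fun x hx => hge i (x, t) hx
    have h9 : ContinuousOn (fun x => v i (x, t)) {x : EuclideanSpace ℝ (Fin N) | x i₀ ≤ 0} := by
      have : ContinuousOn (fun x => - u i (coordRefl i₀ x) t)
          {x : EuclideanSpace ℝ (Fin N) | x i₀ ≤ 0} :=
        ((h3 i t).comp (coordRefl i₀).continuous.continuousOn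
          (fun x hx => show 0 ≤ coordRefl i₀ x i₀ by simpa using hx)).neg
      exact this.congr fun x hx => hneg i (x, t) hx
    rw [← continuousOn_univ]
    refine (h8.union_of_isClosed h9 hA hB).mono fun x _ => ?_
    exact le_total 0 (x i₀)
  have hvt1 : ∀ i, ∀ x ∉ {x : EuclideanSpace ℝ (Fin N) | x i₀ = 0},
      ContDiff ℝ 1 fun t => v i (x, t) := by
    intro i x hx
    rcases lt_or_gt_of_ne (show x i₀ ≠ 0 from hx) with h | h
    · simp only [hneg i (x, _) h.le]
      exact (h2 i _ (by simpa using h)).neg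
    · simp only [hpos i (x, _) h]
      exact h2 i x h
  have hvt : ∀ i x, Continuous fun t => v i (x, t) := by
    intro i x
    by_cases hx : x i₀ = 0
    · simp only [hzero i (x, _) hx]; exact continuous_const
    · exact (hvt1 i x hx).continuous
  have hfo : ∀ i, Continuous (oddF (f i)) := fun i => continuous_oddF (hf i)
  have hHpos : ∀ i (z : EuclideanSpace ℝ (Fin N) × ℝ), 0 < z.1 i₀ →
      HasHeat (v i) z (oddF (f i) (fun j => v j z)) := by
    intro i z hz
    have hopen : IsOpen {x : EuclideanSpace ℝ (Fin N) | 0 < x i₀} := isOpen_lt continuous_const hcoord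
    have := hasHeat_of_classical (F := fun z => u i z.1 z.2) (z := z)
      ((h1 i z.2).contDiffAt (hopen.mem_nhds hz)) ((h2 i z.1 hz).differentiable (by norm_num) _)
    have h8 : oddF (f i) (fun j => v j z) = f i (fun j => u j z.1 z.2) := by
      rw [oddF_of_nonneg (H1 i) fun j => hnn j z hz.le]
      congr 1; funext j; exact hpos j z hz
    refine (this.congr_val ((h7 i z.1 z.2 hz).trans h8.symm)).congr ?_
    filter_upwards [(hopen.preimage continuous_fst).mem_nhds hz] with w hw
    exact hpos i w hw
  have hH : ∀ i (z : EuclideanSpace ℝ (Fin N) × ℝ), z.1 i₀ ≠ 0 →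
      HasHeat (v i) z (oddF (f i) (fun j => v j z)) := by
    intro i z hz
    rcases lt_or_gt_of_ne hz with h | h
    · have h8 := (HasHeat.comp_coordRefl i₀ (hHpos i (coordRefl i₀ z.1, z.2) (by simpa using h))).neg
      refine (h8.congr_val ?_).congr (Eventually.of_forall fun w => ?_)
      · simp only [hodd]
        rw [show (fun j => - v j z) = -(fun j => v j z) from rfl, oddF_neg, neg_neg]
      · simp [hodd]
    · exact hHpos i z h
  choose M hM using fun i => exists_bound_oddF (hf i) |C|
  have hM' : ∀ i z, |oddF (f i) (fun j => v j z)| ≤ M i := fun i z => hM i _ fun j => hC0 j z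
  have hMn : ∀ i, 0 ≤ M i := fun i => (abs_nonneg _).trans (hM' i 0)
  have hcont : ∀ i, Continuous (v i) := by
    refine fun i => continuous_of_separately_continuous_heat (C := |C| + ∑ i, M i)
      (g := fun i z => oddF (f i) (fun j => v j z))
      (fun i z => (hC0 i z).trans (by have := Finset.sum_nonneg fun i (_ : i ∈ Finset.univ) => hMn i; linarith))
      (fun i z => (hM' i z).trans ?_) hvx hvt
      (fun i t => (hfo i).comp (continuous_pi fun j => hvx j t))
      (fun i x => (hfo i).comp (continuous_pi fun j => hvt j x))
      (fun z hz i => (hfo i).continuousAt.comp (continuousAt_pi.2 hz))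
      (S := {x | x i₀ = 0}) (isClosed_eq hcoord continuous_const)
      (fun i x hx t => hzero i (x, t) hx) hvt1 (fun i x hx t => hH i (x, t) hx) i
    have := Finset.single_le_sum (fun i _ => hMn i) (Finset.mem_univ i)
    have := abs_nonneg C
    linarith
  refine ⟨hcont, ⟨|C|, hC0⟩, hodd, hnn, fun i z => ?_⟩
  refine eq_resolv_of_heat (i₀ := i₀) (hcont i)
    (h := fun w => oddF (f i) (fun j => v j w) + v i w) (B := |C|) (M := M i + |C|)
    (((hfo i).comp (continuous_pi hcont)).add (hcont i)) (hC0 i)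
    (fun z => (abs_add_le _ _).trans (add_le_add (hM' i z) (hC0 i z))) (hodd i) (fun w => ?_)
    (fun w hw => (hH i w hw).congr_val (by ring)) z
  simp only [hodd]
  rw [show (fun j => - v j w) = -(fun j => v j w) from rfl, oddF_neg]
  ring

end OddExtension

/-- Pointwise limits of functions on the line whose derivatives converge boundedly. -/
theorem hasDerivAt_of_tendsto_of_bounded {F G : ℕ → ℝ → ℝ} {f g : ℝ → ℝ} {K : ℝ}
    (hFG : ∀ n r, HasDerivAt (F n) (G n r) r) (hG : ∀ n, Continuous (G n))
    (hK : ∀ n r, |G n r| ≤ K) (hF : ∀ r, Tendsto (fun n => F n r) atTop (𝓝 (f r)))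
    (hGg : ∀ r, Tendsto (fun n => G n r) atTop (𝓝 (g r))) (hg : Continuous g) (r : ℝ) :
    HasDerivAt f (g r) r := by
  have h1 : ∀ s, f s - f 0 = ∫ t in (0 : ℝ)..s, g t := by
    intro s
    have h2 : ∀ n, F n s - F n 0 = ∫ t in (0 : ℝ)..s, G n t := fun n =>
      (intervalIntegral.integral_eq_sub_of_hasDerivAt (fun x _ => hFG n x)
        ((hG n).intervalIntegrable _ _)).symm
    have h3 : Tendsto (fun n => ∫ t in (0 : ℝ)..s, G n t) atTop (𝓝 (∫ t in (0 : ℝ)..s, g t)) :=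
      intervalIntegral.tendsto_integral_filter_of_dominated_convergence (fun _ => K)
        (Eventually.of_forall fun n => (hG n).aestronglyMeasurable)
        (Eventually.of_forall fun n => Eventually.of_forall fun t _ => hK n t)
        intervalIntegrable_const (Eventually.of_forall fun t _ => hGg t)
    refine tendsto_nhds_unique ((hF s).sub (hF 0)) ?_
    simpa only [h2] using h3
  have h4 := intervalIntegral.integral_hasDerivAt_right (hg.intervalIntegrable 0 r)
    hg.stronglyMeasurable.stronglyMeasurableAtFilter hg.continuousAt
  have h5 : f = fun s => (∫ t in (0 : ℝ)..s, g t) + f 0 := funext fun s => by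
    rw [← h1]; ring
  rw [h5]
  exact h4.add_const _

theorem clm_apply_eq_sum {N : ℕ} (A : EuclideanSpace ℝ (Fin N) →L[ℝ] ℝ)
    (e : EuclideanSpace ℝ (Fin N)) : A e = ∑ i, e i * A (ee i) := by
  have h2 : e = ∑ i, e i • ee i := by
    ext j; simp [ee_apply]
  conv_lhs => rw [h2]
  simp

section Gradients

variable {N : ℕ} {F G h : EuclideanSpace ℝ (Fin N) × ℝ → ℝ}
  {L M : EuclideanSpace ℝ (Fin N) × ℝ → EuclideanSpace ℝ (Fin N) →L[ℝ] ℝ}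

/-- `F` has a continuous bounded spatial gradient `L`. -/
structure HasGrad (F : EuclideanSpace ℝ (Fin N) × ℝ → ℝ)
    (L : EuclideanSpace ℝ (Fin N) × ℝ → EuclideanSpace ℝ (Fin N) →L[ℝ] ℝ) : Prop where
  cont : Continuous L
  bdd : ∃ D, ∀ z, ‖L z‖ ≤ D
  hasFDerivAt : ∀ z, HasFDerivAt (fun x => F (x, z.2)) (L z) z.1

theorem HasGrad.line (hF : HasGrad F L) (e : EuclideanSpace ℝ (Fin N))
    (z : EuclideanSpace ℝ (Fin N) × ℝ) (r : ℝ) :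
    HasDerivAt (fun r : ℝ => F (z + r • (e, (0 : ℝ)))) (L (z + r • (e, (0 : ℝ))) e) r := by
  have h1 := hF.hasFDerivAt (z + r • (e, (0 : ℝ)))
  have h2 : HasDerivAt (fun r : ℝ => z.1 + r • e) e r := by
    simpa using ((hasDerivAt_id r).smul_const e).const_add z.1
  have h3 := HasFDerivAt.comp_hasDerivAt (f := fun r : ℝ => z.1 + r • e) r
    (by simpa using h1) h2
  refine (h3.congr_of_eventuallyEq (Eventually.of_forall fun s => ?_)).congr_deriv ?_
  · simp [Prod.add_def]
  · simp

theorem HasGrad.continuous_apply (hF : HasGrad F L) (e : EuclideanSpace ℝ (Fin N)) :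
    Continuous fun z => L z e := hF.cont.clm_apply continuous_const

theorem HasGrad.exists_bound_apply (hF : HasGrad F L) (e : EuclideanSpace ℝ (Fin N)) :
    ∃ D, ∀ z, |L z e| ≤ D := by
  obtain ⟨D, hD⟩ := hF.bdd
  exact ⟨D * ‖e‖, fun z => ((L z).le_opNorm e).trans
    (mul_le_mul_of_nonneg_right (hD z) (norm_nonneg _))⟩

theorem HasGrad.add (hF : HasGrad F L) (hG : HasGrad G M) :
    HasGrad (fun z => F z + G z) fun z => L z + M z := by
  obtain ⟨D, hD⟩ := hF.bdd
  obtain ⟨D', hD'⟩ := hG.bdd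
  exact ⟨hF.cont.add hG.cont, ⟨D + D', fun z => (norm_add_le _ _).trans (add_le_add (hD z) (hD' z))⟩,
    fun z => (hF.hasFDerivAt z).add (hG.hasFDerivAt z)⟩

theorem HasGrad.of_line {P : EuclideanSpace ℝ (Fin N) → EuclideanSpace ℝ (Fin N) × ℝ → ℝ}
    (hd : ∀ e z (r : ℝ), HasDerivAt (fun r : ℝ => F (z + r • (e, (0 : ℝ)))) (P e (z + r • (e, (0 : ℝ)))) r)
    (hc : ∀ i, Continuous (P (ee i))) (hb : ∀ i, ∃ D, ∀ z, |P (ee i) z| ≤ D)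
    (hlin : ∀ e z, P e z = ∑ i, e i * P (ee i) z) :
    HasGrad F fun z => ∑ i, P (ee i) z • (EuclideanSpace.proj i : EuclideanSpace ℝ (Fin N) →L[ℝ] ℝ) := by
  have hLc : Continuous fun z =>
      ∑ i, P (ee i) z • (EuclideanSpace.proj i : EuclideanSpace ℝ (Fin N) →L[ℝ] ℝ) :=
    continuous_finsetSum _ fun i _ => (hc i).smul continuous_const
  have hL : ∀ z e, (∑ i, P (ee i) z • (EuclideanSpace.proj i : EuclideanSpace ℝ (Fin N) →L[ℝ] ℝ)) e
      = P e z := by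
    intro z e
    rw [hlin e z]
    simp [mul_comm]
  refine ⟨hLc, ?_, fun z => ?_⟩
  · choose D hD using hb
    refine ⟨∑ i, D i * ‖(EuclideanSpace.proj i : EuclideanSpace ℝ (Fin N) →L[ℝ] ℝ)‖, fun z => ?_⟩
    refine (norm_sum_le _ _).trans (Finset.sum_le_sum fun i _ => ?_)
    rw [norm_smul]
    exact mul_le_mul_of_nonneg_right (hD i z) (norm_nonneg _)
  · rw [hasFDerivAt_iff_isLittleO_nhds_zero, Asymptotics.isLittleO_iff]
    intro ε hε
    obtain ⟨δ, hδ, hball⟩ := Metric.continuousAt_iff.1 (hLc.continuousAt (x := z)) ε hε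
    filter_upwards [Metric.ball_mem_nhds (0 : EuclideanSpace ℝ (Fin N)) hδ] with y hy
    obtain ⟨c, hc, hceq⟩ := exists_hasDerivAt_eq_slope (fun r : ℝ => F (z + r • (y, (0 : ℝ))))
      (fun r => P y (z + r • (y, (0 : ℝ)))) zero_lt_one
      (fun r _ => (hd y z r).continuousAt.continuousWithinAt) (fun r _ => hd y z r)
    have h1 : F (z.1 + y, z.2) - F (z.1, z.2) = P y (z + c • (y, (0 : ℝ))) := by
      rw [hceq]; simp [Prod.add_def]
    rw [h1, ← hL, ← _root_.sub_apply]
    refine (ContinuousLinearMap.le_opNorm _ _).trans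
      (mul_le_mul_of_nonneg_right ?_ (norm_nonneg _))
    rw [← dist_eq_norm]
    refine (hball ?_).le
    rw [dist_eq_norm, add_sub_cancel_left, norm_smul, Prod.norm_def]
    simp only [norm_zero, norm_nonneg, sup_of_le_left, Real.norm_eq_abs, abs_of_pos hc.1]
    have : ‖y‖ < δ := by simpa using hy
    nlinarith [hc.2, norm_nonneg y]

theorem HasGrad.contDiff_one (hF : HasGrad F L) (t : ℝ) : ContDiff ℝ 1 fun x => F (x, t) := by
  rw [contDiff_one_iff_fderiv]
  refine ⟨fun x => (hF.hasFDerivAt (x, t)).differentiableAt, ?_⟩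
  have : fderiv ℝ (fun x => F (x, t)) = fun x => L (x, t) :=
    funext fun x => (hF.hasFDerivAt (x, t)).fderiv
  rw [this]
  exact hF.cont.comp (by fun_prop)

theorem HasGrad.contDiff_two (hF : HasGrad F L)
    (hL : ∀ i, ∃ K, HasGrad (fun z => L z (ee i)) K) (t : ℝ) : ContDiff ℝ 2 fun x => F (x, t) := by
  rw [show (2 : WithTop ℕ∞) = 1 + 1 from one_add_one_eq_two.symm, contDiff_succ_iff_fderiv]
  have h1 : fderiv ℝ (fun x => F (x, t)) = fun x => ∑ i, L (x, t) (ee i) •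
      (EuclideanSpace.proj i : EuclideanSpace ℝ (Fin N) →L[ℝ] ℝ) := by
    funext x
    rw [(hF.hasFDerivAt (x, t)).fderiv]
    ext e
    rw [clm_apply_eq_sum]
    simp [mul_comm]
  refine ⟨fun x => (hF.hasFDerivAt (x, t)).differentiableAt, by simp, ?_⟩
  rw [h1]
  refine ContDiff.sum fun i _ => ?_
  obtain ⟨K, hK⟩ := hL i
  exact (hK.contDiff_one t).smul (contDiff_const (c := EuclideanSpace.proj i))

theorem hasDerivAt_resolv_line (hc : Continuous h) {C : ℝ} (hC : ∀ z, |h z| ≤ C)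
    (e : EuclideanSpace ℝ (Fin N)) (z : EuclideanSpace ℝ (Fin N) × ℝ) (r : ℝ) :
    HasDerivAt (fun r : ℝ => resolv h (z + r • (e, (0 : ℝ))))
      (wres (gradWeight e) h (z + r • (e, (0 : ℝ)))) r := by
  have hW : Integrable (fun _ : ℝ × EuclideanSpace ℝ (Fin N) => (1 : ℝ)) (resLaw N) :=
    integrable_const _
  obtain ⟨H, h1, h2, h3⟩ := exists_moll_seq hc hC
  refine hasDerivAt_of_tendsto_of_bounded (K := (∫ p, |gradWeight e p| ∂(resLaw N)) * C)
    (F := fun n r => resolv (H n) (z + r • (e, (0 : ℝ))))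
    (G := fun n r => wres (gradWeight e) (H n) (z + r • (e, (0 : ℝ))))
    (g := fun r => wres (gradWeight e) h (z + r • (e, (0 : ℝ)))) (fun n r => ?_)
    (fun n => ?_) (fun n r => abs_wres_le (integrable_gradWeight e) (h2 n) _) (fun r => ?_)
    (fun r => ?_) ?_ r
  · have h4 := (h1 n).1.resolv.hasDerivAt_line z (e, 0) r
    refine h4.congr_deriv ?_
    rw [(h1 n).1.wres_gradWeight]
    exact (h1 n).1.fderiv_wres hW _ _
  · exact (continuous_wres (integrable_gradWeight e) (h1 n).1.continuous (h2 n)).comp (by fun_prop)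
  · exact tendsto_wres hW (fun n => (h1 n).1.continuous) h2 h3 _
  · exact tendsto_wres (integrable_gradWeight e) (fun n => (h1 n).1.continuous) h2 h3 _
  · exact (continuous_wres (integrable_gradWeight e) hc hC).comp (by fun_prop)

theorem hasDerivAt_wres_line {W : ℝ × EuclideanSpace ℝ (Fin N) → ℝ} (hW : Integrable W (resLaw N))
    (hc : Continuous h) {C : ℝ} (hC : ∀ z, |h z| ≤ C) {v : EuclideanSpace ℝ (Fin N) × ℝ}
    {k : EuclideanSpace ℝ (Fin N) × ℝ → ℝ} {D : ℝ} (hkc : Continuous k) (hkD : ∀ z, |k z| ≤ D)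
    (hd : ∀ z (r : ℝ), HasDerivAt (fun r : ℝ => h (z + r • v)) (k (z + r • v)) r)
    (z : EuclideanSpace ℝ (Fin N) × ℝ) (r : ℝ) :
    HasDerivAt (fun r : ℝ => wres W h (z + r • v)) (wres W k (z + r • v)) r := by
  unfold wres
  refine (hasDerivAt_integral_of_dominated_loc_of_deriv_le (s := univ)
      (F := fun r p => W p * h (z + r • v - disp p)) (F' := fun r p => W p * k (z + r • v - disp p))
      (bound := fun p => |W p| * D) univ_mem
      (Eventually.of_forall fun r => (integrable_wres hW hc hC _).aestronglyMeasurable)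
      (integrable_wres hW hc hC _) (integrable_wres hW hkc hkD _).aestronglyMeasurable
      (Eventually.of_forall fun p r _ => ?_) (hW.abs.mul_const D)
      (Eventually.of_forall fun p r _ => ?_)).2
  · rw [norm_mul]; exact mul_le_mul_of_nonneg_left (hkD _) (abs_nonneg _)
  · have := (hd (z - disp p) r).const_mul (W p)
    simpa only [sub_add_eq_add_sub] using this

theorem gradWeight_eq_sum (e : EuclideanSpace ℝ (Fin N)) (p : ℝ × EuclideanSpace ℝ (Fin N)) :
    gradWeight e p = ∑ i, e i * gradWeight (ee i) p := by
  simp only [gradWeight, ee, PiLp.inner_apply, Finset.mul_sum,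
    ← Finset.sum_neg_distrib]
  refine Finset.sum_congr rfl fun i _ => ?_
  simp
  ring

theorem hasGrad_resolv (hc : Continuous h) {C : ℝ} (hC : ∀ z, |h z| ≤ C) :
    HasGrad (resolv h) fun z => ∑ i, wres (gradWeight (ee i)) h z •
      (EuclideanSpace.proj i : EuclideanSpace ℝ (Fin N) →L[ℝ] ℝ) := by
  refine HasGrad.of_line (P := fun e => wres (gradWeight e) h)
    (fun e z r => hasDerivAt_resolv_line hc hC e z r)
    (fun i => continuous_wres (integrable_gradWeight _) hc hC)
    (fun i => ⟨_, abs_wres_le (integrable_gradWeight _) hC⟩) fun e z => ?_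
  unfold wres
  simp only [← integral_const_mul]
  rw [← integral_finsetSum _ fun i _ =>
    (integrable_wres (integrable_gradWeight (ee i)) hc hC z).const_mul (e i)]
  refine integral_congr_ae (Eventually.of_forall fun p => ?_)
  simp only [gradWeight_eq_sum e, Finset.sum_mul, mul_assoc]

theorem HasGrad.wres {W : ℝ × EuclideanSpace ℝ (Fin N) → ℝ} (hW : Integrable W (resLaw N))
    (hc : Continuous h) {C : ℝ} (hC : ∀ z, |h z| ≤ C) (hL : HasGrad h L) :
    HasGrad (wres W h) fun z => ∑ i, _root_.wres W (fun z => L z (ee i)) z •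
      (EuclideanSpace.proj i : EuclideanSpace ℝ (Fin N) →L[ℝ] ℝ) := by
  choose D hD using hL.exists_bound_apply
  refine HasGrad.of_line (P := fun e => _root_.wres W fun z => L z e)
    (fun e z r => hasDerivAt_wres_line hW hc hC (hL.continuous_apply e) (hD e) (hL.line e) z r)
    (fun i => continuous_wres hW (hL.continuous_apply _) (hD _))
    (fun i => ⟨_, abs_wres_le hW (hD _)⟩) fun e z => ?_
  unfold _root_.wres
  simp only [← integral_const_mul]
  rw [← integral_finsetSum _ fun i _ =>
    (integrable_wres hW (hL.continuous_apply _) (hD (ee i)) z).const_mul (e i)]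
  refine integral_congr_ae (Eventually.of_forall fun p => ?_)
  simp only [clm_apply_eq_sum (L (z - disp p)) e, Finset.mul_sum]
  exact Finset.sum_congr rfl fun i _ => by ring

/-- The time derivative of the resolvent of a function with continuous spatial gradient. -/
theorem HasGrad.hasDerivAt_resolv_time (hc : Continuous h) {C : ℝ} (hC : ∀ z, |h z| ≤ C)
    (hL : HasGrad h L) (x : EuclideanSpace ℝ (Fin N)) (t : ℝ) :
    HasDerivAt (fun t => resolv h (x, t))
      (∑ i, _root_.wres (gradWeight (ee i)) (fun z => L z (ee i)) (x, t) + h (x, t) - resolv h (x, t))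
      t := by
  have hW : Integrable (fun _ : ℝ × EuclideanSpace ℝ (Fin N) => (1 : ℝ)) (resLaw N) :=
    integrable_const _
  choose D hD using fun i : Fin N => hL.exists_bound_apply (ee i)
  obtain ⟨H, h1, h2, h3, h4, h5⟩ := exists_moll_seq_deriv hc hC (fun i : Fin N => hL.continuous_apply _)
    hD (fun i => hL.line (ee i))
  have hline : Continuous fun t : ℝ => (x, t) := by fun_prop
  have hcg := fun i n => continuous_wres (integrable_gradWeight (ee i))
    ((h1 n).1.continuous_fderiv (ee i, 0)) (h4 i n)
  refine hasDerivAt_of_tendsto_of_bounded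
    (K := ∑ i, (∫ p, |gradWeight (ee i) p| ∂(resLaw N)) * D i + C + C)
    (F := fun n t => resolv (H n) (x, t))
    (G := fun n t => ∑ i, _root_.wres (gradWeight (ee i)) (fun z => fderiv ℝ (H n) z (ee i, 0)) (x, t)
      + H n (x, t) - resolv (H n) (x, t))
    (g := fun t => ∑ i, _root_.wres (gradWeight (ee i)) (fun z => L z (ee i)) (x, t)
      + h (x, t) - resolv h (x, t))
    (fun n r => ?_) (fun n => ?_) (fun n r => ?_) (fun r => ?_) (fun r => ?_) ?_ t
  · have h6 := (h1 n).1.resolv.hasDerivAt_line (x, 0) (0, 1) r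
    have h7 : ∀ s : ℝ, (x, (0 : ℝ)) + s • ((0 : EuclideanSpace ℝ (Fin N)), (1 : ℝ)) = (x, s) :=
      fun s => by simp
    simp only [h7] at h6
    refine h6.congr_deriv ?_
    have h8 := (h1 n).heatOp_resolv (x, r)
    unfold heatOp at h8
    have h9 : ∀ i : Fin N, (fun y => fderiv ℝ (resolv (H n)) y (ee i, 0)) =
        _root_.wres (gradWeight (ee i)) (H n) := fun i => funext fun y => by
      rw [(h1 n).1.wres_gradWeight]
      exact (h1 n).1.fderiv_wres hW _ _
    simp only [h9, (h1 n).1.fderiv_wres (integrable_gradWeight _)] at h8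
    linarith
  · exact ((continuous_finsetSum _ fun i _ => (hcg i n).comp hline).add
      ((h1 n).1.continuous.comp hline)).sub ((h1 n).1.resolv.continuous.comp hline)
  · refine (abs_sub _ _).trans (add_le_add ((abs_add_le _ _).trans (add_le_add ?_ (h2 n _)))
      (abs_resolv_le (h2 n) _))
    exact (Finset.abs_sum_le_sum_abs _ _).trans (Finset.sum_le_sum fun i _ =>
      abs_wres_le (integrable_gradWeight _) (h4 i n) _)
  · exact tendsto_wres hW (fun n => (h1 n).1.continuous) h2 h3 _
  · exact ((tendsto_finsetSum _ fun i _ => tendsto_wres (integrable_gradWeight _)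
      (fun n => (h1 n).1.continuous_fderiv _) (h4 i) (h5 i) _).add (h3 _)).sub
      (tendsto_wres hW (fun n => (h1 n).1.continuous) h2 h3 _)
  · exact ((continuous_finsetSum _ fun i _ => (continuous_wres (integrable_gradWeight _)
      (hL.continuous_apply _) (hD i)).comp hline).add (hc.comp hline)).sub
      ((continuous_wres hW hc hC).comp hline)

end Gradients

section Orthant

variable {m : ℕ} {φ : (Fin m → ℝ) → ℝ}

/-- The closed nonnegative orthant. -/
abbrev orthant (m : ℕ) : Set (Fin m → ℝ) := {v : Fin m → ℝ | ∀ j, 0 ≤ v j}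

theorem isClosed_orthant (m : ℕ) : IsClosed (orthant m) := by
  rw [orthant, ofPred_forall]
  exact isClosed_iInter fun j => isClosed_le continuous_const (continuous_apply j)

theorem uniqueDiffOn_orthant (m : ℕ) : UniqueDiffOn ℝ (orthant m) := by
  have : orthant m = Set.pi univ fun _ => Ici (0 : ℝ) := by
    ext v; simp [orthant, Pi.le_def]
  rw [this]
  exact UniqueDiffOn.univ_pi fun _ => uniqueDiffOn_Ici 0

/-- The derivative of the odd extension, at vectors of constant sign. -/
noncomputable def dOdd (φ : (Fin m → ℝ) → ℝ) (v : Fin m → ℝ) : (Fin m → ℝ) →L[ℝ] ℝ :=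
  fderivWithin ℝ φ (orthant m) fun j => |v j|

theorem dOdd_neg (φ : (Fin m → ℝ) → ℝ) (v : Fin m → ℝ) : dOdd φ (-v) = dOdd φ v := by
  simp [dOdd]

theorem dOdd_of_mem {v : Fin m → ℝ} (hv : v ∈ orthant m) :
    dOdd φ v = fderivWithin ℝ φ (orthant m) v := by
  have : (fun j => |v j|) = v := funext fun j => abs_of_nonneg (hv j)
  rw [dOdd, this]

theorem continuous_dOdd (hφ : ContDiffOn ℝ 1 φ (orthant m)) : Continuous (dOdd φ) := by
  have h1 : ContinuousOn (fderivWithin ℝ φ (orthant m)) (orthant m) :=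
    hφ.continuousOn_fderivWithin (uniqueDiffOn_orthant m) le_rfl
  exact h1.comp_continuous (continuous_pi fun j => (continuous_apply j).abs)
    fun v j => abs_nonneg (v j)

theorem hasFDerivWithinAt_oddF_of_mem (hφ : ContDiffOn ℝ 1 φ (orthant m)) {v : Fin m → ℝ}
    (hv : v ∈ orthant m) :
    HasFDerivWithinAt (oddF φ) (dOdd φ v) (orthant m ∪ {v | -v ∈ orthant m}) v := by
  have h1 : ∀ w ∈ orthant m, HasFDerivWithinAt (oddF φ) (dOdd φ w) (orthant m) w := fun w hw => by
    rw [dOdd_of_mem hw]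
    have h2 := ((hφ.differentiableOn (by norm_num)) w hw).hasFDerivWithinAt
    have h3 : ∀ w ∈ orthant m, oddF φ w = φ w - φ 0 := fun w hw => by
      have h1 : w ⊔ 0 = w := sup_eq_left.2 hw
      have h2 : (-w) ⊔ 0 = 0 := sup_eq_right.2 fun j => by simpa using hw j
      simp [oddF, h1, h2]
    exact (h2.sub_const (φ 0)).congr h3 (h3 w hw)
  have hcl : IsClosed {v : Fin m → ℝ | -v ∈ orthant m} :=
    (isClosed_orthant m).preimage continuous_neg
  refine (h1 v hv).union ?_
  by_cases hv' : -v ∈ orthant m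
  · have h4 := (h1 (-v) hv').comp (f := fun w => -w) (s := {v : Fin m → ℝ | -v ∈ orthant m}) v
      (hasFDerivAt_id v).neg.hasFDerivWithinAt fun w hw => hw
    have h5 := h4.neg
    rw [dOdd_neg] at h5
    refine (h5.congr_fderiv ?_).congr (fun w _ => ?_) ?_
    · ext e; simp
    · simp [oddF_neg]
    · simp [oddF_neg]
  · exact HasFDerivWithinAt.of_notMem_closure (by rwa [hcl.closure_eq])

theorem hasFDerivWithinAt_oddF (hφ : ContDiffOn ℝ 1 φ (orthant m)) {v : Fin m → ℝ}
    (hv : v ∈ orthant m ∪ {v | -v ∈ orthant m}) :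
    HasFDerivWithinAt (oddF φ) (dOdd φ v) (orthant m ∪ {v | -v ∈ orthant m}) v := by
  rcases hv with hv | hv
  · exact hasFDerivWithinAt_oddF_of_mem hφ hv
  · have h4 := (hasFDerivWithinAt_oddF_of_mem hφ hv).comp (f := fun w => -w)
      (s := orthant m ∪ {v : Fin m → ℝ | -v ∈ orthant m}) v
      (hasFDerivAt_id v).neg.hasFDerivWithinAt fun w hw => by
        rcases hw with hw | hw
        · exact Or.inr (by simpa using hw)
        · exact Or.inl hw
    have h5 := h4.neg
    rw [dOdd_neg] at h5
    refine (h5.congr_fderiv ?_).congr (fun w _ => ?_) ?_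
    · ext e; simp
    · simp [oddF_neg]
    · simp [oddF_neg]

end Orthant

section Regularity

variable {N m : ℕ} {i₀ : Fin N} {f : Fin m → (Fin m → ℝ) → ℝ}
  {v : Fin m → EuclideanSpace ℝ (Fin N) × ℝ → ℝ}

theorem HasGrad.oddF {φ : (Fin m → ℝ) → ℝ} (hφ : ContDiffOn ℝ 1 φ (orthant m))
    {L : Fin m → EuclideanSpace ℝ (Fin N) × ℝ → EuclideanSpace ℝ (Fin N) →L[ℝ] ℝ}
    (hv : ∀ j, HasGrad (v j) (L j)) (hc : ∀ j, Continuous (v j)) {C : ℝ} (hC : ∀ j z, |v j z| ≤ C)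
    (hK : ∀ z, (fun j => v j z) ∈ orthant m ∪ {v | -v ∈ orthant m}) :
    HasGrad (fun z => _root_.oddF φ fun j => v j z)
      fun z => ∑ j, dOdd φ (fun j => v j z) (Pi.single j 1) • L j z := by
  have hd : ∀ j, Continuous fun z => dOdd φ (fun j => v j z) (Pi.single j 1) := fun j =>
    ((continuous_dOdd hφ).comp (continuous_pi hc)).clm_apply continuous_const
  refine ⟨continuous_finsetSum _ fun j _ => (hd j).smul (hv j).cont, ?_, fun z => ?_⟩
  · obtain ⟨M, hM⟩ := (isCompact_univ_pi fun _ : Fin m =>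
      (isCompact_Icc (a := -C) (b := C))).exists_bound_of_continuousOn (continuous_dOdd hφ).continuousOn
    choose D hD using fun j => (hv j).bdd
    refine ⟨∑ j : Fin m, M * ‖(Pi.single j 1 : Fin m → ℝ)‖ * D j, fun z => (norm_sum_le _ _).trans
      (Finset.sum_le_sum fun j _ => ?_)⟩
    rw [norm_smul]
    have h1 : ‖dOdd φ fun j => v j z‖ ≤ M := hM _ fun j _ => abs_le.1 (hC j z)
    refine mul_le_mul ((ContinuousLinearMap.le_opNorm _ _).trans
      (mul_le_mul_of_nonneg_right h1 (norm_nonneg _))) (hD j z) (norm_nonneg _) ?_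
    exact mul_nonneg ((norm_nonneg _).trans h1) (norm_nonneg _)
  · have h1 : HasFDerivAt (fun x => fun j => v j (x, z.2)) (ContinuousLinearMap.pi fun j => L j z) z.1 :=
      hasFDerivAt_pi.2 fun j => (hv j).hasFDerivAt z
    have h2 := (hasFDerivWithinAt_oddF hφ (hK z)).comp_hasFDerivAt (f := fun x => fun j => v j (x, z.2))
      z.1 h1 (Eventually.of_forall fun x => hK (x, z.2))
    refine h2.congr_fderiv ?_
    ext e
    have h3 : (fun j => L j z e) = ∑ j, L j z e • (Pi.single j 1 : Fin m → ℝ) := by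
      ext j; simp [Finset.sum_apply, Pi.single_apply]
    have h4 : (ContinuousLinearMap.pi fun j => L j z) e = fun j => L j z e := rfl
    rw [ContinuousLinearMap.comp_apply, h4, h3, map_sum]
    simp [mul_comm]

theorem IsOddMild.mem_union (hv : IsOddMild i₀ f v) (z : EuclideanSpace ℝ (Fin N) × ℝ) :
    (fun j => v j z) ∈ orthant m ∪ {v | -v ∈ orthant m} := by
  rcases le_total 0 (z.1 i₀) with h | h
  · exact Or.inl fun j => hv.nonneg j z h
  · refine Or.inr fun j => ?_
    have := hv.nonneg j (coordRefl i₀ z.1, z.2) (by simpa using h)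
    rwa [hv.odd] at this

theorem IsOddMild.regularity (hv : IsOddMild i₀ f v) (hf : ∀ i, ContDiffOn ℝ 1 (f i) (orthant m)) :
    ∃ (L : Fin m → EuclideanSpace ℝ (Fin N) × ℝ → EuclideanSpace ℝ (Fin N) →L[ℝ] ℝ)
      (K : Fin m → Fin N → EuclideanSpace ℝ (Fin N) × ℝ → EuclideanSpace ℝ (Fin N) →L[ℝ] ℝ),
      (∀ i, HasGrad (v i) (L i)) ∧ (∀ i j, HasGrad (fun z => L i z (ee j)) (K i j)) ∧
      ∀ i x t, HasDerivAt (fun t => v i (x, t))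
        (∑ j, K i j (x, t) (ee j) + oddF (f i) (fun j => v j (x, t))) t := by
  obtain ⟨C, hC⟩ := hv.bdd
  choose M hM using fun i => exists_bound_oddF (hf i).continuousOn C
  let h : Fin m → EuclideanSpace ℝ (Fin N) × ℝ → ℝ := fun i w => oddF (f i) (fun j => v j w) + v i w
  have hh : ∀ i, Continuous (h i) := fun i =>
    ((continuous_oddF (hf i).continuousOn).comp (continuous_pi hv.cont)).add (hv.cont i)
  have hhb : ∀ i z, |h i z| ≤ M i + C := fun i z =>
    (abs_add_le _ _).trans (add_le_add (hM i _ fun j => hC j z) (hC i z))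
  have hvh : ∀ i, v i = resolv (h i) := fun i => funext fun z => hv.mild i z
  have hL : ∀ i, HasGrad (v i) _ := fun i => by
    rw [hvh i]
    exact hasGrad_resolv (hh i) (hhb i)
  obtain ⟨Lh, hLh⟩ : ∃ Lh : Fin m → EuclideanSpace ℝ (Fin N) × ℝ → EuclideanSpace ℝ (Fin N) →L[ℝ] ℝ,
      ∀ i, HasGrad (h i) (Lh i) :=
    ⟨_, fun i => (HasGrad.oddF (hf i) hL hv.cont hC hv.mem_union).add (hL i)⟩
  have hK := fun i (j : Fin N) =>
    HasGrad.wres (integrable_gradWeight (ee j)) (hh i) (hhb i) (hLh i)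
  refine ⟨_, fun i j z => ∑ k, wres (gradWeight (ee j)) (fun z => Lh i z (ee k)) z •
    (EuclideanSpace.proj k : EuclideanSpace ℝ (Fin N) →L[ℝ] ℝ), hL, fun i j => ?_, fun i x t => ?_⟩
  · have h1 : (fun z => (∑ k, wres (gradWeight (ee k)) (h i) z •
        (EuclideanSpace.proj k : EuclideanSpace ℝ (Fin N) →L[ℝ] ℝ)) (ee j)) =
        wres (gradWeight (ee j)) (h i) := by
      funext z
      simp [ee_apply]
    rw [h1]
    exact hK i j
  · have h1 := (hLh i).hasDerivAt_resolv_time (hh i) (hhb i) x t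
    rw [← hvh] at h1
    refine h1.congr_deriv ?_
    simp [h, ee_apply]
    ring

end Regularity

section Consequences

variable {N m : ℕ} {i₀ : Fin N} {f : Fin m → (Fin m → ℝ) → ℝ}
  {v : Fin m → EuclideanSpace ℝ (Fin N) × ℝ → ℝ}

theorem HasHeat.unique {F : EuclideanSpace ℝ (Fin N) × ℝ → ℝ} {z : EuclideanSpace ℝ (Fin N) × ℝ}
    {a b : ℝ} (h : HasHeat F z a) (h' : HasHeat F z b) : a = b := by
  obtain ⟨τ, p, l, hj, rfl⟩ := h
  obtain ⟨τ', p', l', hj', rfl⟩ := h'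
  rw [hj.1.unique hj'.1, Finset.sum_congr rfl fun i _ => ((hj.2 i).unique (hj'.2 i)).2]

theorem IsOddMild.hasHeat (hv : IsOddMild i₀ f v) (hf : ∀ i, ContDiffOn ℝ 1 (f i) (orthant m))
    (i : Fin m) (z : EuclideanSpace ℝ (Fin N) × ℝ) :
    HasHeat (v i) z (oddF (f i) fun j => v j z) := by
  obtain ⟨L, K, hL, hK, ht⟩ := hv.regularity hf
  have hz : ∀ (r : ℝ) (j : Fin N), z + r • (ee j, (0 : ℝ)) = (z.1 + r • ee j, z.2) := fun r j => by
    ext <;> simp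
  have h1 : HasJet (v i) z (∑ j, K i j z (ee j) + oddF (f i) fun j => v j z) (fun j => L i z (ee j)) (fun j => K i j z (ee j)) := by
    refine ⟨HasDerivAt.comp_const_add z.2 0 (by rw [add_zero]; exact ht i z.1 z.2), fun j => ?_⟩
    refine Jet.of_hasDerivAt (φ' := fun r => L i (z.1 + r • ee j, z.2) (ee j))
      (Eventually.of_forall fun r => ?_) (by simp) ?_
    · simpa only [hz] using (hL i).line (ee j) z r
    · have := (hK i j).line (ee j) z 0
      simp only [hz] at this
      simpa using this
  exact h1.hasHeat.congr_val (by ring)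

theorem IsOddMild.contDiff_two (hv : IsOddMild i₀ f v)
    (hf : ∀ i, ContDiffOn ℝ 1 (f i) (orthant m)) (i : Fin m) (t : ℝ) :
    ContDiff ℝ 2 fun x => v i (x, t) := by
  obtain ⟨L, K, hL, hK, -⟩ := hv.regularity hf
  exact (hL i).contDiff_two (fun j => ⟨_, hK i j⟩) t

theorem IsOddMild.eq_zero (hv : IsOddMild i₀ f v) (i : Fin m) {z : EuclideanSpace ℝ (Fin N) × ℝ}
    (hz : z.1 i₀ = 0) : v i z = 0 := by
  have := hv.odd i z
  rw [coordRefl_eq_self i₀ hz] at this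
  linarith [show v i z = - v i z from this]

theorem IsOddMild.isBddNonnegSolC {hN : 0 < N} (hv : IsOddMild ⟨0, hN⟩ f v)
    (hf : ∀ i, ContDiffOn ℝ 1 (f i) (orthant m)) (H1 : ∀ i, f i 0 = 0) :
    IsBddNonnegSolC hN f fun i x t => v i (x, t) := by
  obtain ⟨L, K, hL, hK, ht⟩ := hv.regularity hf
  obtain ⟨C, hC⟩ := hv.bdd
  have htime : ∀ i x, ContDiff ℝ 1 fun t => v i (x, t) := fun i x => by
    rw [contDiff_one_iff_deriv]
    refine ⟨fun t => (ht i x t).differentiableAt, ?_⟩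
    rw [show deriv (fun t => v i (x, t)) = _ from funext fun t => (ht i x t).deriv]
    refine (continuous_finsetSum _ fun j _ => ?_).add ?_
    · exact ((hK i j).cont.clm_apply continuous_const).comp (by fun_prop)
    · exact (continuous_oddF (hf i).continuousOn).comp
        (continuous_pi fun j => (hv.cont j).comp (by fun_prop))
  refine ⟨fun i t => (hv.contDiff_two hf i t).contDiffOn, fun i x _ => htime i x,
    fun i t => (hv.contDiff_two hf i t).continuous.continuousOn,
    fun i x t hx => hv.eq_zero i hx, fun i x t hx => hv.nonneg i _ hx.le,
    ⟨C, fun i x t _ => (le_abs_self _).trans (hC i _)⟩, fun i x t hx => ?_⟩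
  have h1 := hasHeat_of_classical (F := v i) (z := (x, t))
    (hv.contDiff_two hf i t).contDiffAt ((htime i x).differentiable one_ne_zero t)
  rw [h1.unique (hv.hasHeat hf i (x, t)), oddF_of_nonneg (H1 i) fun j => hv.nonneg j (x, t) hx.le]

theorem IsOddMild.exists_lipschitz (hv : IsOddMild i₀ f v)
    (hf : ∀ i, ContDiffOn ℝ 1 (f i) (orthant m)) :
    ∃ K, ∀ i z w, |v i z - v i w| ≤ K * dist z w := by
  obtain ⟨L, K, hL, hK, ht⟩ := hv.regularity hf
  obtain ⟨C, hC⟩ := hv.bdd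
  have key : ∀ i, ∃ B, 0 ≤ B ∧ ∀ z w, |v i z - v i w| ≤ B * dist z w := by
    intro i
    obtain ⟨D, hD⟩ := (hL i).bdd
    choose D' hD' using fun j => (hK i j).exists_bound_apply (ee j)
    obtain ⟨M, hM⟩ := exists_bound_oddF (hf i).continuousOn C
    have hx : ∀ x y t, |v i (x, t) - v i (y, t)| ≤ D * ‖x - y‖ := fun x y t =>
      convex_univ.norm_image_sub_le_of_norm_hasFDerivWithin_le (f := fun x => v i (x, t))
        (f' := fun x => L i (x, t)) (fun x _ => ((hL i).hasFDerivAt (x, t)).hasFDerivWithinAt)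
        (fun x _ => hD (x, t)) (mem_univ y) (mem_univ x)
    have hs : ∀ x s t, |v i (x, s) - v i (x, t)| ≤ (∑ j, D' j + M) * ‖s - t‖ := fun x s t =>
      convex_univ.norm_image_sub_le_of_norm_hasDerivWithin_le (f := fun t => v i (x, t))
        (fun t _ => (ht i x t).hasDerivWithinAt)
        (fun t _ => (norm_add_le _ _).trans (add_le_add ((norm_sum_le _ _).trans
          (Finset.sum_le_sum fun j _ => hD' j (x, t))) (hM _ fun j => hC j (x, t))))
        (mem_univ t) (mem_univ s)
    have hD0 : 0 ≤ D := (norm_nonneg _).trans (hD 0)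
    have hE0 : 0 ≤ ∑ j, D' j + M := add_nonneg
      (Finset.sum_nonneg fun j _ => (abs_nonneg _).trans (hD' j 0))
      ((abs_nonneg _).trans (hM _ fun j => hC j 0))
    refine ⟨D + (∑ j, D' j + M), add_nonneg hD0 hE0, fun z w => ?_⟩
    have h1 : ‖z.1 - w.1‖ ≤ dist z w := by
      rw [Prod.dist_eq, ← dist_eq_norm]; exact le_max_left _ _
    have h2 : ‖z.2 - w.2‖ ≤ dist z w := by
      rw [Prod.dist_eq, ← dist_eq_norm]; exact le_max_right _ _
    have h3 : |v i z - v i w| ≤ |v i (z.1, z.2) - v i (w.1, z.2)| + |v i (w.1, z.2) - v i (w.1, w.2)| :=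
      abs_sub_le _ _ _
    have h4 := hx z.1 w.1 z.2
    have h5 := hs w.1 z.2 w.2
    have h6 := mul_le_mul_of_nonneg_left h1 hD0
    have h7 := mul_le_mul_of_nonneg_left h2 hE0
    linarith
  choose B hB0 hB using key
  refine ⟨∑ i, B i, fun i z w => (hB i z w).trans (mul_le_mul_of_nonneg_right ?_ dist_nonneg)⟩
  exact Finset.single_le_sum (fun i _ => hB0 i) (Finset.mem_univ i)

end Consequences

section Compactness

variable {N m : ℕ} {i₀ : Fin N} {f : Fin m → (Fin m → ℝ) → ℝ}
  {v : Fin m → EuclideanSpace ℝ (Fin N) × ℝ → ℝ}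

/-- A bounded equi-Lipschitz sequence has a pointwise convergent subsequence. -/
theorem exists_subseq_tendsto_of_lipschitz {X ι : Type*} [PseudoMetricSpace X]
    [TopologicalSpace.SeparableSpace X] [Countable ι] {F : ℕ → ι → X → ℝ} {C K : ℝ}
    (hC : ∀ n i x, |F n i x| ≤ C) (hK : ∀ n i x y, |F n i x - F n i y| ≤ K * dist x y) :
    ∃ (G : ι → X → ℝ) (φ : ℕ → ℕ), StrictMono φ ∧
      ∀ i x, Tendsto (fun n => F (φ n) i x) atTop (𝓝 (G i x)) := by
  obtain ⟨s, hs, hsd⟩ := TopologicalSpace.exists_countable_dense X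
  have : Countable s := hs.to_subtype
  have hcomp : IsCompact (Set.pi univ fun _ : ι × s => Icc (-C) C) :=
    isCompact_univ_pi fun _ => isCompact_Icc
  obtain ⟨a, -, φ, hφ, hlim⟩ := hcomp.tendsto_subseq (x := fun n (p : ι × s) => F n p.1 p.2)
    fun n p _ => abs_le.1 (hC n p.1 p.2)
  rw [tendsto_pi_nhds] at hlim
  have hcau : ∀ i x, CauchySeq fun n => F (φ n) i x := by
    intro i x
    rw [Metric.cauchySeq_iff']
    intro ε hε
    have hδ : 0 < ε / (4 * (|K| + 1)) := by positivity
    obtain ⟨y, hy, hxy⟩ := hsd.exists_dist_lt x hδ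
    obtain ⟨n₀, hn₀⟩ := Metric.cauchySeq_iff'.1 (hlim (i, ⟨y, hy⟩)).cauchySeq (ε / 4) (by linarith)
    refine ⟨n₀, fun n hn => ?_⟩
    have h1 := hn₀ n hn
    simp only [Function.comp_apply, Real.dist_eq] at h1 ⊢
    have h4 : K * dist x y ≤ ε / 4 := by
      calc K * dist x y ≤ (|K| + 1) * (ε / (4 * (|K| + 1))) :=
            mul_le_mul (by linarith [le_abs_self K]) hxy.le dist_nonneg (by positivity)
        _ = ε / 4 := by field_simp
    have h2 := hK (φ n) i x y
    have h3 := hK (φ n₀) i x y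
    rw [abs_lt] at h1 ⊢
    have h2' := abs_le.1 h2
    have h3' := abs_le.1 h3
    constructor <;> linarith [h2'.1, h2'.2, h3'.1, h3'.2, h1.1, h1.2]
  choose G hG using fun i x => cauchySeq_tendsto_of_complete (hcau i x)
  exact ⟨G, φ, hφ, hG⟩

theorem IsOddMild.translate (hv : IsOddMild i₀ f v) {a : EuclideanSpace ℝ (Fin N) × ℝ}
    (ha : a.1 i₀ = 0) : IsOddMild i₀ f fun i z => v i (z + a) := by
  obtain ⟨C, hC⟩ := hv.bdd
  refine ⟨fun i => (hv.cont i).comp (by fun_prop), ⟨C, fun i z => hC i _⟩, fun i z => ?_,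
    fun i z hz => hv.nonneg i _ (by simpa [ha] using hz), fun i z => ?_⟩
  · rw [← hv.odd]
    congr 1
    ext
    · simp [coordRefl_eq_self i₀ ha]
    · simp
  · rw [hv.mild]
    exact (wres_translate (W := fun _ => 1) (h := fun w => oddF (f i) (fun j => v j w) + v i w) a z).symm

theorem IsOddMild.of_tendsto (hf : ∀ i, ContDiffOn ℝ 1 (f i) (orthant m))
    {w : ℕ → Fin m → EuclideanSpace ℝ (Fin N) × ℝ → ℝ} (hw : ∀ n, IsOddMild i₀ f (w n)) {C K : ℝ}
    (hC : ∀ n i z, |w n i z| ≤ C) (hK : ∀ n i z y, |w n i z - w n i y| ≤ K * dist z y)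
    (hlim : ∀ i z, Tendsto (fun n => w n i z) atTop (𝓝 (v i z))) : IsOddMild i₀ f v := by
  have hfo : ∀ i, Continuous (oddF (f i)) := fun i => continuous_oddF (hf i).continuousOn
  refine ⟨fun i => ?_, ⟨C, fun i z => ?_⟩, fun i z => ?_, fun i z hz => ?_, fun i z => ?_⟩
  · refine (LipschitzWith.of_dist_le_mul (K := K.toNNReal) fun z y => ?_).continuous
    rw [Real.dist_eq]
    refine le_of_tendsto ((hlim i z).sub (hlim i y)).abs (Eventually.of_forall fun n => ?_)
    exact (hK n i z y).trans (mul_le_mul_of_nonneg_right (Real.le_coe_toNNReal K) dist_nonneg)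
  · exact le_of_tendsto (hlim i z).abs (Eventually.of_forall fun n => hC n i z)
  · refine tendsto_nhds_unique (hlim i _) ((hlim i z).neg.congr fun n => ?_)
    exact ((hw n).odd i z).symm
  · exact ge_of_tendsto (hlim i z) (Eventually.of_forall fun n => (hw n).nonneg i z hz)
  · obtain ⟨M, hM⟩ := exists_bound_oddF (hf i).continuousOn C
    refine tendsto_nhds_unique (hlim i z) (Tendsto.congr (fun n => ((hw n).mild i z).symm) ?_)
    refine tendsto_wres (C := M + C) (integrable_const _) (fun n => ?_) (fun n y => ?_) (fun y => ?_) z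
    · exact ((hfo i).comp (continuous_pi (hw n).cont)).add ((hw n).cont i)
    · exact (abs_add_le _ _).trans (add_le_add (hM _ fun j => hC n j y) (hC n i y))
    · exact (((hfo i).tendsto _).comp (tendsto_pi_nhds.2 fun j => hlim j y)).add (hlim i y)

theorem IsOddMild.exists_limit_translate (hv : IsOddMild i₀ f v)
    (hf : ∀ i, ContDiffOn ℝ 1 (f i) (orthant m)) {a : ℕ → EuclideanSpace ℝ (Fin N) × ℝ}
    (ha : ∀ n, (a n).1 i₀ = 0) :
    ∃ (w : Fin m → EuclideanSpace ℝ (Fin N) × ℝ → ℝ) (φ : ℕ → ℕ), StrictMono φ ∧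
      IsOddMild i₀ f w ∧
      ∀ i z, ∀ b : ℕ → EuclideanSpace ℝ (Fin N) × ℝ, Tendsto b atTop (𝓝 z) →
        Tendsto (fun n => v i (b n + a (φ n))) atTop (𝓝 (w i z)) := by
  obtain ⟨C, hC⟩ := hv.bdd
  obtain ⟨K, hK⟩ := hv.exists_lipschitz hf
  have hK' : ∀ n i z y, |v i (z + a n) - v i (y + a n)| ≤ K * dist z y := fun n i z y => by
    simpa using hK i (z + a n) (y + a n)
  obtain ⟨w, φ, hφ, hlim⟩ := exists_subseq_tendsto_of_lipschitz
    (F := fun n i z => v i (z + a n)) (C := C) (fun n i z => hC i _) hK'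
  refine ⟨w, φ, hφ, IsOddMild.of_tendsto hf (fun n => hv.translate (ha (φ n)))
    (fun n i z => hC i _) (fun n => hK' (φ n)) hlim, fun i z b hb => ?_⟩
  have h1 : Tendsto (fun n => v i (b n + a (φ n)) - v i (z + a (φ n))) atTop (𝓝 0) := by
    refine squeeze_zero_norm (fun n => hK' (φ n) i (b n) z) ?_
    simpa using (tendsto_iff_dist_tendsto_zero.1 hb).const_mul K
  simpa using h1.add (hlim i z)

end Compactness

section MeanValue

variable {m : ℕ} {φ : (Fin m → ℝ) → ℝ} {f : Fin m → (Fin m → ℝ) → ℝ}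

theorem clm_pi_apply_eq_sum (A : (Fin m → ℝ) →L[ℝ] ℝ) (w : Fin m → ℝ) :
    A w = ∑ j, A (Pi.single j 1) * w j := by
  have h : w = ∑ j, w j • (Pi.single j 1 : Fin m → ℝ) := by
    ext j; simp [Finset.sum_apply, Pi.single_apply]
  conv_lhs => rw [h, map_sum]
  simp [mul_comm]

theorem exists_mean_value_orthant (hφ : ContDiffOn ℝ 1 φ (orthant m)) {a b : Fin m → ℝ}
    (ha : a ∈ orthant m) (hb : b ∈ orthant m) :
    ∃ ξ : Fin m → ℝ, (∀ j, 0 ≤ ξ j ∧ ξ j ≤ max (a j) (b j)) ∧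
      φ a - φ b = ∑ j, fderivWithin ℝ φ (orthant m) ξ (Pi.single j 1) * (a j - b j) := by
  have hconv : Convex ℝ (orthant m) := by
    intro x hx y hy s t hs ht _ j
    exact add_nonneg (mul_nonneg hs (hx j)) (mul_nonneg ht (hy j))
  obtain ⟨ξ, hξ, h⟩ := domain_mvt (f' := fderivWithin ℝ φ (orthant m))
    (fun x hx => (hφ.differentiableOn one_ne_zero x hx).hasFDerivWithinAt) hconv hb ha
  refine ⟨ξ, fun j => ⟨hconv.segment_subset hb ha hξ j, ?_⟩, ?_⟩
  · obtain ⟨s, t, hs, ht, hst, rfl⟩ := hξ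
    simp only [Pi.add_apply, Pi.smul_apply, smul_eq_mul]
    calc s * b j + t * a j ≤ s * max (a j) (b j) + t * max (a j) (b j) :=
          add_le_add (mul_le_mul_of_nonneg_left (le_max_right _ _) hs)
            (mul_le_mul_of_nonneg_left (le_max_left _ _) ht)
      _ = max (a j) (b j) := by rw [← add_mul, hst, one_mul]
  · rw [h, clm_pi_apply_eq_sum]
    rfl

theorem exists_bound_fderivWithin_orthant (hf : ∀ i, ContDiffOn ℝ 1 (f i) (orthant m)) (C : ℝ) :
    ∃ B, 0 ≤ B ∧ ∀ i j (ξ : Fin m → ℝ), (∀ k, 0 ≤ ξ k ∧ ξ k ≤ C) →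
      |fderivWithin ℝ (f i) (orthant m) ξ (Pi.single j 1)| ≤ B := by
  have h : ∀ i j, ∃ B, 0 ≤ B ∧ ∀ ξ : Fin m → ℝ, (∀ k, 0 ≤ ξ k ∧ ξ k ≤ C) →
      |fderivWithin ℝ (f i) (orthant m) ξ (Pi.single j 1)| ≤ B := by
    intro i j
    have h1 := ((hf i).continuousOn_fderivWithin (uniqueDiffOn_orthant m) le_rfl).clm_apply
      (continuousOn_const (c := (Pi.single j 1 : Fin m → ℝ)))
    obtain ⟨B, hB⟩ := (isCompact_univ_pi fun _ : Fin m =>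
      (isCompact_Icc (a := 0) (b := C))).exists_bound_of_continuousOn
      (h1.mono fun ξ hξ k => (hξ k (mem_univ k)).1)
    exact ⟨max B 0, le_max_right _ _, fun ξ hξ => (hB ξ fun k _ => hξ k).trans (le_max_left _ _)⟩
  choose B hB0 hB using h
  refine ⟨∑ i, ∑ j, B i j, Finset.sum_nonneg fun i _ => Finset.sum_nonneg fun j _ => hB0 i j,
    fun i j ξ hξ => (hB i j ξ hξ).trans ?_⟩
  exact (Finset.single_le_sum (fun j _ => hB0 i j) (Finset.mem_univ j)).trans
    (Finset.single_le_sum (f := fun i => ∑ j, B i j)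
      (fun i _ => Finset.sum_nonneg fun j _ => hB0 i j) (Finset.mem_univ i))

end MeanValue

section Mirror

variable {N m : ℕ} {i₀ : Fin N} {f : Fin m → (Fin m → ℝ) → ℝ}
  {v : Fin m → EuclideanSpace ℝ (Fin N) × ℝ → ℝ} {l : ℝ}

/-- The reflection of an odd function across the hyperplane `x i₀ = l`. -/
noncomputable def mirror (i₀ : Fin N) (v : Fin m → EuclideanSpace ℝ (Fin N) × ℝ → ℝ) (l : ℝ)
    (i : Fin m) (z : EuclideanSpace ℝ (Fin N) × ℝ) : ℝ :=
  - v i (z + (-(2 * l) • ee i₀, 0))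

theorem IsOddMild.continuous_mirror (hv : IsOddMild i₀ f v) (l : ℝ) (i : Fin m) :
    Continuous (mirror i₀ v l i) :=
  ((hv.cont i).comp (by fun_prop)).neg

theorem IsOddMild.mirror_eq_of_eq (hv : IsOddMild i₀ f v) {z : EuclideanSpace ℝ (Fin N) × ℝ}
    {w : EuclideanSpace ℝ (Fin N) × ℝ}
    (h : w = (coordRefl i₀ (z + (-(2 * l) • ee i₀, (0 : ℝ))).1, z.2)) (i : Fin m) :
    mirror i₀ v l i z = v i w := by
  subst h
  unfold mirror
  rw [← hv.odd]
  simp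

theorem IsOddMild.mirror_nonneg (hv : IsOddMild i₀ f v) {z : EuclideanSpace ℝ (Fin N) × ℝ}
    (hz : z.1 i₀ ≤ 2 * l) (i : Fin m) : 0 ≤ mirror i₀ v l i z := by
  rw [hv.mirror_eq_of_eq rfl]
  refine hv.nonneg i _ ?_
  simp
  linarith

theorem IsOddMild.mirror_eq_self (hv : IsOddMild i₀ f v) {z : EuclideanSpace ℝ (Fin N) × ℝ}
    (hz : z.1 i₀ = l) (i : Fin m) : mirror i₀ v l i z = v i z := by
  refine hv.mirror_eq_of_eq ?_ i
  refine Prod.ext ?_ rfl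
  ext k
  by_cases h : k = i₀
  · subst h; simp [hz]; ring
  · simp [coordRefl_apply, ee_apply, h]

theorem IsOddMild.hasHeat_mirror_sub (hv : IsOddMild i₀ f v)
    (hf : ∀ i, ContDiffOn ℝ 1 (f i) (orthant m)) (H1 : ∀ i, f i 0 = 0)
    {z : EuclideanSpace ℝ (Fin N) × ℝ} (h0 : 0 ≤ z.1 i₀) (hz : z.1 i₀ ≤ 2 * l) (i : Fin m) :
    HasHeat (fun z => mirror i₀ v l i z - v i z) z
      (f i (fun j => mirror i₀ v l j z) - f i fun j => v j z) := by
  have h1 := (HasHeat.translate _ (hv.hasHeat hf i (z + (-(2 * l) • ee i₀, 0)))).neg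
  refine HasHeat.congr_val (h1.sub (hv.hasHeat hf i z)) ?_
  rw [oddF_of_nonneg (H1 i) fun j => hv.nonneg j z h0, ← oddF_neg]
  congr 1
  exact oddF_of_nonneg (H1 i) fun j => hv.mirror_nonneg hz j

theorem hasHeat_coord {g g' g'' : ℝ → ℝ} (hg : ∀ s, HasDerivAt g (g' s) s)
    (hg' : ∀ s, HasDerivAt g' (g'' s) s) (z : EuclideanSpace ℝ (Fin N) × ℝ) :
    HasHeat (fun z => g (z.1 i₀)) z (- g'' (z.1 i₀)) := by
  have h1 : HasJet (fun z : EuclideanSpace ℝ (Fin N) × ℝ => z.1 i₀) z 0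
      (fun j => if j = i₀ then 1 else 0) (fun _ => 0) := by
    refine ⟨by simpa using hasDerivAt_const (0 : ℝ) (z.1 i₀), fun j => ?_⟩
    have := Jet.quadratic (z.1 i₀) (if j = i₀ then 1 else 0) 0
    rw [mul_zero] at this
    refine this.congr (Eventually.of_forall fun r => ?_)
    by_cases h : j = i₀
    · simp [h]
    · simp [ee_apply, h, Ne.symm h]
  refine (h1.comp hg (hg' _)).hasHeat.congr_val ?_
  simp

end Mirror

section Barrier

variable {N m : ℕ} {i₀ : Fin N} {f : Fin m → (Fin m → ℝ) → ℝ}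
  {v : Fin m → EuclideanSpace ℝ (Fin N) × ℝ → ℝ} {l : ℝ}

/-- Off-diagonal derivatives are nonnegative on the orthant. -/
def Cooperative (f : Fin m → (Fin m → ℝ) → ℝ) : Prop :=
  ∀ i j, i ≠ j → ∀ v ∈ orthant m, 0 ≤ fderivWithin ℝ (f i) (orthant m) v (Pi.single j 1)

theorem Cooperative.exists_lower_bound (H2 : Cooperative f)
    (hf : ∀ i, ContDiffOn ℝ 1 (f i) (orthant m)) {B C M : ℝ}
    (hB : ∀ i j (ξ : Fin m → ℝ), (∀ k, 0 ≤ ξ k ∧ ξ k ≤ C) →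
      |fderivWithin ℝ (f i) (orthant m) ξ (Pi.single j 1)| ≤ B)
    {a b : Fin m → ℝ} (ha : ∀ j, 0 ≤ a j) (hb : ∀ j, 0 ≤ b j) (haC : ∀ j, a j ≤ C)
    (hbC : ∀ j, b j ≤ C) (hM : ∀ j, -M ≤ a j - b j) (i : Fin m) :
    ∃ ξ : Fin m → ℝ, (∀ j, 0 ≤ ξ j ∧ ξ j ≤ max (a j) (b j)) ∧
      -B * (a i - b i + M) - M * ∑ j, fderivWithin ℝ (f i) (orthant m) ξ (Pi.single j 1)
        ≤ f i a - f i b := by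
  obtain ⟨ξ, hξ, h⟩ := exists_mean_value_orthant (hf i) ha hb
  refine ⟨ξ, hξ, ?_⟩
  have hξC : ∀ k, 0 ≤ ξ k ∧ ξ k ≤ C := fun k =>
    ⟨(hξ k).1, (hξ k).2.trans (max_le (haC k) (hbC k))⟩
  have h1 : ∀ j, 0 ≤ (fderivWithin ℝ (f i) (orthant m) ξ (Pi.single j 1) +
      if j = i then B else 0) * (a j - b j + M) := by
    intro j
    refine mul_nonneg ?_ (by linarith [hM j])
    split_ifs with hj
    · linarith [(abs_le.1 (hB i j ξ hξC)).1]
    · simpa using H2 i j (Ne.symm hj) ξ fun k => (hξ k).1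
  have h2 := Finset.sum_nonneg fun j (_ : j ∈ Finset.univ) => h1 j
  have h3 : ∑ j, (fderivWithin ℝ (f i) (orthant m) ξ (Pi.single j 1) +
      if j = i then B else 0) * (a j - b j + M) = (f i a - f i b) +
      M * ∑ j, fderivWithin ℝ (f i) (orthant m) ξ (Pi.single j 1) + B * (a i - b i + M) := by
    rw [h, Finset.mul_sum, ← Finset.sum_add_distrib]
    simp only [add_mul, ite_mul, zero_mul, Finset.sum_add_distrib, Finset.sum_ite_eq',
      Finset.mem_univ, if_true]
    congr 1
    rw [← Finset.sum_add_distrib]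
    exact Finset.sum_congr rfl fun j _ => by ring
  linarith

theorem abs_coord_sub_le (x y : EuclideanSpace ℝ (Fin N)) (i : Fin N) : |x i - y i| ≤ ‖x - y‖ := by
  simpa using PiLp.norm_apply_le (x - y) i

theorem IsOddMild.exists_barrier (hv : IsOddMild i₀ f v)
    (hf : ∀ i, ContDiffOn ℝ 1 (f i) (orthant m)) (H1 : ∀ i, f i 0 = 0) (H2 : Cooperative f)
    (hl : 0 < l) (hpos : ∀ i (z : EuclideanSpace ℝ (Fin N) × ℝ), 0 < z.1 i₀ → 0 < v i z)
    (hW : ∀ i (z : EuclideanSpace ℝ (Fin N) × ℝ), 0 ≤ z.1 i₀ → z.1 i₀ ≤ l →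
      v i z ≤ mirror i₀ v l i z) (i : Fin m)
    {x : EuclideanSpace ℝ (Fin N)} (hx : x i₀ = l) (t : ℝ) :
    ∃ ε > 0, ∃ α > 0, ∀ r, 0 ≤ r → r ≤ l →
      v i (x - r • ee i₀, t) + ε * (exp (-α * (2 * l - r) ^ 2) - exp (-α * (2 * l) ^ 2)) ≤
        mirror i₀ v l i (x - r • ee i₀, t) := by
  obtain ⟨C, hC⟩ := hv.bdd
  obtain ⟨B, hB0, hB⟩ := exists_bound_fderivWithin_orthant hf C
  set c : EuclideanSpace ℝ (Fin N) × ℝ := (x - (2 * l) • ee i₀, t) with hc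
  have hc0 : c.1 i₀ = -l := by simp [hc, hx]; ring
  have hcoord : Continuous fun z : EuclideanSpace ℝ (Fin N) × ℝ => z.1 i₀ := by fun_prop
  have hline : ∀ r, sqDist c (x - r • ee i₀, t) = (2 * l - r) ^ 2 := by
    intro r
    have : x - r • ee i₀ - (x - (2 * l) • ee i₀) = (2 * l - r) • ee i₀ := by
      rw [sub_smul]; abel
    simp [sqDist, hc, this, norm_smul]
  set w : EuclideanSpace ℝ (Fin N) × ℝ → ℝ := fun z => mirror i₀ v l i z - v i z with hw
  have hwc : Continuous w := (hv.continuous_mirror l i).sub (hv.cont i)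
  have hcpt := isCompact_sqDist_le c (by linarith : (0 : ℝ) ≤ 2 * l)
  obtain ⟨y, ⟨hy1, hy2⟩, hymin⟩ := (hcpt.inter_right
    (isClosed_eq hcoord (continuous_const (y := 0)))).exists_isMinOn
    ⟨(x - l • ee i₀, t), by
      show sqDist c _ ≤ _
      rw [hline]; nlinarith, by simp [hx]⟩ hwc.continuousOn
  have hμ : 0 < w y := by
    have h1 : v i y = 0 := hv.eq_zero i hy2
    have h2 : 0 < mirror i₀ v l i y := by
      rw [hv.mirror_eq_of_eq rfl]
      refine hpos i _ ?_
      simp [show y.1 i₀ = 0 from hy2, hl]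
    simp only [hw, h1, sub_zero, h2]
  set α : ℝ := (4 * l + 2 * N + B + 1) / (4 * l ^ 2) + 1 with hα
  have hα1 : 1 ≤ α := by
    have : 0 ≤ (4 * l + 2 * N + B + 1) / (4 * l ^ 2) := by positivity
    linarith
  have hα2 : 4 * l + 2 * N + B + 1 ≤ 4 * α * l ^ 2 := by
    have : 4 * α * l ^ 2 = (4 * l + 2 * N + B + 1) + 4 * l ^ 2 := by
      rw [hα]; field_simp
    nlinarith
  have hα0 : 0 < α := by linarith
  set b : EuclideanSpace ℝ (Fin N) × ℝ → ℝ := fun z =>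
    w y * (exp (-α * sqDist c z + 0) - exp (-α * (2 * l) ^ 2)) with hb
  have hbc : Continuous b := by
    have := continuous_sqDist c
    fun_prop
  have key : ∀ z, sqDist c z ≤ (2 * l) ^ 2 → 0 ≤ z.1 i₀ → b z ≤ w z := by
    by_contra! hcon
    obtain ⟨z₁, hz1, hz2, hz3⟩ := hcon
    obtain ⟨p, ⟨hp1, hp2⟩, hpmax⟩ := (hcpt.inter_right
      (isClosed_le (continuous_const (y := 0)) hcoord)).exists_isMaxOn
      ⟨z₁, hz1, hz2⟩ (hbc.sub hwc).continuousOn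
    have hp3 : w p < b p := by
      have : b z₁ - w z₁ ≤ b p - w p := hpmax (show z₁ ∈ _ from ⟨hz1, hz2⟩)
      linarith
    replace hp1 : sqDist c p ≤ (2 * l) ^ 2 := hp1
    replace hp2 : 0 ≤ p.1 i₀ := hp2
    obtain ⟨hn, ht⟩ := bounds_of_sqDist_le (by linarith) hp1
    have hco := (abs_coord_sub_le p.1 c.1 i₀).trans hn
    rw [hc0] at hco
    have hpl : p.1 i₀ ≤ l := by linarith [(abs_le.1 hco).2]
    have hwp : 0 ≤ w p := sub_nonneg.2 (hW i p hp2 hpl)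
    have hE : ∀ z, b z ≤ w y * exp (-α * sqDist c z + 0) := fun z =>
      mul_le_mul_of_nonneg_left (by linarith [exp_pos (-α * (2 * l) ^ 2)]) hμ.le
    have hp4 : sqDist c p < (2 * l) ^ 2 := by
      refine lt_of_le_of_ne hp1 fun h => ?_
      have : b p = 0 := by simp [hb, h]
      linarith
    have hp5 : 0 < p.1 i₀ := by
      refine lt_of_le_of_ne hp2 fun h => ?_
      have h1 : w y ≤ w p := hymin (show p ∈ _ from ⟨hp1, h.symm⟩)
      have h2 : exp (-α * sqDist c p + 0) ≤ 1 := by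
        rw [exp_le_one_iff, add_zero, neg_mul]
        have : 0 ≤ sqDist c p := by unfold sqDist; positivity
        have := mul_nonneg hα0.le this
        linarith
      have := mul_le_mul_of_nonneg_left h2 hμ.le
      linarith [hE p]
    have hloc : IsLocalMax (fun z => b z - w z) p := by
      have hnb : {z : EuclideanSpace ℝ (Fin N) × ℝ | sqDist c z < (2 * l) ^ 2} ∩ {z | 0 < z.1 i₀} ∈ 𝓝 p :=
        ((isOpen_lt (continuous_sqDist c) continuous_const).inter
          (isOpen_lt continuous_const hcoord)).mem_nhds ⟨hp4, hp5⟩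
      filter_upwards [hnb] with z hz
      exact hpmax (show z ∈ _ from ⟨show sqDist c z ≤ _ from le_of_lt hz.1, show 0 ≤ z.1 i₀ from le_of_lt hz.2⟩)
    have hheatb : HasHeat b p (w y * (exp (-α * sqDist c p + 0) *
        (-α * (2 * (p.2 - c.2) - 2 * N) - 4 * (-α) ^ 2 * ‖p.1 - c.1‖ ^ 2))) := by
      refine (((hasHeat_exp_sqDist (-α) 0 c p).sub
        (HasHeat.const (exp (-α * (2 * l) ^ 2)) p)).const_mul (w y)).congr_val ?_
      ring
    have hmax := (hheatb.sub (hv.hasHeat_mirror_sub hf H1 hp2 (by linarith) i)).nonneg_of_isLocalMax hloc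
    obtain ⟨ξ, -, hξ⟩ := H2.exists_lower_bound (M := 0) hf hB
      (a := fun j => mirror i₀ v l j p) (b := fun j => v j p)
      (fun j => hv.mirror_nonneg (by linarith) j) (fun j => hv.nonneg j p hp2)
      (fun j => (neg_le_abs _).trans (hC j _)) (fun j => (le_abs_self _).trans (hC j _))
      (fun j => by linarith [hW j p hp2 hpl]) i
    have hξ' : -B * w p ≤ f i (fun j => mirror i₀ v l j p) - f i fun j => v j p := by
      simpa [hw] using hξ
    have hnorm : l ≤ ‖p.1 - c.1‖ := by
      have := (le_abs_self _).trans (abs_coord_sub_le p.1 c.1 i₀)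
      rw [hc0] at this
      linarith
    have hnorm2 : l ^ 2 ≤ ‖p.1 - c.1‖ ^ 2 := pow_le_pow_left₀ hl.le hnorm 2
    have hcoef : -α * (2 * (p.2 - c.2) - 2 * N) - 4 * (-α) ^ 2 * ‖p.1 - c.1‖ ^ 2 ≤ -B - 1 := by
      have h1 : -(2 * l) ≤ p.2 - c.2 := (abs_le.1 ht).1
      have h2 : 4 * α ^ 2 * l ^ 2 ≤ 4 * α ^ 2 * ‖p.1 - c.1‖ ^ 2 := by gcongr
      have h3 : α * (-(p.2 - c.2)) ≤ α * (2 * l) := by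
        apply mul_le_mul_of_nonneg_left _ hα0.le; linarith
      have h4 := mul_le_mul_of_nonneg_left hα2 hα0.le
      have h5 : B + 1 ≤ α * (B + 1) := le_mul_of_one_le_left (by linarith) hα1
      nlinarith
    have hep : 0 < w y * exp (-α * sqDist c p + 0) := mul_pos hμ (exp_pos _)
    have h6 := mul_le_mul_of_nonneg_left hcoef hep.le
    have h7 : B * w p ≤ B * (w y * exp (-α * sqDist c p + 0)) :=
      mul_le_mul_of_nonneg_left (hp3.le.trans (hE p)) hB0
    rw [← mul_assoc] at hmax
    have h8 : w y * exp (-α * sqDist c p + 0) * (-B - 1) =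
      -(B * (w y * exp (-α * sqDist c p + 0))) - w y * exp (-α * sqDist c p + 0) := by ring
    linarith
  refine ⟨w y, hμ, α, hα0, fun r h0 hr => ?_⟩
  have := key (x - r • ee i₀, t) (by rw [hline]; nlinarith) (by simp [hx, hr])
  simp only [hb, hw, hline, add_zero] at this ⊢
  linarith

end Barrier

section NearMaximum

variable {N m : ℕ} {i₀ : Fin N} {f : Fin m → (Fin m → ℝ) → ℝ}
  {v : Fin m → EuclideanSpace ℝ (Fin N) × ℝ → ℝ} {l : ℝ}

theorem IsOddMild.exists_near_max (hv : IsOddMild i₀ f v)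
    (hf : ∀ i, ContDiffOn ℝ 1 (f i) (orthant m)) (H1 : ∀ i, f i 0 = 0) (H2 : Cooperative f)
    {g g' g'' : ℝ → ℝ} (hg : ∀ s, HasDerivAt g (g' s) s) (hg' : ∀ s, HasDerivAt g' (g'' s) s)
    (hg1 : ∀ s, 0 ≤ s → s ≤ l → 1 ≤ g s) (hg3 : ∀ s, 0 ≤ s → s ≤ l → g s ≤ 3)
    (hbad : ∃ i, ∃ z : EuclideanSpace ℝ (Fin N) × ℝ, 0 ≤ z.1 i₀ ∧ z.1 i₀ ≤ l ∧
      mirror i₀ v l i z < v i z) {ε : ℝ} (hε : 0 < ε) :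
    ∃ i, ∃ p : EuclideanSpace ℝ (Fin N) × ℝ, ∃ ξ : Fin m → ℝ, 0 < p.1 i₀ ∧ p.1 i₀ < l ∧
      mirror i₀ v l i p < v i p ∧ (∀ j, 0 ≤ ξ j ∧ ξ j ≤ max (mirror i₀ v l j p) (v j p)) ∧
      - g'' (p.1 i₀) ≤ g (p.1 i₀) *
        ∑ j, fderivWithin ℝ (f i) (orthant m) ξ (Pi.single j 1) + ε := by
  obtain ⟨C, hC⟩ := hv.bdd
  obtain ⟨B, hB0, hB⟩ := exists_bound_fderivWithin_orthant hf C
  have hgc : Continuous g := continuous_iff_continuousAt.2 fun s => (hg s).continuousAt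
  have hcoord : Continuous fun z : EuclideanSpace ℝ (Fin N) × ℝ => z.1 i₀ := by fun_prop
  let A : Set ℝ := {r | ∃ i, ∃ z : EuclideanSpace ℝ (Fin N) × ℝ, 0 ≤ z.1 i₀ ∧ z.1 i₀ ≤ l ∧
    r = (v i z - mirror i₀ v l i z) / g (z.1 i₀)}
  have hbdd : BddAbove A := by
    refine ⟨2 * C, ?_⟩
    rintro r ⟨i, z, h0, h1, rfl⟩
    have h2 := hg1 _ h0 h1
    have h3 : 0 ≤ C := (abs_nonneg _).trans (hC i z)
    rw [div_le_iff₀ (by linarith)]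
    have h4 := (le_abs_self _).trans (hC i z)
    have h5 : - mirror i₀ v l i z ≤ C := by
      unfold mirror; rw [neg_neg]; exact (le_abs_self _).trans (hC i _)
    nlinarith
  set M : ℝ := sSup A with hMdef
  have hM : 0 < M := by
    obtain ⟨i, z, h0, h1, h2⟩ := hbad
    exact lt_of_lt_of_le (div_pos (sub_pos.2 h2) (by linarith [hg1 _ h0 h1]))
      (le_csSup hbdd ⟨i, z, h0, h1, rfl⟩)
  have hle : ∀ i (z : EuclideanSpace ℝ (Fin N) × ℝ), 0 ≤ z.1 i₀ → z.1 i₀ ≤ l →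
      v i z - mirror i₀ v l i z ≤ M * g (z.1 i₀) := fun i z h0 h1 => by
    rw [← div_le_iff₀ (by linarith [hg1 _ h0 h1])]
    exact le_csSup hbdd ⟨i, z, h0, h1, rfl⟩
  set Q : ℝ := B + 2 + 2 * N with hQ
  have hQ0 : 0 < Q := by positivity
  set κ : ℝ := M * ε / (ε + Q) with hκ
  have hκ0 : 0 < κ := by positivity
  have hκM : κ < M := by
    rw [hκ, div_lt_iff₀ (by positivity)]; nlinarith
  have hκQ : κ * Q ≤ M * ε := by
    rw [hκ, div_mul_eq_mul_div, div_le_iff₀ (by positivity)]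
    have : 0 < M * ε := by positivity
    nlinarith
  obtain ⟨r, ⟨i, c, hc0, hcl, rfl⟩, hr⟩ := exists_lt_of_lt_csSup (s := A) (b := M - κ / 3)
    (by obtain ⟨i, z, h0, h1, -⟩ := hbad; exact ⟨_, i, z, h0, h1, rfl⟩) (by linarith)
  rw [lt_div_iff₀ (by linarith [hg1 _ hc0 hcl])] at hr
  set Φ : EuclideanSpace ℝ (Fin N) × ℝ → ℝ := fun z =>
    -(mirror i₀ v l i z - v i z) - M * g (z.1 i₀) - κ * sqDist c z with hΦ
  have hΦc : Continuous Φ := by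
    have h1 := hv.continuous_mirror l i
    have h2 := hv.cont i
    have h3 := continuous_sqDist c
    have h4 := hgc.comp hcoord
    exact (((h1.sub h2).neg).sub (continuous_const.mul h4)).sub (continuous_const.mul h3)
  have hΦ0 : -κ < Φ c := by
    have := hg3 _ hc0 hcl
    simp only [hΦ, sqDist_self]
    nlinarith
  obtain ⟨p, ⟨hp1, hp2, hp3⟩, hpmax⟩ := ((isCompact_sqDist_le c zero_le_one).inter_right
    ((isClosed_le (continuous_const (y := 0)) hcoord).inter
      (isClosed_le hcoord (continuous_const (y := l))))).exists_isMaxOn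
      ⟨c, by show sqDist c c ≤ _; rw [sqDist_self]; norm_num, hc0, hcl⟩ hΦc.continuousOn
  replace hp1 : sqDist c p ≤ 1 ^ 2 := hp1
  replace hp2 : 0 ≤ p.1 i₀ := hp2
  replace hp3 : p.1 i₀ ≤ l := hp3
  have hΦp : -κ < Φ p := hΦ0.trans_le (hpmax
    ⟨by show sqDist c c ≤ _; rw [sqDist_self]; norm_num, hc0, hcl⟩)
  have hsd0 : 0 ≤ sqDist c p := by unfold sqDist; positivity
  have hMp := hle i p hp2 hp3
  have hgp := hg1 _ hp2 hp3
  simp only [hΦ] at hΦp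
  have hsd : sqDist c p < 1 ^ 2 := by
    by_contra! h
    nlinarith
  have hκsd : 0 ≤ κ * sqDist c p := by positivity
  have hMg : M ≤ M * g (p.1 i₀) := le_mul_of_one_le_right hM.le hgp
  have hneg : mirror i₀ v l i p < v i p := by linarith
  have hp4 : 0 < p.1 i₀ := by
    refine lt_of_le_of_ne hp2 fun h => ?_
    have h1 : v i p = 0 := hv.eq_zero i h.symm
    have h2 := hv.mirror_nonneg (l := l) (z := p) (by linarith) i
    linarith
  have hp5 : p.1 i₀ < l := lt_of_le_of_ne hp3 fun h => by
    rw [hv.mirror_eq_self h] at hneg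
    exact lt_irrefl _ hneg
  have hloc : IsLocalMax Φ p := by
    have hnb : {z : EuclideanSpace ℝ (Fin N) × ℝ | sqDist c z < 1 ^ 2} ∩
        ({z | 0 < z.1 i₀} ∩ {z | z.1 i₀ < l}) ∈ 𝓝 p :=
      ((isOpen_lt (continuous_sqDist c) continuous_const).inter
        ((isOpen_lt continuous_const hcoord).inter
          (isOpen_lt hcoord continuous_const))).mem_nhds ⟨hsd, hp4, hp5⟩
    filter_upwards [hnb] with z hz
    exact hpmax ⟨show sqDist c z ≤ _ from le_of_lt hz.1, show 0 ≤ z.1 i₀ from le_of_lt hz.2.1,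
      show z.1 i₀ ≤ l from le_of_lt hz.2.2⟩
  have hmax := ((((hv.hasHeat_mirror_sub hf H1 hp2 (by linarith) i).neg).sub
    ((hasHeat_coord hg hg' p).const_mul M)).sub
      ((hasHeat_sqDist c p).const_mul κ)).nonneg_of_isLocalMax hloc
  obtain ⟨ξ, hξ, hlow⟩ := H2.exists_lower_bound (M := M * g (p.1 i₀)) hf hB
    (a := fun j => mirror i₀ v l j p) (b := fun j => v j p)
    (fun j => hv.mirror_nonneg (by linarith) j) (fun j => hv.nonneg j p hp2)
    (fun j => (neg_le_abs _).trans (hC j _)) (fun j => (le_abs_self _).trans (hC j _))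
    (fun j => by linarith [hle j p hp2 hp3]) i
  refine ⟨i, p, ξ, hp4, hp5, hneg, hξ, ?_⟩
  have h1 := (abs_le.1 (bounds_of_sqDist_le zero_le_one hp1).2).1
  have h2 : B * (mirror i₀ v l i p - v i p + M * g (p.1 i₀)) ≤ B * κ :=
    mul_le_mul_of_nonneg_left (by linarith) hB0
  have h3 : κ * (-1) ≤ κ * (p.2 - c.2) := mul_le_mul_of_nonneg_left h1 hκ0.le
  refine le_of_mul_le_mul_left ?_ hM
  have h4 : κ * Q = B * κ + 2 * κ + 2 * (κ * N) := by rw [hQ]; ring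
  have h5 : κ * (2 * (p.2 - c.2) - 2 * N) = 2 * (κ * (p.2 - c.2)) - 2 * (κ * N) := by ring
  rw [h5] at hmax
  have h6 : M * (g (p.1 i₀) * ∑ j, fderivWithin ℝ (f i) (orthant m) ξ (Pi.single j 1) + ε) =
      M * g (p.1 i₀) * ∑ j, fderivWithin ℝ (f i) (orthant m) ξ (Pi.single j 1) + M * ε := by ring
  rw [h6]
  linarith

end NearMaximum

section BadPlanes

variable {N m : ℕ} {i₀ : Fin N} {f : Fin m → (Fin m → ℝ) → ℝ}
  {v : Fin m → EuclideanSpace ℝ (Fin N) × ℝ → ℝ} {l : ℝ}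

/-- The reflected solution fails to dominate somewhere in the strip `0 ≤ x i₀ ≤ l`. -/
def IsBadPlane (i₀ : Fin N) (v : Fin m → EuclideanSpace ℝ (Fin N) × ℝ → ℝ) (l : ℝ) : Prop :=
  ∃ i, ∃ z : EuclideanSpace ℝ (Fin N) × ℝ, 0 ≤ z.1 i₀ ∧ z.1 i₀ ≤ l ∧ mirror i₀ v l i z < v i z

theorem IsOddMild.exists_bad_point (hv : IsOddMild i₀ f v)
    (hf : ∀ i, ContDiffOn ℝ 1 (f i) (orthant m)) (H1 : ∀ i, f i 0 = 0) (H2 : Cooperative f)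
    {C R Λ : ℝ} (hC : ∀ i z, |v i z| ≤ C)
    (hR : ∀ i (ξ : Fin m → ℝ), (∀ k, 0 ≤ ξ k ∧ ξ k ≤ C) →
      ∑ j, fderivWithin ℝ (f i) (orthant m) ξ (Pi.single j 1) ≤ R) :
    ∃ θ < 1, ∀ l, 0 < l → l ≤ Λ → IsBadPlane i₀ v l →
      ∃ i, ∃ p : EuclideanSpace ℝ (Fin N) × ℝ, ∃ ξ : Fin m → ℝ, 0 < p.1 i₀ ∧ p.1 i₀ ≤ θ * l ∧
      mirror i₀ v l i p < v i p ∧ (∀ j, 0 ≤ ξ j ∧ ξ j ≤ max (mirror i₀ v l j p) (v j p)) ∧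
      1 ≤ 3 * l ^ 2 * ∑ j, fderivWithin ℝ (f i) (orthant m) ξ (Pi.single j 1) := by
  obtain ⟨q, hq⟩ := exists_nat_ge (6 * Λ ^ 2 * R)
  refine ⟨1 - 1 / (2 * (q + 1)), by simp; positivity, fun l hl hlΛ hbad => ?_⟩
  have hdiv : ∀ s : ℝ, HasDerivAt (fun s => s / l) (1 / l) s := fun s => (hasDerivAt_id s).div_const l
  obtain ⟨i, p, ξ, hp0, hpl, hneg, hξ, h⟩ := hv.exists_near_max (l := l) (ε := 1 / l ^ 2) hf H1 H2
    (g := fun s => 3 - (s / l) ^ 2 - (s / l) ^ (q + 2))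
    (g' := fun s => - (2 / l * (s / l)) - (q + 2) / l * (s / l) ^ (q + 1))
    (g'' := fun s => - (2 / l ^ 2) - (q + 2) * (q + 1) / l ^ 2 * (s / l) ^ q)
    (fun s => by
      refine ((((hdiv s).pow 2).const_sub 3).sub ((hdiv s).pow (q + 2))).congr_deriv ?_
      simp only [Nat.add_one_sub_one, Nat.cast_ofNat]
      push_cast
      ring_nf)
    (fun s => by
      refine ((((hdiv s).const_mul (2 / l)).neg).sub
        (((hdiv s).pow (q + 1)).const_mul ((q + 2) / l))).congr_deriv ?_
      simp only [Nat.add_one_sub_one]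
      push_cast
      field_simp)
    (fun s h0 hs => by
      have h1 : 0 ≤ s / l := by positivity
      have h2 : s / l ≤ 1 := (div_le_one hl).2 hs
      have h3 := pow_le_one₀ (n := 2) h1 h2
      have h4 := pow_le_one₀ (n := q + 2) h1 h2
      linarith)
    (fun s h0 hs => by
      have h1 : 0 ≤ s / l := by positivity
      have h3 := pow_nonneg h1 2
      have h4 := pow_nonneg h1 (q + 2)
      linarith)
    hbad (by positivity)
  set S := ∑ j, fderivWithin ℝ (f i) (orthant m) ξ (Pi.single j 1) with hS
  set y := p.1 i₀ / l with hy
  have hy0 : 0 < y := by positivity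
  have hy1 : y ≤ 1 := (div_le_one hl).2 hpl.le
  set G := 3 - y ^ 2 - y ^ (q + 2) with hG
  have hG1 : 1 ≤ G := by
    have h3 := pow_le_one₀ (n := 2) hy0.le hy1
    have h4 := pow_le_one₀ (n := q + 2) hy0.le hy1
    linarith
  have hG3 : G ≤ 3 := by
    have h3 := pow_nonneg hy0.le 2
    have h4 := pow_nonneg hy0.le (q + 2)
    linarith
  have hl2 : 0 < l ^ 2 := by positivity
  have h1 : 1 + (q + 2) * (q + 1) * y ^ q ≤ l ^ 2 * (G * S) := by
    have h2 := mul_le_mul_of_nonneg_left h hl2.le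
    have h3 : l ^ 2 * -(-(2 / l ^ 2) - (q + 2) * (q + 1) / l ^ 2 * y ^ q) =
        2 + (q + 2) * (q + 1) * y ^ q := by field_simp; ring
    have h4 : l ^ 2 * (G * S + 1 / l ^ 2) = l ^ 2 * (G * S) + 1 := by field_simp
    rw [h3, h4] at h2
    linarith
  have h5 : 0 ≤ (q + 2) * (q + 1) * y ^ q := by positivity
  have hS0 : 0 < S := by
    have : 0 < l ^ 2 * (G * S) := by linarith
    have := pos_of_mul_pos_right this hl2.le
    exact pos_of_mul_pos_right this (by linarith)
  have h6 : l ^ 2 * (G * S) ≤ 3 * l ^ 2 * S := by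
    have := mul_le_mul_of_nonneg_right hG3 hS0.le
    nlinarith
  have hξC : ∀ k, 0 ≤ ξ k ∧ ξ k ≤ C := fun k => ⟨(hξ k).1, (hξ k).2.trans
    (max_le ((neg_le_abs _).trans (hC k _)) ((le_abs_self _).trans (hC k _)))⟩
  have hSR := hR i ξ hξC
  refine ⟨i, p, ξ, hp0, ?_, hneg, hξ, by linarith⟩
  rw [← div_le_iff₀ hl]
  by_contra! hcon
  have h7 := one_add_mul_le_pow (a := -(1 / (2 * ((q : ℝ) + 1)))) (by
    have : 1 / (2 * ((q : ℝ) + 1)) ≤ 1 := by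
      rw [div_le_one (by positivity)]; have : (0 : ℝ) ≤ q := Nat.cast_nonneg q; linarith
    linarith) q
  have h8 : (1 : ℝ) / 2 ≤ 1 + q * -(1 / (2 * ((q : ℝ) + 1))) := by
    have : (q : ℝ) * (1 / (2 * ((q : ℝ) + 1))) ≤ 1 / 2 := by
      rw [mul_one_div, div_le_div_iff₀ (by positivity) (by norm_num)]; linarith
    linarith
  have h9 : (1 + -(1 / (2 * ((q : ℝ) + 1)))) ^ q ≤ y ^ q := by
    refine pow_le_pow_left₀ ?_ (by linarith) q
    have : 1 / (2 * ((q : ℝ) + 1)) ≤ 1 := by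
      rw [div_le_one (by positivity)]; have : (0 : ℝ) ≤ q := Nat.cast_nonneg q; linarith
    linarith
  have hq0 : (0 : ℝ) ≤ q := Nat.cast_nonneg q
  have h10 : ((q : ℝ) + 2) * (1 / 2) ≤ (q + 2) * (q + 1) * y ^ q := by
    rw [mul_assoc]
    refine mul_le_mul_of_nonneg_left ?_ (by linarith)
    nlinarith
  have h11 : 3 * l ^ 2 * S ≤ 3 * Λ ^ 2 * R := by
    have : l ^ 2 ≤ Λ ^ 2 := pow_le_pow_left₀ hl.le hlΛ 2
    have := mul_le_mul this hSR hS0.le (by positivity)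
    linarith
  linarith

end BadPlanes

section NoBadPlanes

variable {N m : ℕ} {i₀ : Fin N} {f : Fin m → (Fin m → ℝ) → ℝ}
  {v : Fin m → EuclideanSpace ℝ (Fin N) × ℝ → ℝ}

theorem tendsto_mirror {a b : ℕ → EuclideanSpace ℝ (Fin N) × ℝ}
    {w : Fin m → EuclideanSpace ℝ (Fin N) × ℝ → ℝ}
    (hlim : ∀ i z, ∀ b : ℕ → EuclideanSpace ℝ (Fin N) × ℝ, Tendsto b atTop (𝓝 z) →
      Tendsto (fun n => v i (b n + a n)) atTop (𝓝 (w i z))) {μ : ℕ → ℝ} {l : ℝ}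
    (hμ : Tendsto μ atTop (𝓝 l)) {z : EuclideanSpace ℝ (Fin N) × ℝ} (hb : Tendsto b atTop (𝓝 z))
    (i : Fin m) :
    Tendsto (fun n => mirror i₀ v (μ n) i (b n + a n)) atTop (𝓝 (mirror i₀ w l i z)) := by
  unfold mirror
  have h1 : Tendsto (fun n => ((-(2 * μ n) • ee i₀, 0) : EuclideanSpace ℝ (Fin N) × ℝ)) atTop
      (𝓝 (-(2 * l) • ee i₀, 0)) :=
    (((hμ.const_mul 2).neg).smul_const (ee i₀)).prodMk_nhds tendsto_const_nhds
  refine ((hlim i _ _ (hb.add h1)).congr fun n => ?_).neg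
  rw [add_right_comm]

theorem IsOddMild.le_mirror_of_forall_lt (hv : IsOddMild i₀ f v) {l : ℝ}
    (h : ∀ μ, 0 < μ → μ < l → ¬ IsBadPlane i₀ v μ) (i : Fin m)
    {z : EuclideanSpace ℝ (Fin N) × ℝ} (h0 : 0 ≤ z.1 i₀) (hl : z.1 i₀ ≤ l) :
    v i z ≤ mirror i₀ v l i z := by
  rcases hl.eq_or_lt with hl | hl
  · exact (hv.mirror_eq_self hl i).ge
  have hc : Continuous fun μ : ℝ => mirror i₀ v μ i z := ((hv.cont i).comp (by fun_prop)).neg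
  refine ge_of_tendsto (hc.continuousWithinAt (s := Iio l) (x := l)) ?_
  filter_upwards [Ioo_mem_nhdsLT hl] with μ hμ
  by_contra! hlt
  exact h μ (h0.trans_lt hμ.1) hμ.2 ⟨i, z, h0, hμ.1.le, hlt⟩

theorem IsOddMild.not_isBadPlane (hv : IsOddMild i₀ f v)
    (hf : ∀ i, ContDiffOn ℝ 1 (f i) (orthant m)) (H1 : ∀ i, f i 0 = 0) (H2 : Cooperative f)
    (H3 : ∀ i, ∑ j, fderivWithin ℝ (f i) (orthant m) 0 (Pi.single j 1) ≤ 0)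
    (hpos : ∀ w, IsOddMild i₀ f w →
      (∃ i, ∃ z : EuclideanSpace ℝ (Fin N) × ℝ, 0 < z.1 i₀ ∧ w i z ≠ 0) →
      ∀ i (z : EuclideanSpace ℝ (Fin N) × ℝ), 0 < z.1 i₀ → 0 < w i z)
    {l : ℝ} (hl : 0 < l) : ¬ IsBadPlane i₀ v l := by
  intro hbad
  obtain ⟨C, hC⟩ := hv.bdd
  obtain ⟨B, hB0, hB⟩ := exists_bound_fderivWithin_orthant hf C
  have hR : ∀ i (ξ : Fin m → ℝ), (∀ k, 0 ≤ ξ k ∧ ξ k ≤ C) →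
      ∑ j, fderivWithin ℝ (f i) (orthant m) ξ (Pi.single j 1) ≤ m * B := fun i ξ hξ => by
    refine (Finset.sum_le_sum fun j _ => (le_abs_self _).trans (hB i j ξ hξ)).trans ?_
    simp
  let S : Set ℝ := {μ | 0 < μ ∧ IsBadPlane i₀ v μ}
  have hSb : BddBelow S := ⟨0, fun μ hμ => hμ.1.le⟩
  obtain ⟨μ, hμa, hμ, hμS⟩ := exists_seq_tendsto_sInf (S := S) ⟨l, hl, hbad⟩ hSb
  set lam := sInf S with hlam
  have hgood : ∀ μ, 0 < μ → μ < lam → ¬ IsBadPlane i₀ v μ := fun μ h0 h1 h2 =>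
    (csInf_le hSb (show μ ∈ S from ⟨h0, h2⟩)).not_gt h1
  obtain ⟨θ, hθ1, hθ⟩ := hv.exists_bad_point (Λ := μ 0) hf H1 H2 hC hR
  choose i p ξ hp0 hpθ hneg hξ hS using
    fun n => hθ (μ n) (hμS n).1 (hμa (Nat.zero_le n)) (hμS n).2
  have hξC : ∀ n k, 0 ≤ ξ n k ∧ ξ n k ≤ C := fun n k => by
    refine ⟨(hξ n k).1, (hξ n k).2.trans (max_le ?_ ((le_abs_self _).trans (hC _ _)))⟩
    refine (le_abs_self _).trans ?_
    rw [mirror, abs_neg]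
    exact hC _ _
  have hlam0 : 0 < lam := by
    have h1 : ∀ n, 1 ≤ 3 * μ n ^ 2 * (m * B) := fun n =>
      (hS n).trans (mul_le_mul_of_nonneg_left (hR _ _ (hξC n)) (by positivity))
    have h2 : 1 ≤ 3 * lam ^ 2 * (m * B) :=
      ge_of_tendsto (((hμ.pow 2).const_mul 3).mul_const _) (Eventually.of_forall h1)
    have h3 : 0 ≤ lam := ge_of_tendsto hμ (Eventually.of_forall fun n => (hμS n).1.le)
    refine h3.lt_of_ne fun h => ?_
    rw [← h] at h2
    norm_num at h2
  have hpΛ : ∀ n, (p n).1 i₀ ∈ Icc 0 (μ 0) := fun n =>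
    ⟨(hp0 n).le, (hpθ n).trans ((mul_le_of_le_one_left (hμS n).1.le hθ1.le).trans
      (hμa (Nat.zero_le n)))⟩
  have hK : IsCompact ((univ : Set (Fin m)) ×ˢ (Icc (0 : ℝ) (μ 0) ×ˢ
      Set.pi univ fun _ : Fin m => Icc (0 : ℝ) C)) :=
    isCompact_univ.prod (isCompact_Icc.prod (isCompact_univ_pi fun _ => isCompact_Icc))
  obtain ⟨⟨i', s, ζ⟩, ⟨-, hs, hζ⟩, ψ, hψ, hlim⟩ := hK.tendsto_subseq
    (x := fun n => (i n, (p n).1 i₀, ξ n))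
    fun n => ⟨mem_univ _, hpΛ n, fun k _ => hξC n k⟩
  rw [nhds_prod_eq, nhds_prod_eq, nhds_discrete, tendsto_prod_iff', tendsto_prod_iff'] at hlim
  obtain ⟨hi, hs', hζ'⟩ := hlim
  rw [tendsto_pure] at hi
  simp only [Function.comp_apply] at hi hs' hζ'
  obtain ⟨w, φ, hφ, hw, hvw⟩ := hv.exists_limit_translate hf
    (a := fun n => p (ψ n) - ((p (ψ n)).1 i₀ • ee i₀, 0)) fun n => by simp
  set τ := fun n => ψ (φ n) with hτ
  have hφt := hφ.tendsto_atTop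
  have hτt : Tendsto τ atTop atTop := hψ.tendsto_atTop.comp hφt
  set q : EuclideanSpace ℝ (Fin N) × ℝ := (s • ee i₀, 0) with hq
  have hq0 : q.1 i₀ = s := by simp [hq]
  have hb : Tendsto (fun n => (((p (τ n)).1 i₀ • ee i₀, 0) : EuclideanSpace ℝ (Fin N) × ℝ)) atTop
      (𝓝 q) := ((hs'.comp hφt).smul_const _).prodMk_nhds tendsto_const_nhds
  have hμτ := hμ.comp hτt
  have hlv : ∀ j, Tendsto (fun n => v j (p (τ n))) atTop (𝓝 (w j q)) := fun j =>
    (hvw j q _ hb).congr fun n => by rw [add_sub_cancel]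
  have hlm : ∀ j, Tendsto (fun n => mirror i₀ v (μ (τ n)) j (p (τ n))) atTop
      (𝓝 (mirror i₀ w lam j q)) := fun j =>
    (tendsto_mirror hvw hμτ hb j).congr fun n => by rw [add_sub_cancel]; rfl
  have hs1 : s < lam := by
    have h1 : s ≤ θ * lam := le_of_tendsto_of_tendsto' (hs'.comp hφt) (hμτ.const_mul θ)
      fun n => hpθ _
    nlinarith
  have hiτ : ∀ᶠ n in atTop, i (τ n) = i' := hφt.eventually hi
  have hwq : mirror i₀ w lam i' q ≤ w i' q := by
    refine le_of_tendsto_of_tendsto (hlm i') (hlv i') ?_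
    filter_upwards [hiτ] with n hn
    rw [← hn]
    exact (hneg _).le
  have hζw : ∀ j, ζ j ≤ max (mirror i₀ w lam j q) (w j q) := fun j =>
    le_of_tendsto_of_tendsto' ((tendsto_pi_nhds.1 (hζ'.comp hφt)) j) ((hlm j).max (hlv j))
      fun n => (hξ _ j).2
  have hζ0 : ∀ j, 0 ≤ ζ j := fun j => (hζ j (mem_univ _)).1
  have hSζ : 1 ≤ 3 * lam ^ 2 * ∑ j, fderivWithin ℝ (f i') (orthant m) ζ (Pi.single j 1) := by
    have hc := (hf i').continuousOn_fderivWithin (uniqueDiffOn_orthant m) le_rfl ζ hζ0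
    have h1 : Tendsto (fun n => ξ (τ n)) atTop (𝓝[orthant m] ζ) :=
      tendsto_nhdsWithin_iff.2 ⟨hζ'.comp hφt, Eventually.of_forall fun n j => (hξC _ j).1⟩
    have h2 := hc.tendsto.comp h1
    refine ge_of_tendsto (((hμτ.pow 2).const_mul 3).mul
      (tendsto_finsetSum _ fun j _ => ((ContinuousLinearMap.apply ℝ ℝ (Pi.single j 1)).continuous.tendsto _).comp h2)) ?_
    filter_upwards [hiτ] with n hn
    rw [← hn]
    exact hS _
  have hζne : ∃ j, 0 < ζ j := by
    by_contra! h
    have h0 : ζ = 0 := funext fun j => le_antisymm (h j) (hζ0 j)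
    rw [h0] at hSζ
    nlinarith [H3 i', sq_nonneg lam]
  have hwne : ∃ j, ∃ z : EuclideanSpace ℝ (Fin N) × ℝ, 0 < z.1 i₀ ∧ w j z ≠ 0 := by
    obtain ⟨j, hj⟩ := hζne
    rcases lt_max_iff.1 (hj.trans_le (hζw j)) with h | h
    · rw [hw.mirror_eq_of_eq rfl] at h
      refine ⟨j, _, ?_, h.ne'⟩
      simp [hq]
      linarith
    · refine ⟨j, q, ?_, h.ne'⟩
      rw [hq0]
      refine hs.1.lt_of_ne fun h0 => h.ne' (hw.eq_zero j ?_)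
      exact hq0.trans h0.symm
  have hwgood : ∀ κ, 0 < κ → κ < lam → ¬ IsBadPlane i₀ w κ := by
    rintro κ h0 h1 ⟨j, z, hz0, hzκ, hz⟩
    refine hz.not_ge (le_of_tendsto_of_tendsto' (hvw j z _ tendsto_const_nhds)
      (tendsto_mirror hvw tendsto_const_nhds tendsto_const_nhds j) fun n => ?_)
    by_contra! hlt
    exact hgood κ h0 h1 ⟨j, _, by simpa using hz0, by simpa using hzκ, hlt⟩
  obtain ⟨ε, hε, α, hα, h⟩ := hw.exists_barrier hf H1 H2 hlam0 (hpos w hw hwne)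
    (fun j z h0 h1 => hw.le_mirror_of_forall_lt hwgood j h0 h1) i'
    (x := lam • ee i₀) (by simp) 0
  have h1 := h (lam - s) (by linarith) (by linarith [hs.1])
  rw [show ((lam • ee i₀ - (lam - s) • ee i₀, 0) : EuclideanSpace ℝ (Fin N) × ℝ) = q by
    rw [hq, ← sub_smul, sub_sub_cancel]] at h1
  have h2 : exp (-α * (2 * lam) ^ 2) < exp (-α * (2 * lam - (lam - s)) ^ 2) := by
    rw [exp_lt_exp]
    have : (2 * lam - (lam - s)) ^ 2 < (2 * lam) ^ 2 := by nlinarith [hs.1]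
    nlinarith
  have h3 := mul_pos hε (sub_pos.2 h2)
  linarith

end NoBadPlanes

section Monotonicity

variable {N m : ℕ} {i₀ : Fin N} {f : Fin m → (Fin m → ℝ) → ℝ}
  {v : Fin m → EuclideanSpace ℝ (Fin N) × ℝ → ℝ}

theorem IsOddMild.fderiv_pos (hv : IsOddMild i₀ f v)
    (hf : ∀ i, ContDiffOn ℝ 1 (f i) (orthant m)) (H1 : ∀ i, f i 0 = 0) (H2 : Cooperative f)
    (hpos : ∀ i (z : EuclideanSpace ℝ (Fin N) × ℝ), 0 < z.1 i₀ → 0 < v i z)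
    {x : EuclideanSpace ℝ (Fin N)} (hx : 0 < x i₀) (hbad : ¬ IsBadPlane i₀ v (x i₀))
    (i : Fin m) (t : ℝ) : 0 < fderiv ℝ (fun y => v i (y, t)) x (ee i₀) := by
  obtain ⟨ε, hε, α, hα, h⟩ := hv.exists_barrier hf H1 H2 hx hpos
    (fun j z h0 h1 => by by_contra! hlt; exact hbad ⟨j, z, h0, h1, hlt⟩) i rfl t
  set l := x i₀ with hl
  set D := fderiv ℝ (fun y => v i (y, t)) x with hD
  have hd : HasFDerivAt (fun y => v i (y, t)) D x :=
    ((hv.contDiff_two hf i t).differentiable two_ne_zero x).hasFDerivAt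
  have hd1 : HasDerivAt (fun r : ℝ => v i (x + r • ee i₀, t)) (D (ee i₀)) 0 := by
    have h1 : HasDerivAt (fun r : ℝ => x + r • ee i₀) ((1 : ℝ) • ee i₀) 0 :=
      ((hasDerivAt_id (0 : ℝ)).smul_const (ee i₀)).const_add x
    rw [one_smul] at h1
    exact HasFDerivAt.comp_hasDerivAt (0 : ℝ) (by simpa using hd) h1
  have hd2 : HasDerivAt (fun r : ℝ => v i (x - r • ee i₀, t)) (-D (ee i₀)) 0 := by
    have h1 : HasDerivAt (fun r : ℝ => x - r • ee i₀) (-((1 : ℝ) • ee i₀)) 0 :=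
      ((hasDerivAt_id (0 : ℝ)).smul_const (ee i₀)).const_sub x
    rw [one_smul] at h1
    rw [← map_neg]
    exact HasFDerivAt.comp_hasDerivAt (0 : ℝ) (by simpa using hd) h1
  have hd3 : HasDerivAt (fun r : ℝ => exp (-α * (2 * l - r) ^ 2))
      (exp (-α * (2 * l) ^ 2) * (4 * α * l)) 0 := by
    have h1 : HasDerivAt (fun r : ℝ => 2 * l - r) (-1) 0 := (hasDerivAt_id (0 : ℝ)).const_sub _
    refine (((h1.pow 2).const_mul (-α)).exp).congr_deriv ?_
    simp
    ring
  have hd4 := (hd1.sub hd2).sub ((hd3.sub_const (exp (-α * (2 * l) ^ 2))).const_mul ε)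
  have hnn : 0 ≤ D (ee i₀) - -D (ee i₀) - ε * (exp (-α * (2 * l) ^ 2) * (4 * α * l)) := by
    have h1 := hd4.hasDerivWithinAt (s := Ioi (0 : ℝ))
    rw [hasDerivWithinAt_iff_tendsto_slope' (by simp)] at h1
    refine ge_of_tendsto h1 ?_
    filter_upwards [Ioo_mem_nhdsGT hx] with r hr
    have h2 := h r hr.1.le hr.2.le
    rw [hv.mirror_eq_of_eq (w := (x + r • ee i₀, t))] at h2
    · rw [slope_def_field]
      refine div_nonneg ?_ (by linarith [hr.1])
      rw [neg_mul, neg_mul] at h2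
      simp
      linarith
    · refine Prod.ext ?_ rfl
      ext k
      by_cases h : k = i₀
      · subst h; simp [← hl]; ring
      · simp [coordRefl_apply, ee_apply, h]
  have : 0 < ε * (exp (-α * (2 * l) ^ 2) * (4 * α * l)) := by positivity
  linarith

end Monotonicity

end

/-- monotonicity in `x_1` of nontrivial, nonnegative, bounded solutions
of the cooperative system (C) in a half-space, under hypotheses (H1)-(H4). -/
theorem monotonicity_cooperative_half_space
    (N m : ℕ) (hN : 0 < N) (hm : 2 ≤ m)
    (f : Fin m → (Fin m → ℝ) → ℝ)
    (hf : ∀ i, ContDiffOn ℝ 1 (f i) {v : Fin m → ℝ | ∀ j, 0 ≤ v j})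
    (H1 : ∀ i, f i 0 = 0)
    (H2 : ∀ i j, i ≠ j → ∀ v : Fin m → ℝ, (∀ k, 0 ≤ v k) →
      0 ≤ fderivWithin ℝ (f i) {v : Fin m → ℝ | ∀ j, 0 ≤ v j} v (Pi.single j 1))
    (H3 : ∀ i, ∑ j,
      fderivWithin ℝ (f i) {v : Fin m → ℝ | ∀ j, 0 ≤ v j} 0 (Pi.single j 1) ≤ 0)
    (H4 : ∀ v : Fin m → EuclideanSpace ℝ (Fin N) → ℝ → ℝ,
      IsBddNonnegSolC hN f v → IsNontrivialC hN v →
      ∀ i (x : EuclideanSpace ℝ (Fin N)) (t : ℝ), 0 < x ⟨0, hN⟩ → 0 < v i x t)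
    (u : Fin m → EuclideanSpace ℝ (Fin N) → ℝ → ℝ)
    (hu : IsBddNonnegSolC hN f u)
    (hunt : IsNontrivialC hN u) :
    ∀ i (x : EuclideanSpace ℝ (Fin N)) (t : ℝ), 0 < x ⟨0, hN⟩ →
      0 < fderiv ℝ (fun y => u i y t) x (EuclideanSpace.single ⟨0, hN⟩ 1) := by
  intro i x t hx
  have hv := hu.isOddMild (fun i => (hf i).continuousOn) H1
  have hpos : ∀ w, IsOddMild ⟨0, hN⟩ f w →
      (∃ i, ∃ z : EuclideanSpace ℝ (Fin N) × ℝ, 0 < z.1 ⟨0, hN⟩ ∧ w i z ≠ 0) →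
      ∀ i (z : EuclideanSpace ℝ (Fin N) × ℝ), 0 < z.1 ⟨0, hN⟩ → 0 < w i z :=
    fun w hw ⟨i, z, hz, hne⟩ j y hy =>
      H4 _ (hw.isBddNonnegSolC hf H1) ⟨i, z.1, z.2, hz, hne⟩ j y.1 y.2 hy
  have hvne : ∃ i, ∃ z : EuclideanSpace ℝ (Fin N) × ℝ, 0 < z.1 ⟨0, hN⟩ ∧
      oddExt ⟨0, hN⟩ u i z ≠ 0 := by
    obtain ⟨i, x, t, hx, hne⟩ := hunt
    exact ⟨i, (x, t), hx, by rwa [oddExt_of_pos hx]⟩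
  have h := hv.fderiv_pos hf H1 H2 (hpos _ hv hvne) hx
    (hv.not_isBadPlane hf H1 H2 H3 hpos hx) i t
  have heq : (fun y => oddExt ⟨0, hN⟩ u i (y, t)) =ᶠ[nhds x] fun y => u i y t := by
    have hc : Continuous fun y : EuclideanSpace ℝ (Fin N) => y ⟨0, hN⟩ := by fun_prop
    filter_upwards [(isOpen_lt continuous_const hc).mem_nhds hx] with y hy
    exact oddExt_of_pos hy
  rwa [heq.fderiv_eq] at h
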